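/- Let k ≥ 5 be an integer, λ a fixed nonzero real number, 0 < δ < 1, and ε > 0. There is a constant C such that for all sufficiently large X and all τ with 0 < τ < 1, ∫_ℝ |S_k(λα)|^{m(k)} K_τ(α) dα ≤ C τ X^{m(k)/k − δ + ε}, where m(k) = 2⌈(kδ + 1 − ⌊kδ⌋)·2^{⌊kδ−1⌋}⌉ if ⌊kδ⌋ ≤ 3, m(k) = 2⌈7kδ − 20⌉ if ⌊kδ⌋ = 4, and m(k) = 2⌈(kδ − ⌊kδ⌋/2)(⌊kδ⌋ + 1)⌉ if ⌊kδ⌋ ≥ 5. -/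

import Mathlib

open MeasureTheory Finset
open scoped Classical

/-- `e(x) = exp(2πix)`. -/
noncomputable def e (x : ℝ) : ℂ := Complex.exp (2 * Real.pi * Complex.I * x)

/-- Fejér-type kernel `K_τ(α)`. -/
noncomputable def Kf (τ α : ℝ) : ℝ :=
  if α = 0 then τ ^ 2 else (Real.sin (Real.pi * τ * α) / (Real.pi * α)) ^ 2

/-- `ψ(m,z) = 1` if every prime factor of `m` is `≥ z`, else `0`. -/
noncomputable def psi (m : ℕ) (z : ℝ) : ℝ :=
  if ∀ p : ℕ, p.Prime → p ∣ m → z ≤ (p : ℝ) then 1 else 0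

/-- `z(p)` in the sieve weights. -/
noncomputable def zP (X : ℝ) (p : ℕ) : ℝ :=
  if (p : ℝ) < X ^ ((1:ℝ)/7) then X ^ ((5:ℝ)/28) * (p : ℝ) ^ (-(1:ℝ)/2)
  else if (p : ℝ) ≤ X ^ ((3:ℝ)/14) then (p : ℝ)
  else X ^ ((5:ℝ)/14) / (p : ℝ)

/-- The sieve function `ρ(m)` of Harman–Kumchev. -/
noncomputable def rho (X : ℝ) (m : ℕ) : ℝ :=
  psi m (X ^ ((5:ℝ)/42)) -
    ∑ p ∈ m.primeFactors.filter
        (fun p : ℕ => X ^ ((5:ℝ)/42) ≤ (p:ℝ) ∧ (p:ℝ) ≤ X ^ ((1:ℝ)/4)),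
      psi (m / p) (zP X p)

/-- `S_k(α) = Σ_{p ∈ [(ηX)^{1/k}, X^{1/k}]} (log p) e(p^k α)`, sum over primes. -/
noncomputable def SS (η X : ℝ) (k : ℕ) (α : ℝ) : ℂ :=
  ∑ p ∈ (Finset.Icc 1 ⌊X ^ ((1:ℝ)/(k:ℝ))⌋₊).filter
      (fun p : ℕ => p.Prime ∧ (η * X) ^ ((1:ℝ)/(k:ℝ)) ≤ (p : ℝ)),
    (Real.log p : ℂ) * e ((p : ℝ) ^ k * α)

/-- `S₂(α, ρ) = Σ_{m ∈ [(ηX)^{1/2}, X^{1/2}]} ρ(m) e(m²α)`. -/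
noncomputable def S2 (η X α : ℝ) : ℂ :=
  ∑ m ∈ (Finset.Icc 1 ⌊X ^ ((1:ℝ)/2)⌋₊).filter
      (fun m : ℕ => (η * X) ^ ((1:ℝ)/2) ≤ (m : ℝ)),
    (rho X m : ℂ) * e ((m : ℝ) ^ 2 * α)

/-- `S_r(α)` for real `r ≥ 1`. -/
noncomputable def Sr (η X r α : ℝ) : ℂ :=
  ∑ p ∈ (Finset.Icc 1 ⌊X ^ (1/r)⌋₊).filter
      (fun p : ℕ => p.Prime ∧ (η * X) ^ (1/r) ≤ (p : ℝ)),
    (Real.log p : ℂ) * e ((p : ℝ) ^ r * α)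

/-- `U_r(α)` for real `r ≥ 1`. -/
noncomputable def Ur (η X r α : ℝ) : ℂ :=
  ∑ n ∈ (Finset.Icc 1 ⌊X ^ (1/r)⌋₊).filter
      (fun n : ℕ => (η * X) ^ (1/r) ≤ (n : ℝ)),
    e ((n : ℝ) ^ r * α)

/-- Chebyshev's function `θ(x) = Σ_{p ≤ x} log p`. -/
noncomputable def theta (x : ℝ) : ℝ :=
  ∑ p ∈ (Finset.Icc 1 ⌊x⌋₊).filter Nat.Prime, Real.log p

/-- `J_r(X,h)`. -/
noncomputable def J (ε r X h : ℝ) : ℝ :=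
  ∫ x in Set.Icc (ε * X) X,
    (theta ((x + h) ^ (1/r)) - theta (x ^ (1/r)) - ((x + h) ^ (1/r) - x ^ (1/r))) ^ 2

/-- `T_n(α) = ∫_{(ηX)^{1/n}}^{X^{1/n}} e(t^n α) dt`. -/
noncomputable def T (η X : ℝ) (n : ℕ) (α : ℝ) : ℂ :=
  ∫ t in Set.Icc ((η * X) ^ ((1:ℝ)/(n:ℝ))) (X ^ ((1:ℝ)/(n:ℝ))), e (t ^ n * α)

/-- `m₁(k)`. -/
noncomputable def m1 (k : ℕ) : ℝ :=
  if k = 5 then 2 * (⌈343 * (k:ℝ) / 50 - 20⌉ : ℝ)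
  else 2 * (⌈(49 * (k:ℝ) / 50 - (⌊49 * (k:ℝ) / 50⌋ : ℝ) / 2)
      * ((⌊49 * (k:ℝ) / 50⌋ : ℝ) + 1)⌉ : ℝ)

/-- `σ(k) = 44/45 − 24/(25 m₁(k))`. -/
noncomputable def sigma' (k : ℕ) : ℝ := 44/45 - 24 / (25 * m1 k)

/-- `m(k)` depending on `δ`. -/
noncomputable def mδ (k : ℕ) (δ : ℝ) : ℝ :=
  if ⌊(k:ℝ) * δ⌋ ≤ 3 then
    2 * (⌈((k:ℝ) * δ + 1 - (⌊(k:ℝ) * δ⌋ : ℝ)) * (2:ℝ) ^ (⌊(k:ℝ) * δ - 1⌋)⌉ : ℝ)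
  else if ⌊(k:ℝ) * δ⌋ = 4 then 2 * (⌈7 * (k:ℝ) * δ - 20⌉ : ℝ)
  else 2 * (⌈((k:ℝ) * δ - (⌊(k:ℝ) * δ⌋ : ℝ)/2) * ((⌊(k:ℝ) * δ⌋ : ℝ) + 1)⌉ : ℝ)

/-- `m₂(k)`. -/
noncomputable def m2 (k : ℕ) : ℝ :=
  if k = 5 then
    2 * (⌈(2 * (k:ℝ)/3 + 1 - (⌊2 * (k:ℝ)/3⌋ : ℝ)) * (2:ℝ) ^ (⌊2 * (k:ℝ)/3⌋ - 1)⌉ : ℝ)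
  else if k ≤ 7 then 2 * (⌈14 * (k:ℝ)/3 - 20⌉ : ℝ)
  else 2 * (⌈(2 * (k:ℝ)/3 - (⌊2 * (k:ℝ)/3⌋ : ℝ)/2) * ((⌊2 * (k:ℝ)/3⌋ : ℝ) + 1)⌉ : ℝ)

namespace VMV
open Polynomial

section basics
variable (p : ℕ) [hp : Fact p.Prime]

/-- additive character `z ↦ e(z/p^M)` of the p-adic integers -/
noncomputable def ps (M : ℕ) : AddChar ℤ_[p] ℂ :=
  (ZMod.stdAddChar (N := p ^ M)).compAddMonoidHom (PadicInt.toZModPow M).toAddMonoidHom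

lemma ps_apply (M : ℕ) (z : ℤ_[p]) :
    ps p M z = ZMod.stdAddChar (N := p ^ M) (PadicInt.toZModPow M z) := rfl

lemma ps_eq_one (M : ℕ) (z : ℤ_[p]) : ps p M z = 1 ↔ (p : ℤ_[p]) ^ M ∣ z := by
  rw [ps_apply, ← AddChar.map_zero_eq_one (ZMod.stdAddChar (N := p ^ M)),
    (ZMod.injective_stdAddChar (N := p ^ M)).eq_iff, ← RingHom.mem_ker, PadicInt.ker_toZModPow,
    Ideal.mem_span_singleton]

lemma ps_shift (M i : ℕ) (z : ℤ_[p]) : ps p (M + i) ((p : ℤ_[p]) ^ i * z) = ps p M z := by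
  obtain ⟨n, y, rfl⟩ : ∃ (n : ℕ) (y : ℤ_[p]), z = n + (p : ℤ_[p]) ^ M * y := by
    refine ⟨(PadicInt.toZModPow M z).val, ?_⟩
    have : z - ((PadicInt.toZModPow M z).val : ℤ_[p]) ∈ RingHom.ker (PadicInt.toZModPow (p := p) M) := by
      rw [RingHom.mem_ker, map_sub, map_natCast, ZMod.natCast_zmod_val, sub_self]
    rw [PadicInt.ker_toZModPow, Ideal.mem_span_singleton] at this
    obtain ⟨y, hy⟩ := this
    exact ⟨y, by rw [← hy]; ring⟩
  have h1 : (p : ℤ_[p]) ^ i * (n + (p : ℤ_[p]) ^ M * y)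
      = ((p ^ i * n : ℕ) : ℤ_[p]) + (p : ℤ_[p]) ^ (M + i) * y := by push_cast; ring
  rw [h1, AddChar.map_add_eq_mul, AddChar.map_add_eq_mul, (ps_eq_one p (M + i) _).2 ⟨y, rfl⟩,
    (ps_eq_one p M _).2 ⟨y, rfl⟩, mul_one, mul_one, ps_apply, ps_apply,
    map_natCast (PadicInt.toZModPow (p := p) (M + i)), map_natCast (PadicInt.toZModPow (p := p) M)]
  have h2 := ZMod.stdAddChar_coe (N := p ^ (M + i)) ((p ^ i * n : ℕ) : ℤ)
  have h3 := ZMod.stdAddChar_coe (N := p ^ M) (n : ℤ)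
  rw [Int.cast_natCast] at h2 h3
  rw [h2, h3]
  congr 1
  have : (p : ℂ) ≠ 0 := by exact_mod_cast hp.out.ne_zero
  push_cast
  field_simp
  ring

/-- squared `L^{2r}` norm -/
noncomputable def nq {A : Type} [Fintype A] (r : ℕ) (f : A → ℂ) : ℝ :=
  (∑ x, ‖f x‖ ^ (2 * r)) ^ ((1 : ℝ) / r)

/-- classes of `S` at level `N` -/
noncomputable def parts (N : ℕ) (ν : ℤ → ℤ) (S : Finset ℤ) : Finset (Finset ℤ) :=
  S.image (fun n => S.filter (fun m => (p : ℤ) ^ N ∣ ν m - ν n))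

/-- phases of the polynomials in `W` at level `L` are available -/
def HasPh {A : Type} [AddCommGroup A] (W : Submodule ℤ_[p] ℤ_[p][X]) (L : ℕ) (S : Finset ℤ)
    (ν : ℤ → ℤ) (χ : ℤ → AddChar A ℂ) : Prop :=
  ∀ w ∈ W, ∃ h : A, ∃ c : ℂ, ∀ n ∈ S, χ n h = c * ps p L (w.eval ((ν n : ℤ) : ℤ_[p]))

/-- weak nondegeneracy at a point -/
def NDat (s : ℕ) (W : Submodule ℤ_[p] ℤ_[p][X]) (ξ : ℤ) : Prop :=
  ∀ j, 1 ≤ j → j ≤ s → ∃ w ∈ W, ∃ (r : ℤ_[p][X]) (c : ℤ_[p]),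
    w.comp (X + C (ξ : ℤ_[p])) = X ^ j + X ^ (s + 1) * r + C c

/-- nondegeneracy, with p-divisible error -/
def ND (s : ℕ) (W : Submodule ℤ_[p] ℤ_[p][X]) : Prop :=
  ∀ ξ : ℤ, ∀ j, 1 ≤ j → j ≤ s → ∃ w ∈ W, ∃ (r : ℤ_[p][X]) (c : ℤ_[p]),
    w.comp (X + C (ξ : ℤ_[p])) = X ^ j + C (p : ℤ_[p]) * X ^ (s + 1) * r + C c

def Rich {A : Type} [AddCommGroup A] (s N : ℕ) (S : Finset ℤ)
    (ν : ℤ → ℤ) (χ : ℤ → AddChar A ℂ) : Prop :=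
  ∃ W : Submodule ℤ_[p] ℤ_[p][X], ND p s W ∧ HasPh p W (s * N) S ν χ

def RR (l : ℕ) : ℕ := l * (l + 1) / 2

lemma two_RR (l : ℕ) : 2 * RR l = l * (l + 1) :=
  Nat.mul_div_cancel' (Nat.even_mul_succ_self l).two_dvd

def Dec (s N : ℕ) (D : ℝ) : Prop :=
  ∀ (A : Type) [AddCommGroup A] [Fintype A] (χ : ℤ → AddChar A ℂ) (ν : ℤ → ℤ) (S : Finset ℤ)
    (f : ℤ → A → ℂ), (∀ n ∈ S, ∀ x h, f n (x + h) = χ n h * f n x) → Rich p s N S ν χ →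
    nq (RR s) (fun x => ∑ n ∈ S, f n x) ≤
      D * ∑ T ∈ parts p N ν S, nq (RR s) (fun x => ∑ n ∈ T, f n x)

variable {p}

lemma HasPh.mono {A : Type} [AddCommGroup A] {W : Submodule ℤ_[p] ℤ_[p][X]} {L : ℕ}
    {S T : Finset ℤ} {ν : ℤ → ℤ} {χ : ℤ → AddChar A ℂ} (h : HasPh p W L S ν χ) (hT : T ⊆ S) :
    HasPh p W L T ν χ := fun w hw => by
  obtain ⟨a, c, ha⟩ := h w hw
  exact ⟨a, c, fun n hn => ha n (hT hn)⟩

lemma Rich.mono {A : Type} [AddCommGroup A] {s N : ℕ}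
    {S T : Finset ℤ} {ν : ℤ → ℤ} {χ : ℤ → AddChar A ℂ} (h : Rich p s N S ν χ) (hT : T ⊆ S) :
    Rich p s N T ν χ := by
  obtain ⟨W, h1, h2⟩ := h
  exact ⟨W, h1, h2.mono hT⟩

/-- lower the level of a phase -/
lemma HasPh.lower {A : Type} [AddCommGroup A] {W : Submodule ℤ_[p] ℤ_[p][X]} {L L' : ℕ}
    {S : Finset ℤ} {ν : ℤ → ℤ} {χ : ℤ → AddChar A ℂ} (h : HasPh p W L S ν χ) (hL : L' ≤ L) :
    HasPh p W L' S ν χ := fun w hw => by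
  obtain ⟨a, c, ha⟩ := h (((p : ℤ_[p]) ^ (L - L')) • w) (W.smul_mem _ hw)
  refine ⟨a, c, fun n hn => ?_⟩
  rw [ha n hn, eval_smul, smul_eq_mul]
  have := ps_shift p L' (L - L') (w.eval ((ν n : ℤ) : ℤ_[p]))
  rw [Nat.add_sub_cancel' hL] at this
  rw [this]

/-- the rescaling lemma -/
lemma rescale {A : Type} [AddCommGroup A] {W : Submodule ℤ_[p] ℤ_[p][X]} {L s N a : ℕ}
    {S : Finset ℤ} {ν ν' : ℤ → ℤ} {χ : ℤ → AddChar A ℂ} (h : HasPh p W L S ν χ) (ξ : ℤ)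
    (ha : 1 ≤ a) (hL : s * (N + a) ≤ L) (hν : ∀ n ∈ S, ν n = ξ + (p : ℤ) ^ a * ν' n)
    (hW : ∀ t : ℤ, NDat p s W (ξ + (p : ℤ) ^ a * t)) : Rich p s N S ν' χ := by
  have h' := h.lower hL
  let W' : Submodule ℤ_[p] ℤ_[p][X] :=
    { carrier := {w' | ∃ w ∈ W, ∃ c : ℤ_[p], C ((p : ℤ_[p]) ^ (s * a)) * w' + C c
          = w.comp (C (ξ : ℤ_[p]) + C ((p : ℤ_[p]) ^ a) * X)}
      add_mem' := by
        rintro u v ⟨w, hw, c, hc⟩ ⟨w1, hw1, c1, hc1⟩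
        refine ⟨w + w1, W.add_mem hw hw1, c + c1, ?_⟩
        rw [add_comp, ← hc, ← hc1, C_add]; ring
      zero_mem' := ⟨0, W.zero_mem, 0, by simp⟩
      smul_mem' := by
        rintro z u ⟨w, hw, c, hc⟩
        refine ⟨z • w, W.smul_mem _ hw, z * c, ?_⟩
        rw [smul_comp, ← hc, smul_eq_C_mul, smul_eq_C_mul, C_mul]; ring }
  refine ⟨W', ?_, ?_⟩
  · intro t j hj1 hj
    obtain ⟨w, hw, r, c, hc⟩ := hW t j hj1 hj
    obtain ⟨b, rfl⟩ : ∃ b, a = b + 1 := ⟨a - 1, by omega⟩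
    set P : ℤ_[p] := (p : ℤ_[p]) with hP
    have key : w.comp (C (ξ : ℤ_[p]) + C (P ^ (b + 1)) * (X + C (t : ℤ_[p])))
        = C (P ^ (j * (b + 1))) * X ^ j + C (P ^ ((s + 1) * (b + 1))) * X ^ (s + 1) *
            r.comp (C (P ^ (b + 1)) * X) + C c := by
      have := congrArg (fun q : ℤ_[p][X] => q.comp (C (P ^ (b + 1)) * X)) hc
      simp only [comp_assoc, add_comp, X_comp, C_comp, mul_comp, pow_comp] at this
      rw [mul_pow, mul_pow, ← C_pow, ← C_pow, ← pow_mul, ← pow_mul] at this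
      rw [mul_comm j, mul_comm (s + 1) (b + 1), ← this]
      congr 1
      push_cast
      simp only [C_add, C_mul]
      ring
    refine ⟨(X ^ j + C P * X ^ (s + 1) *
        (C (P ^ ((s + 1 - j) * (b + 1) - 1)) * r.comp (C (P ^ (b + 1)) * X))).comp
          (X - C (t : ℤ_[p])), ⟨(P ^ ((s - j) * (b + 1))) • w, W.smul_mem _ hw,
          P ^ ((s - j) * (b + 1)) * c, ?_⟩,
        C (P ^ ((s + 1 - j) * (b + 1) - 1)) * r.comp (C (P ^ (b + 1)) * X), 0, ?_⟩
    · have key2 := congrArg (fun q : ℤ_[p][X] => q.comp (X - C (t : ℤ_[p]))) key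
      simp only [comp_assoc, add_comp, X_comp, C_comp, mul_comp, pow_comp,
        sub_add_cancel] at key2
      rw [smul_comp, key2, smul_eq_C_mul]
      simp only [comp_assoc, add_comp, X_comp, C_comp, mul_comp, pow_comp, C_mul]
      have e1 : P ^ (s * (b + 1)) = P ^ ((s - j) * (b + 1)) * P ^ (j * (b + 1)) := by
        rw [← pow_add, ← add_mul, Nat.sub_add_cancel hj]
      have e2 : P ^ (s * (b + 1)) * P * P ^ ((s + 1 - j) * (b + 1) - 1)
          = P ^ ((s - j) * (b + 1)) * P ^ ((s + 1) * (b + 1)) := by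
        rw [← pow_succ, ← pow_add, ← pow_add]
        congr 1
        obtain ⟨d, rfl⟩ := Nat.exists_eq_add_of_le hj
        have : j + d + 1 - j = d + 1 := by omega
        rw [this, Nat.add_sub_cancel_left]
        have : (d + 1) * (b + 1) - 1 = d * b + d + b := by
          have h9 : (d + 1) * (b + 1) = d * b + d + b + 1 := by ring
          omega
        rw [this]; ring
      have e1' := congrArg (C (R := ℤ_[p])) e1
      have e2' := congrArg (C (R := ℤ_[p])) e2
      simp only [C_mul] at e1' e2'
      linear_combination (X - C (t : ℤ_[p])) ^ j * e1' + (X - C (t : ℤ_[p])) ^ (s + 1) *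
        (r.comp (C (P ^ (b + 1)) * (X - C (t : ℤ_[p])))) * e2'
    · rw [comp_assoc]
      simp
  · rintro w' ⟨w, hw, c, hc⟩
    obtain ⟨g, d, hg⟩ := h' w hw
    refine ⟨g, d * ps p (s * (N + a)) c, fun n hn => ?_⟩
    have h1 := congrArg (fun q : ℤ_[p][X] => q.eval ((ν' n : ℤ) : ℤ_[p])) hc
    simp only [eval_add, eval_mul, eval_C, eval_comp, eval_X] at h1
    rw [hg n hn, hν n hn, mul_assoc, ← ps_shift p (s * N) (s * a), ← mul_add,
      ← AddChar.map_add_eq_mul, add_comm c, h1]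
    push_cast
    rfl

end basics
end VMV

namespace VMV
open Polynomial

section flags
variable {p : ℕ} [hp : Fact p.Prime]

def flagW (W : Submodule ℤ_[p] ℤ_[p][X]) (m : ℕ) (ξ' : ℤ) : Submodule ℤ_[p] ℤ_[p][X] where
  carrier := {w | w ∈ W ∧ ∀ i, 1 ≤ i → i ≤ m → (w.comp (X + C (ξ' : ℤ_[p]))).coeff i = 0}
  add_mem' := by
    rintro a b ⟨ha, ha'⟩ ⟨hb, hb'⟩
    refine ⟨W.add_mem ha hb, fun i h1 h2 => ?_⟩
    rw [add_comp, coeff_add, ha' i h1 h2, hb' i h1 h2, add_zero]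
  zero_mem' := ⟨W.zero_mem, by simp⟩
  smul_mem' := by
    rintro z a ⟨ha, ha'⟩
    refine ⟨W.smul_mem _ ha, fun i h1 h2 => ?_⟩
    rw [smul_comp, coeff_smul, ha' i h1 h2, smul_zero]

lemma isUnit_of_toZMod {z : ℤ_[p]} (h : PadicInt.toZMod z ≠ 0) : IsUnit z := by
  by_contra hz
  apply h
  rw [← RingHom.mem_ker, PadicInt.ker_toZMod]
  exact (IsLocalRing.mem_maximalIdeal z).2 hz

lemma wronsk {m l : ℕ} (hk : m + l < p) (u : ZMod p) (hu : u ≠ 0) (v : Fin l → ZMod p)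
    (h : ∀ j : Fin l, ((∑ i : Fin l, C (v i) * X ^ (m + i + 1) : (ZMod p)[X]).comp
      (X + C u)).coeff (j + 1) = 0) : v = 0 := by
  set Q : (ZMod p)[X] := ∑ i : Fin l, C (v i) * X ^ (m + i + 1) with hQ
  have hdeg : Q.natDegree ≤ m + l := by
    refine natDegree_sum_le_of_forall_le _ _ fun i _ => ?_
    refine (natDegree_C_mul_X_pow_le _ _).trans ?_
    have := i.2; omega
  have h1 : X ^ m ∣ derivative Q := by
    rw [hQ, derivative_sum]
    refine Finset.dvd_sum fun i _ => ?_
    rw [derivative_C_mul_X_pow]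
    refine Dvd.dvd.mul_left (pow_dvd_pow _ (by omega)) _
  have h2 : X ^ l ∣ (derivative Q).comp (X + C u) := by
    have : (derivative Q).comp (X + C u) = derivative (Q.comp (X + C u)) := by
      rw [derivative_comp]; simp
    rw [this, X_pow_dvd_iff]
    intro d hd
    rw [coeff_derivative, h ⟨d, hd⟩, zero_mul]
  have h3 : (X - C u) ^ l ∣ derivative Q := by
    obtain ⟨g, hg⟩ := h2
    have := congrArg (fun q : (ZMod p)[X] => q.comp (X - C u)) hg
    simp only [comp_assoc, add_comp, X_comp, C_comp, mul_comp, pow_comp, sub_add_cancel,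
      comp_X] at this
    exact ⟨_, this⟩
  have hcop : IsCoprime (X : (ZMod p)[X]) (X - C u) := by
    have := isCoprime_X_sub_C_of_isUnit_sub (R := ZMod p) (a := 0) (b := u)
      (by rw [zero_sub]; exact (neg_ne_zero.2 hu).isUnit)
    simpa using this
  have h4 : X ^ m * (X - C u) ^ l ∣ derivative Q := (hcop.pow).mul_dvd h1 h3
  have h5 : derivative Q = 0 := by
    by_contra hne
    have h6 := natDegree_le_of_dvd h4 hne
    rw [Polynomial.natDegree_mul (pow_ne_zero _ X_ne_zero) (pow_ne_zero _ (X_sub_C_ne_zero u)),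
      natDegree_pow, natDegree_pow, natDegree_X, natDegree_X_sub_C] at h6
    have h7 : Q.natDegree ≠ 0 := by
      intro h0
      rw [natDegree_eq_zero] at h0
      obtain ⟨c, hc⟩ := h0
      rw [← hc, derivative_C] at hne
      exact hne rfl
    have := natDegree_derivative_lt h7
    omega
  funext i
  have h8 : (derivative Q).coeff (m + i) = 0 := by rw [h5]; simp
  rw [coeff_derivative, hQ, finsetSum_coeff] at h8
  rw [Finset.sum_eq_single i] at h8
  · rw [coeff_C_mul, coeff_X_pow, if_pos rfl, mul_one] at h8
    rcases mul_eq_zero.1 h8 with h9 | h9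
    · exact h9
    · exfalso
      have : ((m + i + 1 : ℕ) : ZMod p) = 0 := by push_cast; push_cast at h9; exact h9
      rw [ZMod.natCast_eq_zero_iff] at this
      have := Nat.le_of_dvd (by omega) this
      have := i.2
      omega
  · intro b _ hb
    rw [coeff_C_mul, coeff_X_pow, if_neg, mul_zero]
    intro h; apply hb; ext; omega
  · simp

lemma flag_ND {W : Submodule ℤ_[p] ℤ_[p][X]} {m l : ℕ} (hk : m + l < p)
    (hW : ND p (m + l) W) {ξ ξ' : ℤ} (hξ : ¬ (p : ℤ) ∣ ξ - ξ') : NDat p l (flagW W m ξ') ξ := by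
  have h0 : ∀ i : Fin l, ∃ w ∈ W, ∃ (r : ℤ_[p][X]) (c : ℤ_[p]),
      w.comp (X + C (ξ' : ℤ_[p])) = X ^ (m + i + 1) + C (p : ℤ_[p]) * X ^ (m + l + 1) * r + C c :=
    fun i => hW ξ' (m + i + 1) (by omega) (by have := i.2; omega)
  choose w hw r c hc using h0
  have hwF : ∀ i, w i ∈ flagW W m ξ' := by
    intro i
    refine ⟨hw i, fun d h1 h2 => ?_⟩
    rw [hc i, coeff_add, coeff_add, coeff_X_pow, if_neg (by omega), coeff_C, if_neg (by omega),
      mul_assoc, coeff_C_mul, coeff_X_pow_mul', if_neg (by omega)]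
    simp
  let T : Matrix (Fin l) (Fin l) ℤ_[p] :=
    Matrix.of fun j i => ((w i).comp (X + C (ξ : ℤ_[p]))).coeff (j + 1)
  have hdet : IsUnit T.det := by
    apply isUnit_of_toZMod
    rw [RingHom.map_det]
    intro hd
    obtain ⟨v, hv, hv0⟩ := Matrix.exists_mulVec_eq_zero_iff.2 hd
    apply hv
    apply wronsk hk ((ξ : ZMod p) - ξ') _ v
    · intro j
      have h1 := congrFun hv0 j
      simp only [Matrix.mulVec, dotProduct, Pi.zero_apply, RingHom.mapMatrix_apply,
        Matrix.map_apply, T, Matrix.of_apply] at h1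
      rw [← h1, Polynomial.sum_comp, finsetSum_coeff]
      refine Finset.sum_congr rfl fun i _ => ?_
      have h2 : (w i) = (X - C (ξ' : ℤ_[p])) ^ (m + i + 1) + C (p : ℤ_[p]) *
          (X - C (ξ' : ℤ_[p])) ^ (m + l + 1) * (r i).comp (X - C (ξ' : ℤ_[p])) + C (c i) := by
        have := congrArg (fun q : ℤ_[p][X] => q.comp (X - C (ξ' : ℤ_[p]))) (hc i)
        simp only [comp_assoc, add_comp, X_comp, C_comp, mul_comp, pow_comp, sub_add_cancel,
          comp_X] at this
        exact this
      have h3 : (((w i).comp (X + C (ξ : ℤ_[p]))).map PadicInt.toZMod)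
          = (X + C ((ξ : ZMod p) - ξ')) ^ (m + i + 1) + C (PadicInt.toZMod (c i)) := by
        rw [h2]
        simp only [Polynomial.map_comp, Polynomial.map_add, Polynomial.map_mul, Polynomial.map_pow,
          Polynomial.map_sub, map_X, map_C, map_natCast, map_intCast, CharP.cast_eq_zero, C_0,
          zero_mul, add_zero, add_comp, mul_comp, pow_comp, sub_comp, X_comp, C_comp, C_sub]
        congr 2
        ring_nf
        simp
      rw [← coeff_map, h3, coeff_add, coeff_C, if_neg (by omega), add_zero, mul_comp, C_comp,
        pow_comp, X_comp, coeff_C_mul, mul_comm]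
    · intro h
      apply hξ
      rw [← Int.cast_sub, ZMod.intCast_zmod_eq_zero_iff_dvd] at h
      exact h
  intro j hj1 hj
  obtain ⟨j0, rfl⟩ : ∃ j0 : Fin l, j = j0 + 1 := ⟨⟨j - 1, by omega⟩, by simp; omega⟩
  let al : Fin l → ℤ_[p] := T⁻¹.mulVec (Pi.single j0 1)
  have hal : T.mulVec al = Pi.single j0 1 := by
    rw [Matrix.mulVec_mulVec, Matrix.mul_nonsing_inv _ hdet, Matrix.one_mulVec]
  let g : ℤ_[p][X] := (∑ i, al i • w i).comp (X + C (ξ : ℤ_[p]))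
  have hco : ∀ d : Fin l, g.coeff (d + 1) = if d = j0 then 1 else 0 := by
    intro d
    have h1 := congrFun hal d
    rw [Pi.single_apply] at h1
    rw [← h1]
    simp only [g, Polynomial.sum_comp, finsetSum_coeff, smul_comp, coeff_smul,
      Matrix.mulVec, dotProduct, T, Matrix.of_apply, smul_eq_mul]
    exact Finset.sum_congr rfl fun i _ => mul_comm _ _
  have hdv : X ^ (l + 1) ∣ g - X ^ ((j0 : ℕ) + 1) - C (g.coeff 0) := by
    rw [X_pow_dvd_iff]
    intro d hd
    rcases Nat.eq_zero_or_pos d with rfl | hd0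
    · simp
    · obtain ⟨d', rfl⟩ : ∃ d' : Fin l, d = d' + 1 := ⟨⟨d - 1, by omega⟩, by simp; omega⟩
      rw [coeff_sub, coeff_sub, hco, coeff_X_pow, coeff_C, if_neg (show ¬ ((d' : ℕ) + 1 = 0) by omega)]
      by_cases hdj : d' = j0
      · simp [hdj]
      · rw [if_neg hdj, if_neg]; · simp
        intro h; apply hdj; ext; omega
  obtain ⟨r', hr'⟩ := hdv
  refine ⟨∑ i, al i • w i, Submodule.sum_mem _ fun i _ => Submodule.smul_mem _ _ (hwF i),
    r', g.coeff 0, ?_⟩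
  change g = _
  rw [← hr']; ring

end flags
end VMV

namespace VMV
open Polynomial

section partsec
variable {p : ℕ} [hp : Fact p.Prime]

lemma mem_parts {N : ℕ} {ν : ℤ → ℤ} {S T : Finset ℤ} :
    T ∈ parts p N ν S ↔ ∃ n ∈ S, S.filter (fun m => (p : ℤ) ^ N ∣ ν m - ν n) = T := by
  simp [parts]

lemma parts_subset {N : ℕ} {ν : ℤ → ℤ} {S T : Finset ℤ} (h : T ∈ parts p N ν S) : T ⊆ S := by
  obtain ⟨n, hn, rfl⟩ := mem_parts.1 h
  exact filter_subset _ _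

lemma parts_eq {N : ℕ} {ν : ℤ → ℤ} {S T : Finset ℤ} (h : T ∈ parts p N ν S) {n : ℤ} (hn : n ∈ T) :
    T = S.filter (fun m => (p : ℤ) ^ N ∣ ν m - ν n) := by
  obtain ⟨n0, hn0, rfl⟩ := mem_parts.1 h
  have h1 := (mem_filter.1 hn).2
  refine filter_congr fun m _ => ?_
  constructor
  · intro h2
    have := dvd_sub h2 h1
    simpa using this
  · intro h2
    have := dvd_add h2 h1
    simpa using this

lemma parts_nonempty {N : ℕ} {ν : ℤ → ℤ} {S T : Finset ℤ} (h : T ∈ parts p N ν S) :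
    T.Nonempty := by
  obtain ⟨n, hn, rfl⟩ := mem_parts.1 h
  exact ⟨n, by simp [hn]⟩

lemma sum_parts {N : ℕ} {ν : ℤ → ℤ} {S : Finset ℤ} {M : Type*} [AddCommMonoid M] (g : ℤ → M) :
    ∑ n ∈ S, g n = ∑ T ∈ parts p N ν S, ∑ n ∈ T, g n := by
  rw [← Finset.sum_fiberwise_of_maps_to (s := S) (t := parts p N ν S)
    (g := fun n => S.filter (fun m => (p : ℤ) ^ N ∣ ν m - ν n))
    (fun n hn => mem_parts.2 ⟨n, hn, rfl⟩)]
  refine Finset.sum_congr rfl fun T hT => ?_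
  refine Finset.sum_congr ?_ fun _ _ => rfl
  ext m
  rw [mem_filter]
  constructor
  · rintro ⟨hm, rfl⟩
    simp [hm]
  · intro hm
    exact ⟨parts_subset hT hm, (parts_eq hT hm).symm⟩

lemma parts_sub {N a : ℕ} (ha : a ≤ N) {ν : ℤ → ℤ} {S T0 : Finset ℤ} (h : T0 ∈ parts p a ν S)
    {n : ℤ} (hn : n ∈ T0) : T0.filter (fun m => (p : ℤ) ^ N ∣ ν m - ν n)
      = S.filter (fun m => (p : ℤ) ^ N ∣ ν m - ν n) := by
  rw [parts_eq h hn, filter_filter]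
  refine filter_congr fun m _ => ?_
  exact ⟨fun h => h.2, fun h => ⟨(pow_dvd_pow _ ha).trans h, h⟩⟩

lemma sum_parts_parts {N a : ℕ} (ha : a ≤ N) {ν : ℤ → ℤ} {S : Finset ℤ} {M : Type*}
    [AddCommMonoid M] (g : Finset ℤ → M) :
    ∑ T ∈ parts p N ν S, g T = ∑ T0 ∈ parts p a ν S, ∑ T ∈ parts p N ν T0, g T := by
  rw [← Finset.sum_biUnion]
  · refine Finset.sum_congr ?_ fun _ _ => rfl
    ext T
    simp only [mem_biUnion]
    constructor
    · intro h
      obtain ⟨n, hn, rfl⟩ := mem_parts.1 h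
      have h0 : S.filter (fun m => (p : ℤ) ^ a ∣ ν m - ν n) ∈ parts p a ν S :=
        mem_parts.2 ⟨n, hn, rfl⟩
      exact ⟨_, h0, mem_parts.2 ⟨n, by simp [hn], parts_sub ha h0 (by simp [hn])⟩⟩
    · rintro ⟨T0, h0, h⟩
      obtain ⟨n, hn, rfl⟩ := mem_parts.1 h
      exact mem_parts.2 ⟨n, parts_subset h0 hn, (parts_sub ha h0 hn).symm⟩
  · intro T0 h0 T1 h1 hne
    rw [Function.onFun, Finset.disjoint_left]
    intro T hT hT'
    apply hne
    obtain ⟨n, hn⟩ := parts_nonempty hT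
    rw [parts_eq h0 (parts_subset hT hn), parts_eq h1 (parts_subset hT' hn)]

lemma parts_rescale {N a : ℕ} {ν ν' : ℤ → ℤ} {T : Finset ℤ} {ξ : ℤ}
    (hν : ∀ n ∈ T, ν n = ξ + (p : ℤ) ^ a * ν' n) : parts p N ν' T = parts p (N + a) ν T := by
  unfold parts
  refine Finset.image_congr fun n hn => filter_congr fun m hm => ?_
  rw [hν n hn, hν m hm, pow_add, mul_comm ((p : ℤ) ^ N),
    show ξ + (p : ℤ) ^ a * ν' m - (ξ + (p : ℤ) ^ a * ν' n) = (p : ℤ) ^ a * (ν' m - ν' n) by ring,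
    mul_dvd_mul_iff_left]
  exact pow_ne_zero _ (by exact_mod_cast hp.out.ne_zero)

lemma card_parts (N : ℕ) (ν : ℤ → ℤ) (S : Finset ℤ) : (parts p N ν S).card ≤ p ^ N := by
  have : parts p N ν S ⊆ (univ : Finset (ZMod (p ^ N))).image
      (fun z => S.filter (fun m => ((ν m : ℤ) : ZMod (p ^ N)) = z)) := by
    intro T hT
    obtain ⟨n, hn, rfl⟩ := mem_parts.1 hT
    refine mem_image.2 ⟨ν n, mem_univ _, filter_congr fun m _ => ?_⟩
    rw [← sub_eq_zero, ← Int.cast_sub, ZMod.intCast_zmod_eq_zero_iff_dvd]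
    push_cast; rfl
  calc _ ≤ _ := card_le_card this
    _ ≤ _ := card_image_le
    _ = _ := by rw [Finset.card_univ, ZMod.card]

end partsec

section norms

lemma nq_nonneg {A : Type} [Fintype A] (r : ℕ) (f : A → ℂ) : 0 ≤ nq r f := by
  unfold nq; positivity

lemma nq_pow {A : Type} [Fintype A] {r : ℕ} (hr : 1 ≤ r) (f : A → ℂ) :
    nq r f ^ r = ∑ x, ‖f x‖ ^ (2 * r) := by
  unfold nq
  rw [← Real.rpow_natCast, ← Real.rpow_mul (by positivity), one_div_mul_cancel (by positivity),
    Real.rpow_one]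

lemma nq_le {A : Type} [Fintype A] {r : ℕ} (hr : 1 ≤ r) {f : A → ℂ} {B : ℝ} (hB : 0 ≤ B)
    (h : ∑ x, ‖f x‖ ^ (2 * r) ≤ B ^ r) : nq r f ≤ B := by
  rw [← nq_pow hr] at h
  exact le_of_pow_le_pow_left₀ (by omega) hB h

/-- Minkowski in a convenient form -/
lemma mink {ι X : Type*} (I : Finset ι) (s : Finset X) (w : X → ℝ) (hw : ∀ x ∈ s, 0 ≤ w x)
    (a : ι → X → ℝ) (ha : ∀ i ∈ I, ∀ x ∈ s, 0 ≤ a i x) (E : ι → ℝ) (hE : ∀ i ∈ I, 0 ≤ E i) {r : ℕ}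
    (hr : 1 ≤ r) {K : ℝ} (h : ∀ i ∈ I, ∑ x ∈ s, w x * a i x ^ r ≤ K * E i ^ r) :
    ∑ x ∈ s, w x * (∑ i ∈ I, a i x) ^ r ≤ K * (∑ i ∈ I, E i) ^ r := by
  set J := I.filter (fun i => E i ≠ 0) with hJ
  have hJI : J ⊆ I := filter_subset _ _
  have hEJ : ∑ i ∈ I, E i = ∑ i ∈ J, E i := by
    rw [hJ, Finset.sum_filter_ne_zero]
  have hpos : ∀ i ∈ J, 0 < E i := fun i hi =>
    lt_of_le_of_ne (hE i (hJI hi)) (Ne.symm (mem_filter.1 hi).2)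
  have hz : ∀ x ∈ s, w x * (∑ i ∈ I, a i x) ^ r = w x * (∑ i ∈ J, a i x) ^ r := by
    intro x hx
    by_cases hwx : w x = 0
    · simp [hwx]
    congr 2
    symm
    apply Finset.sum_subset hJI
    intro i hi hiJ
    have hEi : E i = 0 := by
      by_contra hc; exact hiJ (mem_filter.2 ⟨hi, hc⟩)
    have h1 := h i hi
    rw [hEi, zero_pow (by omega), mul_zero] at h1
    have h2 := (Finset.sum_eq_zero_iff_of_nonneg (s := s) (f := fun x => w x * a i x ^ r)
      (fun x hx => mul_nonneg (hw x hx) (pow_nonneg (ha i hi x hx) _))).1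
      (le_antisymm h1 (Finset.sum_nonneg
      (fun x hx => mul_nonneg (hw x hx) (pow_nonneg (ha i hi x hx) _)))) x hx
    rcases mul_eq_zero.1 h2 with h3 | h3
    · exact absurd h3 hwx
    · exact pow_eq_zero_iff (by omega) |>.1 h3
  rw [Finset.sum_congr rfl hz, hEJ]
  set Z := ∑ i ∈ J, E i with hZ
  rcases J.eq_empty_or_nonempty with hJe | hJne
  · rw [hZ, hJe]; simp [zero_pow (show r ≠ 0 by omega)]
  have hZpos : 0 < Z := Finset.sum_pos hpos hJne
  have hpt : ∀ x ∈ s, w x * (∑ i ∈ J, a i x) ^ r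
      ≤ ∑ i ∈ J, (E i / Z) * (Z / E i) ^ r * (w x * a i x ^ r) := by
    intro x hx
    have h1 := Real.pow_arith_mean_le_arith_mean_pow J (fun i => E i / Z)
      (fun i => Z / E i * a i x) (fun i hi => (div_pos (hpos i hi) hZpos).le)
      (by rw [← Finset.sum_div, ← hZ, div_self hZpos.ne'])
      (fun i hi => mul_nonneg (div_pos hZpos (hpos i hi)).le (ha i (hJI hi) x hx)) r
    have h2 : ∑ i ∈ J, E i / Z * (Z / E i * a i x) = ∑ i ∈ J, a i x := by
      refine Finset.sum_congr rfl fun i hi => ?_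
      have := (hpos i hi).ne'
      field_simp
    rw [h2] at h1
    calc _ ≤ w x * _ := mul_le_mul_of_nonneg_left h1 (hw x hx)
      _ = _ := by
        rw [Finset.mul_sum]
        refine Finset.sum_congr rfl fun i hi => ?_
        rw [mul_pow]; ring
  calc _ ≤ ∑ x ∈ s, ∑ i ∈ J, (E i / Z) * (Z / E i) ^ r * (w x * a i x ^ r) :=
        Finset.sum_le_sum hpt
    _ = ∑ i ∈ J, (E i / Z) * (Z / E i) ^ r * ∑ x ∈ s, (w x * a i x ^ r) := by
        rw [Finset.sum_comm]
        refine Finset.sum_congr rfl fun i hi => by rw [Finset.mul_sum]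
    _ ≤ ∑ i ∈ J, (E i / Z) * (Z / E i) ^ r * (K * E i ^ r) := by
        refine Finset.sum_le_sum fun i hi => ?_
        have := hpos i hi
        exact mul_le_mul_of_nonneg_left (h i (hJI hi)) (by positivity)
    _ = ∑ i ∈ J, (E i / Z) * (K * Z ^ r) := by
        refine Finset.sum_congr rfl fun i hi => ?_
        have := (hpos i hi).ne'
        rw [div_pow]; field_simp
    _ = _ := by rw [← Finset.sum_mul, ← Finset.sum_div, ← hZ, div_self hZpos.ne', one_mul]

/-- Trivial estimate -/
lemma nq_triv {A ι : Type} [Fintype A] {r : ℕ} (hr : 1 ≤ r) (I : Finset ι) (g : ι → A → ℂ) :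
    nq r (fun x => ∑ i ∈ I, g i x) ≤ (I.card : ℝ) * ∑ i ∈ I, nq r (g i) := by
  have h0 : 0 ≤ ∑ i ∈ I, nq r (g i) := Finset.sum_nonneg fun i _ => nq_nonneg _ _
  refine nq_le hr (by positivity) ?_
  have h1 := mink I univ (fun _ => (1 : ℝ)) (by simp) (fun i (x : A) => ‖g i x‖ ^ 2)
    (by intros; positivity) (fun i => nq r (g i)) (fun i _ => nq_nonneg _ _) hr (K := 1)
    (fun i _ => by
      rw [nq_pow hr]
      simp only [one_mul]
      exact le_of_eq (Finset.sum_congr rfl fun x _ => by rw [pow_mul]))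
  simp only [one_mul] at h1
  rw [mul_pow]
  calc _ ≤ ∑ x, (I.card : ℝ) ^ r * (∑ i ∈ I, ‖g i x‖ ^ 2) ^ r := by
        refine Finset.sum_le_sum fun x _ => ?_
        rw [pow_mul, ← mul_pow]
        refine pow_le_pow_left₀ (by positivity) ?_ _
        calc _ ≤ (∑ i ∈ I, ‖g i x‖) ^ 2 := pow_le_pow_left₀ (by positivity) (norm_sum_le _ _) _
          _ ≤ _ := sq_sum_le_card_mul_sum_sq
    _ ≤ _ := by
        rw [← Finset.mul_sum]
        exact mul_le_mul_of_nonneg_left h1 (by positivity)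

end norms

end VMV

namespace VMV
open Polynomial

section steps
variable {p : ℕ} [hp : Fact p.Prime]

def FS {A : Type} (f : ℤ → A → ℂ) (T : Finset ℤ) : A → ℂ := fun x => ∑ n ∈ T, f n x

def Eqv {A : Type} [AddCommGroup A] (χ : ℤ → AddChar A ℂ) (S : Finset ℤ) (f : ℤ → A → ℂ) : Prop :=
  ∀ n ∈ S, ∀ x h, f n (x + h) = χ n h * f n x

noncomputable def ee {A : Type} [Fintype A] (p k N : ℕ) (ν : ℤ → ℤ) (f : ℤ → A → ℂ)
    (T : Finset ℤ) : ℝ := ∑ J ∈ parts p N ν T, nq (RR k) (FS f J)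

noncomputable def Mx {A : Type} [Fintype A] (i j : ℕ) (F G : A → ℂ) : ℝ :=
  ∑ x, ‖F x‖ ^ (2 * i) * ‖G x‖ ^ (2 * j)

lemma ee_nonneg {A : Type} [Fintype A] (p k N : ℕ) (ν : ℤ → ℤ) (f : ℤ → A → ℂ)
    (T : Finset ℤ) : 0 ≤ ee p k N ν f T := Finset.sum_nonneg fun _ _ => nq_nonneg _ _

lemma ee_split {A : Type} [Fintype A] (k : ℕ) {N a : ℕ} (ha : a ≤ N) (ν : ℤ → ℤ)
    (f : ℤ → A → ℂ) (T : Finset ℤ) :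
    ee p k N ν f T = ∑ J ∈ parts p a ν T, ee p k N ν f J := sum_parts_parts ha _

lemma ND.at {s : ℕ} {W : Submodule ℤ_[p] ℤ_[p][X]} (h : ND p s W) (ξ : ℤ) : NDat p s W ξ := by
  intro j h1 h2
  obtain ⟨w, hw, r, c, hc⟩ := h ξ j h1 h2
  exact ⟨w, hw, C (p : ℤ_[p]) * r, c, by rw [hc]; ring⟩

lemma R1 {A : Type} [AddCommGroup A] [Fintype A] {χ : ℤ → AddChar A ℂ} {ν : ℤ → ℤ} {S T : Finset ℤ}
    {f : ℤ → A → ℂ} {k N a : ℕ} {D : ℝ} (hD : Dec p k (N - a) D) (ha : 1 ≤ a) (haN : a ≤ N)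
    (hf : Eqv χ S f) (hR : Rich p k N S ν χ) (hT : T ⊆ S) (ξ : ℤ)
    (hξ : ∀ n ∈ T, (p : ℤ) ^ a ∣ ν n - ξ) : nq (RR k) (FS f T) ≤ D * ee p k N ν f T := by
  have hν : ∀ n ∈ T, ν n = ξ + (p : ℤ) ^ a * ((ν n - ξ) / (p : ℤ) ^ a) := fun n hn => by
    rw [Int.mul_ediv_cancel' (hξ n hn)]; ring
  obtain ⟨W, hW, hph⟩ := hR
  have hRich : Rich p k (N - a) T (fun n => (ν n - ξ) / (p : ℤ) ^ a) χ :=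
    rescale (hph.mono hT) ξ ha (by rw [Nat.sub_add_cancel haN]) hν (fun t => hW.at _)
  have := hD A χ _ T f (fun n hn => hf n (hT hn)) hRich
  rw [parts_rescale (ν := ν) (a := a) hν, Nat.sub_add_cancel haN] at this
  exact this

lemma R1' {A : Type} [AddCommGroup A] [Fintype A] {χ : ℤ → AddChar A ℂ} {ν : ℤ → ℤ} {S T : Finset ℤ}
    {f : ℤ → A → ℂ} {k N : ℕ} {D : ℝ} (hD : Dec p k N D)
    (hf : Eqv χ S f) (hR : Rich p k N S ν χ) (hT : T ⊆ S) :
    nq (RR k) (FS f T) ≤ D * ee p k N ν f T :=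
  hD A χ _ T f (fun n hn => hf n (hT hn)) (hR.mono hT)

lemma coset_avg {A : Type} [AddCommGroup A] [Fintype A] (A' : AddSubgroup A) (F G : A → ℂ)
    (hG : ∀ y, ∀ x : A', ‖G (y + x)‖ = ‖G y‖) {i : ℕ} (hi : 1 ≤ i) (j : ℕ) :
    ∑ y, ‖G y‖ ^ (2 * j) * nq i (fun x : A' => F (y + x)) ^ i
      = (Fintype.card A' : ℝ) * Mx i j F G := by
  simp_rw [nq_pow hi, Finset.mul_sum]
  rw [Finset.sum_comm, Mx]
  have : ∀ x : A', ∑ y, ‖G y‖ ^ (2 * j) * ‖F (y + x)‖ ^ (2 * i)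
      = ∑ y, ‖F y‖ ^ (2 * i) * ‖G y‖ ^ (2 * j) := by
    intro x
    rw [← Equiv.sum_comp (Equiv.addRight (x : A)) (fun y => ‖F y‖ ^ (2 * i) * ‖G y‖ ^ (2 * j))]
    refine Finset.sum_congr rfl fun y _ => ?_
    simp only [Equiv.coe_addRight]
    rw [hG, mul_comm]
  rw [Finset.sum_congr rfl fun x _ => this x, Finset.sum_const, Finset.card_univ, nsmul_eq_mul]

lemma RR_pos {l : ℕ} (hl : 1 ≤ l) : 1 ≤ RR l := by
  have := two_RR l
  nlinarith

lemma step2core {A : Type} [AddCommGroup A] [Fintype A] {χ : ℤ → AddChar A ℂ} {ν : ℤ → ℤ}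
    {S T T' : Finset ℤ} {f : ℤ → A → ℂ} {m l N N' a b : ℕ} {D : ℝ} (hkp : m + l < p) (hl : 1 ≤ l)
    (hD : Dec p l N' D) (hD0 : 0 ≤ D) (ha : 1 ≤ a) (hL : l * (N' + a) ≤ (m + 1) * b) (hbN : b ≤ N)
    (hf : Eqv χ S f) (hR : Rich p (m + l) N S ν χ) (hT : T ⊆ S) (hT' : T' ⊆ S) {ξ ξ' : ℤ}
    (hξξ : ¬ (p : ℤ) ∣ ξ - ξ')
    (hξ : ∀ n ∈ T, (p : ℤ) ^ a ∣ ν n - ξ) (hξ' : ∀ n ∈ T', (p : ℤ) ^ b ∣ ν n - ξ')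
    {j : ℕ} {K' : ℝ} {E : Finset ℤ → ℝ} (hE : ∀ J, 0 ≤ E J)
    (hM : ∀ J ∈ parts p (N' + a) ν T, Mx (RR l) j (FS f J) (FS f T') ≤ K' * E J ^ RR l) :
    Mx (RR l) j (FS f T) (FS f T') ≤
      D ^ RR l * K' * (∑ J ∈ parts p (N' + a) ν T, E J) ^ RR l := by
  have hν : ∀ n ∈ T, ν n = ξ + (p : ℤ) ^ a * ((ν n - ξ) / (p : ℤ) ^ a) := fun n hn => by
    rw [Int.mul_ediv_cancel' (hξ n hn)]; ring
  obtain ⟨W, hW, hph⟩ := hR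
  have hLL : (m + 1) * b ≤ (m + l) * N := Nat.mul_le_mul (by omega) hbN
  have hph1 := hph.lower hLL
  let A' : AddSubgroup A :=
    { carrier := {h | ∀ n ∈ T', ∀ n' ∈ T', χ n h = χ n' h}
      add_mem' := by
        intro x y hx hy n hn n' hn'
        rw [AddChar.map_add_eq_mul, AddChar.map_add_eq_mul, hx n hn n' hn', hy n hn n' hn']
      zero_mem' := by intro n _ n' _; simp
      neg_mem' := by
        intro x hx n hn n' hn'
        rw [AddChar.map_neg_eq_inv, AddChar.map_neg_eq_inv, hx n hn n' hn'] }
  let χ' : ℤ → AddChar A' ℂ := fun n => (χ n).compAddMonoidHom A'.subtype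
  have hpT : HasPh p (flagW W m ξ') ((m + 1) * b) T ν χ' := by
    rintro w ⟨hw, hw0⟩
    obtain ⟨h, c, hc⟩ := hph1 w hw
    have hdv : X ^ (m + 1) ∣ w.comp (X + C (ξ' : ℤ_[p])) -
        C ((w.comp (X + C (ξ' : ℤ_[p]))).coeff 0) := by
      rw [X_pow_dvd_iff]
      intro d hd
      rcases Nat.eq_zero_or_pos d with rfl | hd0
      · simp
      · rw [coeff_sub, hw0 d hd0 (by omega), coeff_C, if_neg (by omega), sub_zero]
    obtain ⟨q, hq⟩ := hdv
    set c0 := (w.comp (X + C (ξ' : ℤ_[p]))).coeff 0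
    have hconst : ∀ n ∈ T', χ n h = c * ps p ((m + 1) * b) c0 := by
      intro n hn
      rw [hc n (hT' hn)]
      obtain ⟨y, hy⟩ := hξ' n hn
      have h1 := congrArg (fun q : ℤ_[p][X] => q.eval ((p : ℤ_[p]) ^ b * (y : ℤ_[p]))) hq
      simp only [eval_sub, eval_comp, eval_add, eval_X, eval_C, eval_mul, eval_pow] at h1
      have h2 : ((ν n : ℤ) : ℤ_[p]) = (p : ℤ_[p]) ^ b * (y : ℤ_[p]) + (ξ' : ℤ_[p]) := by
        have : ν n = (p : ℤ) ^ b * y + ξ' := by rw [← hy]; ring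
        rw [this]; push_cast; rfl
      have h3 : w.eval ((ν n : ℤ) : ℤ_[p]) = c0 + (p : ℤ_[p]) ^ ((m + 1) * b) *
          ((y : ℤ_[p]) ^ (m + 1) * q.eval ((p : ℤ_[p]) ^ b * (y : ℤ_[p]))) := by
        rw [h2, eq_add_of_sub_eq h1]; ring
      rw [h3, AddChar.map_add_eq_mul, (ps_eq_one p _ _).2 ⟨_, rfl⟩, mul_one]
    exact ⟨⟨h, fun n hn n' hn' => by rw [hconst n hn, hconst n' hn']⟩, c,
      fun n hn => hc n (hT hn)⟩
  have hRich : Rich p l N' T (fun n => (ν n - ξ) / (p : ℤ) ^ a) χ' := by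
    refine rescale hpT ξ ha hL hν (fun t => flag_ND hkp hW ?_)
    intro hd
    apply hξξ
    have h1 : (p : ℤ) ∣ (p : ℤ) ^ a * t := Dvd.dvd.mul_right (dvd_pow_self _ (by omega)) _
    have := dvd_sub hd h1
    rwa [show ξ + (p : ℤ) ^ a * t - ξ' - (p : ℤ) ^ a * t = ξ - ξ' by ring] at this
  have hG : ∀ y, ∀ x : A', ‖FS f T' (y + x)‖ = ‖FS f T' y‖ := by
    intro y x
    rcases T'.eq_empty_or_nonempty with he | ⟨n0, hn0⟩
    · simp [FS, he]
    · have : FS f T' (y + x) = χ n0 x * FS f T' y := by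
        unfold FS
        rw [Finset.mul_sum]
        refine Finset.sum_congr rfl fun n hn => ?_
        rw [hf n (hT' hn), x.2 n hn n0 hn0]
      rw [this, norm_mul, AddChar.norm_apply, one_mul]
  have hRl := RR_pos hl
  have hcard : 0 < (Fintype.card A' : ℝ) := by exact_mod_cast Fintype.card_pos
  have hloc : ∀ y, nq (RR l) (fun x : A' => FS f T (y + x)) ≤
      D * ∑ J ∈ parts p (N' + a) ν T, nq (RR l) (fun x : A' => FS f J (y + x)) := by
    intro y
    have := hD A' χ' _ T (fun n x => f n (y + x)) (by
      intro n hn x h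
      change f n (y + (x + h)) = χ n h * f n (y + x)
      rw [← add_assoc, hf n (hT hn)]) hRich
    rw [parts_rescale (ν := ν) (a := a) hν] at this
    exact this
  have hmk := mink (parts p (N' + a) ν T) univ (fun y => ‖FS f T' y‖ ^ (2 * j))
    (fun _ _ => by positivity) (fun J y => nq (RR l) (fun x : A' => FS f J (y + x)))
    (fun _ _ _ _ => nq_nonneg _ _) E (fun J _ => hE J) hRl
    (K := (Fintype.card A' : ℝ) * K') (fun J hJ => by
      rw [coset_avg A' _ _ hG hRl, mul_assoc]
      exact mul_le_mul_of_nonneg_left (hM J hJ) hcard.le)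
  have hfin : (Fintype.card A' : ℝ) * Mx (RR l) j (FS f T) (FS f T') ≤
      (Fintype.card A' : ℝ) * (D ^ RR l * K' * (∑ J ∈ parts p (N' + a) ν T, E J) ^ RR l) := by
    rw [← coset_avg A' _ _ hG hRl]
    calc _ ≤ ∑ y, D ^ RR l * (‖FS f T' y‖ ^ (2 * j) * (∑ J ∈ parts p (N' + a) ν T,
            nq (RR l) (fun x : A' => FS f J (y + x))) ^ RR l) := by
          refine Finset.sum_le_sum fun y _ => ?_
          rw [mul_left_comm, ← mul_pow]
          exact mul_le_mul_of_nonneg_left (pow_le_pow_left₀ (nq_nonneg _ _) (hloc y) _)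
            (by positivity)
      _ ≤ _ := by
          rw [← Finset.mul_sum]
          calc _ ≤ _ := mul_le_mul_of_nonneg_left hmk (by positivity)
            _ = _ := by ring
  exact le_of_mul_le_mul_left hfin hcard

/-- Hoelder with natural exponents -/
lemma hold {X : Type*} (s : Finset X) (h f g : X → ℝ) (hh : ∀ x ∈ s, 0 ≤ h x)
    (hf : ∀ x ∈ s, 0 ≤ f x) (hg : ∀ x ∈ s, 0 ≤ g x) {q : ℕ} (hq : 1 ≤ q)
    (he : ∀ x ∈ s, h x ^ (q + 1) = f x * g x ^ q) :
    (∑ x ∈ s, h x) ^ (q + 1) ≤ (∑ x ∈ s, f x) * (∑ x ∈ s, g x) ^ q := by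
  set J := s.filter (fun x => g x ≠ 0) with hJ
  have hJs : J ⊆ s := filter_subset _ _
  have e1 : ∑ x ∈ s, h x = ∑ x ∈ J, h x := by
    symm
    refine Finset.sum_subset hJs fun x hx hxJ => ?_
    have : g x = 0 := by by_contra hc; exact hxJ (mem_filter.2 ⟨hx, hc⟩)
    have h2 := he x hx
    rw [this, zero_pow (by omega), mul_zero] at h2
    exact (pow_eq_zero_iff (by omega)).1 h2
  have e2 : ∑ x ∈ s, g x = ∑ x ∈ J, g x := by rw [hJ, Finset.sum_filter_ne_zero]
  have e3 : ∑ x ∈ J, f x ≤ ∑ x ∈ s, f x :=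
    Finset.sum_le_sum_of_subset_of_nonneg hJs fun x hx _ => hf x hx
  rw [e1, e2]
  set G := ∑ x ∈ J, g x with hG
  have hpos : ∀ i ∈ J, 0 < g i := fun i hi =>
    lt_of_le_of_ne (hg i (hJs hi)) (Ne.symm (mem_filter.1 hi).2)
  rcases J.eq_empty_or_nonempty with hJe | hJne
  · rw [hG, hJe]; simp [zero_pow (show q ≠ 0 by omega)]
  have hGpos : 0 < G := Finset.sum_pos hpos hJne
  have h1 := Real.pow_arith_mean_le_arith_mean_pow J (fun x => g x / G) (fun x => G * (h x / g x))
    (fun i hi => (div_pos (hpos i hi) hGpos).le) (by rw [← Finset.sum_div, ← hG, div_self hGpos.ne'])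
    (fun i hi => mul_nonneg hGpos.le (div_nonneg (hh i (hJs hi)) (hpos i hi).le)) (q + 1)
  have h2 : ∑ i ∈ J, g i / G * (G * (h i / g i)) = ∑ i ∈ J, h i := by
    refine Finset.sum_congr rfl fun i hi => ?_
    have := (hpos i hi).ne'
    field_simp
  have h3 : ∑ i ∈ J, g i / G * (G * (h i / g i)) ^ (q + 1) = (∑ i ∈ J, f i) * G ^ q := by
    rw [Finset.sum_mul]
    refine Finset.sum_congr rfl fun i hi => ?_
    have := (hpos i hi).ne'
    rw [mul_pow, div_pow, he i (hJs hi)]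
    field_simp
    ring
  rw [h2, h3] at h1
  exact h1.trans (mul_le_mul_of_nonneg_right e3 (by positivity))

lemma RR_id {k l : ℕ} (hl : 1 ≤ l) (hlk : l ≤ k) :
    (RR k - RR (k - l)) + (k - l) * RR (l - 1) = (k - l + 1) * RR l ∧
    RR (k - l) + (k - l) * (RR k - RR (l - 1)) = (k - l + 1) * (RR k - RR l) ∧ RR l ≤ RR k := by
  obtain ⟨q, rfl⟩ := Nat.exists_eq_add_of_le hlk
  obtain ⟨i, rfl⟩ : ∃ i, l = i + 1 := ⟨l - 1, by omega⟩
  have e1 : i + 1 + q - (i + 1) = q := by omega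
  have e2 : i + 1 - 1 = i := by omega
  rw [e1, e2]
  have a1 := two_RR (i + 1 + q)
  have a2 := two_RR q
  have a3 := two_RR i
  have a4 := two_RR (i + 1)
  have b1 : RR q ≤ RR (i + 1 + q) := by nlinarith
  have b2 : RR i ≤ RR (i + 1 + q) := by nlinarith
  have b3 : RR (i + 1) ≤ RR (i + 1 + q) := by nlinarith
  zify [b1, b2, b3] at *
  refine ⟨?_, ?_, b3⟩
  · have : (2 : ℤ) * ((RR (i + 1 + q) - RR q) + q * RR i) = 2 * ((q + 1) * RR (i + 1)) := by
      linear_combination a1 - a2 + q * a3 - (q + 1) * a4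
    linarith
  · have : (2 : ℤ) * (RR q + q * (RR (i + 1 + q) - RR i)) =
        2 * ((q + 1) * (RR (i + 1 + q) - RR (i + 1))) := by
      linear_combination a2 + q * (a1 - a3) - (q + 1) * (a1 - a4)
    linarith

lemma step3 {A : Type} [Fintype A] (F G : A → ℂ) {k l : ℕ} (hl : 1 ≤ l) (hlk : l < k) :
    Mx (RR l) (RR k - RR l) F G ^ (k - l + 1) ≤
      Mx (RR (k - l)) (RR k - RR (k - l)) G F * Mx (RR (l - 1)) (RR k - RR (l - 1)) F G ^ (k - l) := by
  unfold Mx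
  obtain ⟨h1, h2, -⟩ := RR_id hl hlk.le
  refine hold _ _ _ _ (fun _ _ => by positivity) (fun _ _ => by positivity)
    (fun _ _ => by positivity) (by omega) fun x _ => ?_
  rw [mul_pow, mul_pow, ← pow_mul, ← pow_mul, ← pow_mul, ← pow_mul]
  have e1 : 2 * RR l * (k - l + 1) = 2 * (RR k - RR (k - l)) + 2 * RR (l - 1) * (k - l) := by
    calc _ = 2 * ((k - l + 1) * RR l) := by ring
      _ = _ := by rw [← h1]; ring
  have e2 : 2 * (RR k - RR l) * (k - l + 1) = 2 * RR (k - l) + 2 * (RR k - RR (l - 1)) * (k - l) := by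
    calc _ = 2 * ((k - l + 1) * (RR k - RR l)) := by ring
      _ = _ := by rw [← h2]; ring
  rw [e1, e2, pow_add, pow_add]
  ring

end steps
end VMV

namespace VMV
open Polynomial

section bil
variable {p : ℕ} [hp : Fact p.Prime]

open ComplexConjugate in
lemma orth {A : Type} [AddCommGroup A] [Fintype A] {χ χ' : AddChar A ℂ} (hne : χ ≠ χ')
    {f g : A → ℂ} (hf : ∀ x h, f (x + h) = χ h * f x) (hg : ∀ x h, g (x + h) = χ' h * g x) :
    ∑ x, f x * conj (g x) = 0 := by
  obtain ⟨h, hh⟩ : ∃ h, χ h ≠ χ' h := by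
    by_contra hc
    push Not at hc
    exact hne (by ext x; exact hc x)
  have h1 : ∑ x, f x * conj (g x) = (χ h * conj (χ' h)) * ∑ x, f x * conj (g x) := by
    rw [Finset.mul_sum, ← Equiv.sum_comp (Equiv.addRight h) (fun x => f x * conj (g x))]
    refine Finset.sum_congr rfl fun x _ => ?_
    simp only [Equiv.coe_addRight]
    rw [hf, hg, map_mul]; ring
  have h2 : χ h * conj (χ' h) ≠ 1 := by
    intro h3
    apply hh
    have h4 : conj (χ' h) * χ' h = 1 := by
      rw [mul_comm, Complex.mul_conj', AddChar.norm_apply]; simp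
    calc χ h = χ h * (conj (χ' h) * χ' h) := by rw [h4, mul_one]
      _ = _ := by rw [← mul_assoc, h3, one_mul]
  have h5 : (1 - χ h * conj (χ' h)) * ∑ x, f x * conj (g x) = 0 := by
    rw [sub_mul, one_mul, ← h1, sub_self]
  rcases mul_eq_zero.1 h5 with h6 | h6
  · exact absurd (sub_eq_zero.1 h6).symm h2
  · exact h6

open ComplexConjugate in
lemma pyth {A ι : Type} [Fintype A] (I : Finset ι) (g : ι → A → ℂ)
    (h : ∀ i ∈ I, ∀ j ∈ I, i ≠ j → ∑ x, g i x * conj (g j x) = 0) :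
    ∑ x, ‖∑ i ∈ I, g i x‖ ^ 2 = ∑ i ∈ I, ∑ x, ‖g i x‖ ^ 2 := by
  have : ((∑ x, ‖∑ i ∈ I, g i x‖ ^ 2 : ℝ) : ℂ) = ((∑ i ∈ I, ∑ x, ‖g i x‖ ^ 2 : ℝ) : ℂ) := by
    push_cast
    simp_rw [← Complex.mul_conj', map_sum, Finset.sum_mul_sum]
    rw [Finset.sum_comm]
    refine Finset.sum_congr rfl fun i hi => ?_
    rw [Finset.sum_comm, Finset.sum_eq_single i]
    · intro j hj hji
      exact h i hi j hj (Ne.symm hji)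
    · intro hc; exact absurd hi hc
  exact_mod_cast this

lemma Dec_one (N : ℕ) : Dec p 1 N 1 := by
  intro A _ _ χ ν S f hf hR
  have hRR : RR 1 = 1 := rfl
  have hnq : ∀ g : A → ℂ, nq (RR 1) g = ∑ x, ‖g x‖ ^ 2 := by
    intro g; simp [nq, hRR]
  obtain ⟨W, hW, hph⟩ := hR
  rw [one_mul, hnq]
  simp_rw [hnq]
  have hS : ∀ x, ∑ n ∈ S, f n x = ∑ T ∈ parts p N ν S, ∑ n ∈ T, f n x := fun x => sum_parts _
  simp_rw [hS]
  rw [pyth (parts p N ν S) (fun T x => ∑ n ∈ T, f n x)]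
  intro T hT T' hT' hne
  simp_rw [map_sum, Finset.sum_mul_sum]
  rw [Finset.sum_comm]
  refine Finset.sum_eq_zero fun n hn => ?_
  rw [Finset.sum_comm]
  refine Finset.sum_eq_zero fun n' hn' => ?_
  have hnS := parts_subset hT hn
  have hnS' := parts_subset hT' hn'
  refine orth (χ := χ n) (χ' := χ n') ?_ (hf n hnS) (hf n' hnS')
  intro hχ
  apply hne
  rw [parts_eq hT hn, parts_eq hT' hn']
  have key : (p : ℤ) ^ N ∣ ν n' - ν n := by
    obtain ⟨w, hw, r, c, hc⟩ := hW (ν n) 1 le_rfl le_rfl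
    obtain ⟨h, d, hd⟩ := hph w hw
    have e1 := hd n hnS
    have e2 := hd n' hnS'
    have hd0 : d ≠ 0 := by
      intro h0
      rw [h0, zero_mul] at e1
      have : ‖χ n h‖ = 1 := AddChar.norm_apply _ _
      rw [e1] at this; simp at this
    rw [hχ, e2] at e1
    have e3 := mul_left_cancel₀ hd0 e1
    set y : ℤ_[p] := ((ν n' - ν n : ℤ) : ℤ_[p]) with hy
    have f1 := congrArg (fun q : ℤ_[p][X] => q.eval y) hc
    have f2 := congrArg (fun q : ℤ_[p][X] => q.eval 0) hc
    simp only [eval_comp, eval_add, eval_X, eval_C, eval_mul, eval_pow, pow_one] at f1 f2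
    rw [hy] at f1
    push_cast at f1
    rw [sub_add_cancel] at f1
    rw [zero_add] at f2
    have e4 : w.eval ((ν n' : ℤ) : ℤ_[p]) = w.eval ((ν n : ℤ) : ℤ_[p]) +
        y * (1 + p * (y * r.eval y)) := by
      rw [f1, f2, hy]; push_cast; ring
    rw [e4, AddChar.map_add_eq_mul] at e3
    have hps : ps p (1 * N) (w.eval ((ν n : ℤ) : ℤ_[p])) ≠ 0 := by
      rw [ps_apply]
      intro h0
      have : ‖ZMod.stdAddChar (N := p ^ (1 * N)) (PadicInt.toZModPow (1 * N) (w.eval ((ν n : ℤ) : ℤ_[p])))‖ = 1 :=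
        AddChar.norm_apply _ _
      rw [h0] at this; simp at this
    have e5 := (mul_eq_left₀ hps).1 e3
    rw [ps_eq_one, one_mul] at e5
    have hu : IsUnit (1 + (p : ℤ_[p]) * (y * r.eval y)) := by
      apply isUnit_of_toZMod
      simp
    rw [hu.dvd_mul_right] at e5
    have := (PadicInt.pow_p_dvd_int_iff N (ν n' - ν n)).1 e5
    exact_mod_cast this
  refine filter_congr fun m _ => ?_
  constructor
  · intro h
    have := dvd_sub h key
    rwa [show ν m - ν n - (ν n' - ν n) = ν m - ν n' by ring] at this
  · intro h
    have := dvd_add h key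
    rwa [show ν m - ν n' + (ν n' - ν n) = ν m - ν n by ring] at this

lemma Dec_triv {k : ℕ} (hk : 1 ≤ k) (N : ℕ) : Dec p k N ((p : ℝ) ^ N) := by
  intro A _ _ χ ν S f hf hR
  have hS : (fun x => ∑ n ∈ S, f n x) = fun x => ∑ T ∈ parts p N ν S, ∑ n ∈ T, f n x :=
    funext fun x => sum_parts _
  rw [hS]
  refine (nq_triv (RR_pos hk) _ _).trans ?_
  refine mul_le_mul_of_nonneg_right ?_ (Finset.sum_nonneg fun _ _ => nq_nonneg _ _)
  exact_mod_cast card_parts N ν S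

def Bil (p : ℕ) [Fact p.Prime] (k l a b N : ℕ) (K : ℝ) : Prop :=
  ∀ (A : Type) [AddCommGroup A] [Fintype A] (χ : ℤ → AddChar A ℂ) (ν : ℤ → ℤ) (S : Finset ℤ)
    (f : ℤ → A → ℂ), Eqv χ S f → Rich p k N S ν χ → ∀ ξ ξ' : ℤ, ¬ (p : ℤ) ∣ ξ - ξ' →
    ∀ T T' : Finset ℤ, T ⊆ S → T' ⊆ S → (∀ n ∈ T, (p : ℤ) ^ a ∣ ν n - ξ) →
    (∀ n ∈ T', (p : ℤ) ^ b ∣ ν n - ξ') →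
    Mx (RR l) (RR k - RR l) (FS f T) (FS f T') ≤
      K * (ee p k N ν f T ^ RR l * ee p k N ν f T' ^ (RR k - RR l))

lemma Bil.mono {k l a b N : ℕ} {K K' : ℝ} (h : Bil p k l a b N K) (hK : K ≤ K') :
    Bil p k l a b N K' := by
  intro A _ _ χ ν S f hf hR ξ ξ' hξ T T' hT hT' h1 h2
  refine (h A χ ν S f hf hR ξ ξ' hξ T T' hT hT' h1 h2).trans ?_
  have := ee_nonneg p k N ν f T
  have := ee_nonneg p k N ν f T'
  exact mul_le_mul_of_nonneg_right hK (by positivity)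

lemma Bil_zero {k a b N : ℕ} {D : ℝ} (hk : 1 ≤ k) (hD : Dec p k (N - b) D) (hb : 1 ≤ b)
    (hbN : b ≤ N) : Bil p k 0 a b N (D ^ RR k) := by
  intro A _ _ χ ν S f hf hR ξ ξ' hξ T T' hT hT' h1 h2
  have h3 := R1 hD hb hbN hf hR hT' ξ' h2
  have h4 : RR 0 = 0 := rfl
  have h5 := pow_le_pow_left₀ (nq_nonneg _ _) h3 (RR k)
  rw [nq_pow (RR_pos hk), mul_pow] at h5
  simpa [Mx, h4] using h5

lemma Bil_triv {k l a b N : ℕ} {D : ℝ} (hl : 1 ≤ l) (hlk : l < k) (hD : Dec p k N D) (hD0 : 0 ≤ D) :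
    Bil p k l a b N (2 * D ^ RR k) := by
  intro A _ _ χ ν S f hf hR ξ ξ' hξ T T' hT hT' h1 h2
  have g1 := R1' hD hf hR hT
  have g2 := R1' hD hf hR hT'
  have hRk := RR_pos (show 1 ≤ k by omega)
  have hRl := RR_pos hl
  have hlt : RR l < RR k := by
    have := two_RR l; have := two_RR k; nlinarith
  have hz : ∀ F : A → ℂ, nq (RR k) F ≤ 0 → ∀ x, F x = 0 := by
    intro F hF x
    have : nq (RR k) F = 0 := le_antisymm hF (nq_nonneg _ _)
    have h3 := nq_pow hRk F
    rw [this, zero_pow (by omega)] at h3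
    have h4 := (Finset.sum_eq_zero_iff_of_nonneg (fun x _ => by positivity)).1 h3.symm x (mem_univ _)
    simpa using (pow_eq_zero_iff (by omega)).1 h4
  have e1 := ee_nonneg p k N ν f T
  have e2 := ee_nonneg p k N ν f T'
  have hrhs : 0 ≤ 2 * D ^ RR k * (ee p k N ν f T ^ RR l * ee p k N ν f T' ^ (RR k - RR l)) := by
    positivity
  rcases e1.eq_or_lt with e1 | e1
  · rw [← e1, mul_zero] at g1
    have : Mx (RR l) (RR k - RR l) (FS f T) (FS f T') = 0 := by
      refine Finset.sum_eq_zero fun x _ => ?_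
      rw [hz _ g1 x, norm_zero, zero_pow (by omega), zero_mul]
    rw [this]; exact hrhs
  rcases e2.eq_or_lt with e2 | e2
  · rw [← e2, mul_zero] at g2
    have : Mx (RR l) (RR k - RR l) (FS f T) (FS f T') = 0 := by
      refine Finset.sum_eq_zero fun x _ => ?_
      rw [hz _ g2 x, norm_zero, zero_pow (by omega), mul_zero]
    rw [this]; exact hrhs
  set E := ee p k N ν f T
  set E' := ee p k N ν f T'
  have q1 := pow_le_pow_left₀ (nq_nonneg _ _) g1 (RR k)
  have q2 := pow_le_pow_left₀ (nq_nonneg _ _) g2 (RR k)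
  rw [nq_pow hRk, mul_pow] at q1 q2
  have hpt : ∀ x, ‖FS f T x‖ ^ (2 * RR l) * ‖FS f T' x‖ ^ (2 * (RR k - RR l)) ≤
      (E ^ RR l * E' ^ (RR k - RR l)) * (‖FS f T x‖ ^ (2 * RR k) / E ^ RR k +
        ‖FS f T' x‖ ^ (2 * RR k) / E' ^ RR k) := by
    intro x
    have hb : ∀ u v : ℝ, 0 ≤ u → 0 ≤ v → u ^ RR l * v ^ (RR k - RR l) ≤ u ^ RR k + v ^ RR k := by
      intro u v hu hv
      have hkl : RR k = RR l + (RR k - RR l) := by omega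
      rcases le_total u v with h | h
      · calc _ ≤ v ^ RR l * v ^ (RR k - RR l) := by gcongr
          _ = v ^ RR k := by rw [← pow_add, ← hkl]
          _ ≤ _ := le_add_of_nonneg_left (by positivity)
      · calc _ ≤ u ^ RR l * u ^ (RR k - RR l) := by gcongr
          _ = u ^ RR k := by rw [← pow_add, ← hkl]
          _ ≤ _ := le_add_of_nonneg_right (by positivity)
    have := hb (‖FS f T x‖ ^ 2 / E) (‖FS f T' x‖ ^ 2 / E') (by positivity) (by positivity)
    rw [div_pow, div_pow, div_pow, div_pow, ← pow_mul, ← pow_mul, ← pow_mul, ← pow_mul] at this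
    calc _ = (E ^ RR l * E' ^ (RR k - RR l)) * (‖FS f T x‖ ^ (2 * RR l) / E ^ RR l *
          (‖FS f T' x‖ ^ (2 * (RR k - RR l)) / E' ^ (RR k - RR l))) := by field_simp
      _ ≤ _ := mul_le_mul_of_nonneg_left this (by positivity)
  calc _ ≤ ∑ x, (E ^ RR l * E' ^ (RR k - RR l)) * (‖FS f T x‖ ^ (2 * RR k) / E ^ RR k +
        ‖FS f T' x‖ ^ (2 * RR k) / E' ^ RR k) := Finset.sum_le_sum fun x _ => hpt x
    _ = (E ^ RR l * E' ^ (RR k - RR l)) * ((∑ x, ‖FS f T x‖ ^ (2 * RR k)) / E ^ RR k +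
        (∑ x, ‖FS f T' x‖ ^ (2 * RR k)) / E' ^ RR k) := by
        rw [← Finset.mul_sum, Finset.sum_add_distrib, Finset.sum_div, Finset.sum_div]
    _ ≤ (E ^ RR l * E' ^ (RR k - RR l)) * (D ^ RR k * E ^ RR k / E ^ RR k +
        D ^ RR k * E' ^ RR k / E' ^ RR k) := by gcongr
    _ = _ := by field_simp; ring

lemma Bil_step {k l a a' b N : ℕ} {D K K1 K2 : ℝ} (hkp : k < p) (hl : 1 ≤ l) (hlk : l < k)
    (ha : 1 ≤ a) (haa : a ≤ a') (hL : l * a' ≤ (k - l + 1) * b) (haN : a' ≤ N) (hbN : b ≤ N)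
    (hD : Dec p l (a' - a) D) (hD0 : 0 ≤ D) (h1 : Bil p k (k - l) b a' N K1)
    (h2 : Bil p k (l - 1) a' b N K2) (hK : 0 ≤ K) (hK1 : 0 ≤ K1)
    (hKK : K1 * K2 ^ (k - l) ≤ K ^ (k - l + 1)) :
    Bil p k l a b N (D ^ RR l * K) := by
  obtain ⟨m, rfl⟩ : ∃ m, k = m + l := ⟨k - l, by omega⟩
  rw [Nat.add_sub_cancel] at *
  intro A _ _ χ ν S f hf hR ξ ξ' hξξ T T' hT hT' hξ hξ'
  have haa2 : a' - a + a = a' := Nat.sub_add_cancel haa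
  have e2 := ee_nonneg p (m + l) N ν f T'
  obtain ⟨i1, i2, -⟩ := RR_id hl hlk.le
  rw [Nat.add_sub_cancel] at i1 i2
  have main := step2core (a := a) (b := b) (ξ := ξ) (ξ' := ξ') (N' := a' - a) hkp hl hD hD0 ha
    (by rw [haa2]; exact hL) hbN hf hR hT hT' hξξ hξ hξ' (j := RR (m + l) - RR l)
    (K' := K * ee p (m + l) N ν f T' ^ (RR (m + l) - RR l)) (E := ee p (m + l) N ν f)
    (fun J => ee_nonneg _ _ _ _ _ _) (by
      intro J hJ
      rw [haa2] at hJ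
      obtain ⟨n0, hn0⟩ := parts_nonempty hJ
      have hJT := parts_subset hJ
      have hJν : ∀ n ∈ J, (p : ℤ) ^ a' ∣ ν n - ν n0 := by
        intro n hn
        rw [parts_eq hJ hn0] at hn
        exact (mem_filter.1 hn).2
      have hp1 : (p : ℤ) ∣ ν n0 - ξ := (dvd_pow_self _ (by omega)).trans (hξ n0 (hJT hn0))
      have hn1 : ¬ (p : ℤ) ∣ ν n0 - ξ' := by
        intro hd
        have := dvd_sub hd hp1
        rw [show ν n0 - ξ' - (ν n0 - ξ) = ξ - ξ' by ring] at this
        exact hξξ this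
      have hn2 : ¬ (p : ℤ) ∣ ξ' - ν n0 := by rwa [dvd_sub_comm]
      have m1 := h1 A χ ν S f hf hR ξ' (ν n0) hn2 T' J hT' (hJT.trans hT) hξ' hJν
      have m2 := h2 A χ ν S f hf hR (ν n0) ξ' hn1 J T' (hJT.trans hT) hT' hJν hξ'
      have m3 := step3 (FS f J) (FS f T') hl hlk
      rw [Nat.add_sub_cancel] at m3
      have e1 := ee_nonneg p (m + l) N ν f J
      set E := ee p (m + l) N ν f J
      set E' := ee p (m + l) N ν f T'
      have hM0 : ∀ i j (F G : A → ℂ), 0 ≤ Mx i j F G := fun i j F G =>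
        Finset.sum_nonneg fun _ _ => by positivity
      have m4 : Mx (RR l) (RR (m + l) - RR l) (FS f J) (FS f T') ^ (m + 1) ≤
          (K * E' ^ (RR (m + l) - RR l) * E ^ RR l) ^ (m + 1) := by
        calc _ ≤ _ := m3
          _ ≤ K1 * (E' ^ RR m * E ^ (RR (m + l) - RR m)) * (K2 * (E ^ RR (l - 1) *
              E' ^ (RR (m + l) - RR (l - 1)))) ^ m := by
            refine mul_le_mul m1 (pow_le_pow_left₀ (hM0 _ _ _ _) m2 _)
              (pow_nonneg (hM0 _ _ _ _) _) (by positivity)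
          _ = (K1 * K2 ^ m) * (E ^ ((RR (m + l) - RR m) + m * RR (l - 1)) *
              E' ^ (RR m + m * (RR (m + l) - RR (l - 1)))) := by
            rw [mul_pow, mul_pow, pow_add, pow_add, mul_comm m, mul_comm m, pow_mul, pow_mul]; ring
          _ ≤ K ^ (m + 1) * (E ^ ((RR (m + l) - RR m) + m * RR (l - 1)) *
              E' ^ (RR m + m * (RR (m + l) - RR (l - 1)))) := by gcongr
          _ = _ := by
            rw [i1, i2, mul_pow, mul_pow, ← pow_mul, ← pow_mul]; ring_nf
      exact le_of_pow_le_pow_left₀ (by omega) (by positivity) m4)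
  rw [haa2, ← ee_split _ haN] at main
  refine main.trans (le_of_eq ?_)
  ring

end bil
end VMV

namespace VMV
open Polynomial

section iter
variable {p : ℕ} [hp : Fact p.Prime]

def Good (p : ℕ) [Fact p.Prime] (k : ℕ) (η : ℝ) : Prop :=
  ∃ C > (0 : ℝ), ∀ N : ℕ, Dec p k N (C * (p : ℝ) ^ (η * N))

lemma sum_id (K : ℕ) (s : ℕ → ℝ) :
    ∑ i ∈ range (K + 1), (s (K + 2 - (i + 1)) / ((i + 1 : ℕ) : ℝ) +
      ((K + 2 - (i + 1) : ℕ) : ℝ) / (((K + 2 - (i + 1) : ℕ) : ℝ) + 1) * s i)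
    = ∑ i ∈ range (K + 1), s (i + 1) + (K + 1) / (K + 2) * s 0 := by
  rw [Finset.sum_add_distrib]
  have h1 : ∑ i ∈ range (K + 1), s (K + 2 - (i + 1)) / ((i + 1 : ℕ) : ℝ)
      = ∑ i ∈ range (K + 1), s (i + 1) / ((K + 1 - i : ℕ) : ℝ) := by
    rw [← Finset.sum_range_reflect]
    refine Finset.sum_congr rfl fun i hi => ?_
    have := mem_range.1 hi
    congr 2
    · congr 1; omega
    · omega
  have h2 : ∑ i ∈ range (K + 1), ((K + 2 - (i + 1) : ℕ) : ℝ) / (((K + 2 - (i + 1) : ℕ) : ℝ) + 1) * s i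
      = ∑ i ∈ range (K + 1), (((K - i : ℕ) : ℝ) / ((K + 1 - i : ℕ) : ℝ)) * s (i + 1)
        + (K + 1) / (K + 2) * s 0 := by
    rw [Finset.sum_range_succ', Finset.sum_range_succ (n := K)]
    have : K + 2 - (0 + 1) = K + 1 := by omega
    rw [this, Nat.sub_self]
    push_cast
    rw [zero_div, zero_mul, add_zero, add_assoc (K : ℝ) 1 1, one_add_one_eq_two]
    congr 1
    refine Finset.sum_congr rfl fun i hi => ?_
    have := mem_range.1 hi
    have e1 : K + 2 - (i + 1 + 1) = K - i := by omega
    have e2 : K + 1 - i = K - i + 1 := by omega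
    rw [e2]; push_cast; rfl
  rw [h1, h2, ← add_assoc, ← Finset.sum_add_distrib]
  congr 1
  refine Finset.sum_congr rfl fun i hi => ?_
  have := mem_range.1 hi
  have e2 : K + 1 - i = K - i + 1 := by omega
  rw [e2]
  push_cast
  have : (0 : ℝ) ≤ ((K - i : ℕ) : ℝ) := by positivity
  field_simp
  ring

lemma p1 : (1 : ℝ) < (p : ℝ) := by exact_mod_cast hp.out.one_lt

lemma iter_zero {k : ℕ} (hk : 2 ≤ k) {η0 η : ℝ} (hη : η0 ≤ η) (hG : Good p k η) {ε : ℝ}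
    (hε : 0 < ε) : ∃ C > (0 : ℝ), ∀ N a b : ℕ, 1 ≤ b → b ≤ N →
      Bil p k 0 a b N (C * (p : ℝ) ^ (η * RR k * N + ε * N - η0 * RR k * b)) := by
  obtain ⟨C, hC, hD⟩ := hG
  refine ⟨C ^ RR k, by positivity, fun N a b hb hbN => ?_⟩
  refine (Bil_zero (by omega) (hD (N - b)) hb hbN).mono ?_
  rw [mul_pow]
  refine mul_le_mul_of_nonneg_left ?_ (by positivity)
  rw [← Real.rpow_natCast, ← Real.rpow_mul (by positivity)]
  refine Real.rpow_le_rpow_of_exponent_le p1.le ?_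
  rw [Nat.cast_sub hbN]
  have h1 : (0 : ℝ) ≤ RR k * b := by positivity
  have h2 : 0 ≤ ε * N := by positivity
  nlinarith

lemma iter {k : ℕ} (hk : 2 ≤ k) (hkp : k < p)
    (hIH : ∀ l, 1 ≤ l → l < k → ∀ ε > (0 : ℝ), Good p l ε) {η0 : ℝ} (hη0 : 0 < η0) (n : ℕ) :
    ∃ s : ℕ → ℝ, s 0 = η0 * RR k ∧ (∀ l, 0 ≤ s l) ∧
      n * ((k - 1 : ℕ) / k * (η0 * RR k)) ≤ ∑ i ∈ range (k - 1), s (i + 1) ∧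
      ∀ η ≥ η0, Good p k η → ∀ l < k, ∀ ε > (0 : ℝ), ∃ C > (0 : ℝ), ∀ N a b : ℕ, 1 ≤ a →
        k ^ (n + 1) ≤ b → l * a ≤ (k - l + 1) * b → k ^ (n + 1) * b ≤ N →
        Bil p k l a b N (C * (p : ℝ) ^ (η * RR k * N + ε * N - s l * b)) := by
  have hp0 : (0 : ℝ) < p := zero_lt_one.trans p1
  have hRk := RR_pos (show 1 ≤ k by omega)
  induction n with
  | zero =>
    refine ⟨fun l => if l = 0 then η0 * RR k else 0, by simp, fun l => ?_, by simp, ?_⟩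
    · dsimp only; split_ifs <;> positivity
    · intro η hη hG l hl ε hε
      rcases Nat.eq_zero_or_pos l with rfl | hl0
      · obtain ⟨C, hC, h⟩ := iter_zero hk hη hG hε
        refine ⟨C, hC, fun N a b ha hb _ hN => ?_⟩
        simp only [if_true]
        have : 0 < k ^ (0 + 1) := by positivity
        exact h N a b (by omega) (by nlinarith)
      · obtain ⟨C, hC, hD⟩ := hG
        refine ⟨2 * C ^ RR k, by positivity, fun N a b ha hb _ hN => ?_⟩
        refine (Bil_triv hl0 hl (hD N) (by positivity)).mono ?_
        rw [mul_pow, mul_assoc]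
        refine mul_le_mul_of_nonneg_left (mul_le_mul_of_nonneg_left ?_ (by positivity)) (by norm_num)
        rw [← Real.rpow_natCast, ← Real.rpow_mul (by positivity)]
        refine Real.rpow_le_rpow_of_exponent_le p1.le ?_
        dsimp only
        rw [if_neg (by omega)]
        have h2 : 0 ≤ ε * N := by positivity
        nlinarith
  | succ n ih =>
    obtain ⟨s, hs0, hspos, hsum, hB⟩ := ih
    refine ⟨fun l => if l = 0 then η0 * RR k else s (k - l) / (l : ℝ) +
      ((k - l : ℕ) : ℝ) / (((k - l : ℕ) : ℝ) + 1) * s (l - 1), by simp, fun l => ?_, ?_, ?_⟩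
    · have := hspos (k - l)
      have := hspos (l - 1)
      dsimp only; split_ifs <;> positivity
    · obtain ⟨K, rfl⟩ : ∃ K, k = K + 2 := ⟨k - 2, by omega⟩
      have e1 : K + 2 - 1 = K + 1 := by omega
      rw [e1] at hsum ⊢
      have := sum_id K s
      simp only [Nat.add_eq_zero_iff, one_ne_zero, and_false, if_false, Nat.add_sub_cancel]
      rw [this, hs0]
      push_cast at hsum ⊢
      linarith
    · intro η hη hG l hl ε hε
      rcases Nat.eq_zero_or_pos l with rfl | hl0
      · obtain ⟨C, hC, h⟩ := iter_zero hk hη hG hε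
        refine ⟨C, hC, fun N a b ha hb _ hN => ?_⟩
        simp only [if_true]
        have : 0 < k ^ (n + 1 + 1) := by positivity
        exact h N a b (by omega) (by nlinarith)
      · obtain ⟨C1, hC1, h1⟩ := hB η hη hG (k - l) (by omega) (ε / 2) (by positivity)
        obtain ⟨C2, hC2, h2⟩ := hB η hη hG (l - 1) (by omega) (ε / 2) (by positivity)
        obtain ⟨Cl, hCl, hDl⟩ := hIH l hl0 hl (ε / (2 * RR k)) (by positivity)
        refine ⟨Cl ^ RR l * (C1 + C2) * (p : ℝ) ^ (s (k - l)), by positivity,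
          fun N a b ha hb hab hN => ?_⟩
        obtain ⟨q, hq⟩ : ∃ q, q = k - l := ⟨_, rfl⟩
        dsimp only
        rw [if_neg (by omega)]
        rw [← hq] at h1 hab ⊢
        obtain ⟨a', ha'⟩ : ∃ a', a' = (q + 1) * b / l := ⟨_, rfl⟩
        have hb1 : l * a' ≤ (q + 1) * b := by rw [ha']; exact Nat.mul_div_le _ _
        have hb2 : (q + 1) * b < l * (a' + 1) := by
          rw [ha']; exact Nat.lt_mul_div_succ _ hl0
        have haa : a ≤ a' := by
          rw [ha', Nat.le_div_iff_mul_le hl0, mul_comm]; exact hab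
        have hq1 : 1 ≤ q := by omega
        have hqk : q + 1 ≤ k := by omega
        have hkn : 0 < k ^ (n + 1) := by positivity
        have hbk : k ≤ b := le_trans (by
          calc k = k ^ 1 := (pow_one k).symm
            _ ≤ _ := Nat.pow_le_pow_right (by omega) (by omega)) hb
        have hb3 : q * b ≤ l * a' := by nlinarith
        have ha'k : a' ≤ k * b := by
          calc a' ≤ l * a' := Nat.le_mul_of_pos_left _ hl0
            _ ≤ (q + 1) * b := hb1
            _ ≤ _ := Nat.mul_le_mul_right _ hqk
        have hba' : b ≤ k * a' := by
          calc b ≤ q * b := Nat.le_mul_of_pos_left _ hq1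
            _ ≤ l * a' := hb3
            _ ≤ _ := Nat.mul_le_mul_right _ hl.le
        have hNa : k ^ (n + 1) * a' ≤ N := by
          calc _ ≤ k ^ (n + 1) * (k * b) := Nat.mul_le_mul_left _ ha'k
            _ = k ^ (n + 1 + 1) * b := by ring
            _ ≤ N := hN
        have hNb : k ^ (n + 1) * b ≤ N := le_trans (Nat.mul_le_mul_right _
          (Nat.pow_le_pow_right (by omega) (by omega))) hN
        have ha'N : a' ≤ N := le_trans (Nat.le_mul_of_pos_left _ hkn) hNa
        have hbN : b ≤ N := le_trans (Nat.le_mul_of_pos_left _ hkn) hNb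
        have hka' : k ^ (n + 1) ≤ a' := by
          have : k ^ (n + 1) * k ≤ a' * k := by
            calc _ = k ^ (n + 1 + 1) := by ring
              _ ≤ b := hb
              _ ≤ _ := by rw [mul_comm]; exact hba'
          exact Nat.le_of_mul_le_mul_right this (by omega)
        have hkb : k ^ (n + 1) ≤ b := le_trans (Nat.pow_le_pow_right (by omega) (by omega)) hb
        have B1 := h1 N b a' (by omega) hka' (by
          have : k - q = l := by omega
          rw [this]; nlinarith) hNa
        have B2 := h2 N a' b (by omega) hkb (by
          calc (l - 1) * a' ≤ l * a' := Nat.mul_le_mul_right _ (by omega)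
            _ ≤ (q + 1) * b := hb1
            _ ≤ _ := Nat.mul_le_mul_right _ (by omega)) hNb
        set Y : ℝ := η * RR k * N + ε / 2 * N with hY
        set s' : ℝ := s q / (l : ℝ) + (q : ℝ) / ((q : ℝ) + 1) * s (l - 1) with hs'
        have main := Bil_step (K := (C1 + C2) * (p : ℝ) ^ (Y + s q - s' * b)) hkp hl0 hl ha haa
          (by rw [← hq]; exact hb1) ha'N hbN (hDl (a' - a)) (by positivity)
          (by rw [← hq]; exact B1) B2 (by positivity) (by positivity) (by
            rw [← hq, mul_pow, mul_pow, pow_succ (C1 + C2)]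
            rw [show C1 * (p : ℝ) ^ (Y - s q * ↑a') * (C2 ^ q * ((p : ℝ) ^ (Y - s (l - 1) * ↑b)) ^ q)
              = C2 ^ q * C1 * ((p : ℝ) ^ (Y - s q * ↑a') * ((p : ℝ) ^ (Y - s (l - 1) * ↑b)) ^ q) by ring]
            have hc : C2 ^ q * C1 ≤ (C1 + C2) ^ q * (C1 + C2) := by
              refine mul_le_mul (pow_le_pow_left₀ hC2.le (by linarith) _) (by linarith) hC1.le
                (by positivity)
            refine mul_le_mul hc ?_ (by positivity) (by positivity)
            rw [← Real.rpow_natCast, ← Real.rpow_natCast, ← Real.rpow_mul hp0.le,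
              ← Real.rpow_mul hp0.le, ← Real.rpow_add hp0]
            refine Real.rpow_le_rpow_of_exponent_le p1.le ?_
            have hl' : (0 : ℝ) < l := by exact_mod_cast hl0
            have hb2' : ((q : ℝ) + 1) * b / l ≤ a' + 1 := by
              rw [div_le_iff₀ hl']
              have : (((q + 1) * b : ℕ) : ℝ) ≤ ((l * (a' + 1) : ℕ) : ℝ) := by exact_mod_cast hb2.le
              push_cast at this
              linarith
            have hsq := hspos q
            have h3 : ((q : ℝ) + 1) * (s' * b) = s q * (((q : ℝ) + 1) * b / l) + q * s (l - 1) * b := by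
              rw [hs']; field_simp
            have h4 := mul_le_mul_of_nonneg_left hb2' hsq
            have h5 : 0 ≤ (q : ℝ) * s q := by positivity
            push_cast
            nlinarith)
        refine main.mono ?_
        have hDle : (Cl * (p : ℝ) ^ (ε / (2 * RR k) * ((a' - a : ℕ) : ℝ))) ^ RR l ≤
            Cl ^ RR l * (p : ℝ) ^ (ε / 2 * N) := by
          rw [mul_pow]
          refine mul_le_mul_of_nonneg_left ?_ (by positivity)
          rw [← Real.rpow_natCast, ← Real.rpow_mul hp0.le]
          refine Real.rpow_le_rpow_of_exponent_le p1.le ?_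
          have g1 : (((a' - a : ℕ) : ℝ)) ≤ N := by exact_mod_cast (by omega : a' - a ≤ N)
          have g2 : ((RR l : ℕ) : ℝ) ≤ RR k := by
            exact_mod_cast (RR_id hl0 hl.le).2.2
          have g3 : (0 : ℝ) < RR k := by exact_mod_cast hRk
          calc ε / (2 * RR k) * ((a' - a : ℕ) : ℝ) * (RR l : ℕ) ≤ ε / (2 * RR k) * N * RR k := by
                gcongr
            _ = _ := by field_simp
        calc _ ≤ (Cl ^ RR l * (p : ℝ) ^ (ε / 2 * N)) * ((C1 + C2) * (p : ℝ) ^ (Y + s q - s' * b)) :=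
              mul_le_mul_of_nonneg_right hDle (by positivity)
          _ = Cl ^ RR l * (C1 + C2) * (((p : ℝ) ^ (ε / 2 * N)) * (p : ℝ) ^ (Y + s q - s' * b)) := by ring
          _ = Cl ^ RR l * (C1 + C2) * ((p : ℝ) ^ (s q) * (p : ℝ) ^ (η * RR k * N + ε * N - s' * b)) := by
              rw [← Real.rpow_add hp0, ← Real.rpow_add hp0, hY]; ring_nf
          _ = _ := by ring

end iter
end VMV

namespace VMV
open Polynomial

section final
variable {p : ℕ} [hp : Fact p.Prime]

lemma Dec.mono {k N : ℕ} {D D' : ℝ} (h : Dec p k N D) (hD : D ≤ D') : Dec p k N D' := by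
  intro A _ _ χ ν S f hf hR
  exact (h A χ ν S f hf hR).trans (mul_le_mul_of_nonneg_right hD
    (Finset.sum_nonneg fun _ _ => nq_nonneg _ _))

lemma Good.mono {k : ℕ} {η η' : ℝ} (h : Good p k η) (hη : η ≤ η') : Good p k η' := by
  obtain ⟨C, hC, hD⟩ := h
  refine ⟨C, hC, fun N => (hD N).mono (mul_le_mul_of_nonneg_left ?_ hC.le)⟩
  exact Real.rpow_le_rpow_of_exponent_le p1.le (by gcongr)

lemma sum_pow_le' {ι : Type*} (I : Finset ι) (u : ι → ℝ) (hu : ∀ i ∈ I, 0 ≤ u i) {q : ℕ}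
    (hq : 1 ≤ q) : ∑ i ∈ I, u i ^ q ≤ (∑ i ∈ I, u i) ^ q := by
  obtain ⟨q, rfl⟩ : ∃ q', q = q' + 1 := ⟨q - 1, by omega⟩
  rw [pow_succ, Finset.mul_sum]
  refine Finset.sum_le_sum fun i hi => ?_
  rw [pow_succ]
  exact mul_le_mul_of_nonneg_right (pow_le_pow_left₀ (hu i hi)
    (Finset.single_le_sum hu hi) _) (hu i hi)

lemma pow_sum_le' {ι : Type*} (I : Finset ι) (u : ι → ℝ) (hu : ∀ i ∈ I, 0 ≤ u i) {q : ℕ}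
    (hq : 1 ≤ q) : (∑ i ∈ I, u i) ^ q ≤ (I.card : ℝ) ^ q * ∑ i ∈ I, u i ^ q := by
  rcases I.eq_empty_or_nonempty with rfl | hne
  · simp [show q ≠ 0 by omega]
  obtain ⟨i0, h0, hm⟩ := Finset.exists_max_image I u hne
  calc _ ≤ ((I.card : ℝ) * u i0) ^ q := by
        refine pow_le_pow_left₀ (Finset.sum_nonneg hu) ?_ _
        rw [← nsmul_eq_mul]; exact Finset.sum_le_card_nsmul _ _ _ hm
    _ = (I.card : ℝ) ^ q * u i0 ^ q := mul_pow _ _ _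
    _ ≤ _ := by
        refine mul_le_mul_of_nonneg_left ?_ (by positivity)
        exact Finset.single_le_sum (f := fun i => u i ^ q) (fun i hi => pow_nonneg (hu i hi) _) h0

lemma broad {ι : Type*} [DecidableEq ι] (I : Finset ι) (u : ι → ℝ) (hu : ∀ i ∈ I, 0 ≤ u i) {P x : ℝ} (hP : 0 < P)
    (hx : 0 < x) (hc : (I.card : ℝ) ≤ P) {R r : ℕ} (hr : r < R) :
    (∑ i ∈ I, u i) ^ (2 * R) ≤ (1 + x) ^ (2 * R) * ∑ i ∈ I, u i ^ (2 * R) +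
      P ^ (2 * R) * (P / x) ^ (2 * (R - r)) *
        ∑ i ∈ I, ∑ j ∈ I.erase i, u i ^ (2 * r) * u j ^ (2 * (R - r)) := by
  have hS2 : 0 ≤ ∑ i ∈ I, ∑ j ∈ I.erase i, u i ^ (2 * r) * u j ^ (2 * (R - r)) :=
    Finset.sum_nonneg fun i hi => Finset.sum_nonneg fun j hj =>
      mul_nonneg (pow_nonneg (hu i hi) _) (pow_nonneg (hu j (mem_of_mem_erase hj)) _)
  have hS1 : 0 ≤ ∑ i ∈ I, u i ^ (2 * R) := Finset.sum_nonneg fun i hi => pow_nonneg (hu i hi) _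
  rcases I.eq_empty_or_nonempty with rfl | hne
  · simp [show R ≠ 0 by omega]
  obtain ⟨i0, h0, hm⟩ := Finset.exists_max_image I u hne
  have hu0 := hu i0 h0
  by_cases hA : ∀ j ∈ I.erase i0, u j ≤ u i0 * x / P
  · have h1 : ∑ i ∈ I, u i ≤ (1 + x) * u i0 := by
      rw [← Finset.add_sum_erase _ _ h0]
      have : ∑ j ∈ I.erase i0, u j ≤ ((I.erase i0).card : ℝ) * (u i0 * x / P) := by
        rw [← nsmul_eq_mul]; exact Finset.sum_le_card_nsmul _ _ _ hA
      have h2 : ((I.erase i0).card : ℝ) ≤ P :=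
        le_trans (by exact_mod_cast card_le_card (erase_subset _ _)) hc
      have h3 : ((I.erase i0).card : ℝ) * (u i0 * x / P) ≤ P * (u i0 * x / P) :=
        mul_le_mul_of_nonneg_right h2 (by positivity)
      have h4 : P * (u i0 * x / P) = x * u i0 := by field_simp
      linarith
    calc _ ≤ ((1 + x) * u i0) ^ (2 * R) := pow_le_pow_left₀ (Finset.sum_nonneg hu) h1 _
      _ = (1 + x) ^ (2 * R) * u i0 ^ (2 * R) := mul_pow _ _ _
      _ ≤ (1 + x) ^ (2 * R) * ∑ i ∈ I, u i ^ (2 * R) := by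
          refine mul_le_mul_of_nonneg_left ?_ (by positivity)
          exact Finset.single_le_sum (f := fun i => u i ^ (2 * R))
            (fun i hi => pow_nonneg (hu i hi) _) h0
      _ ≤ _ := le_add_of_nonneg_right (by positivity)
  · push Not at hA
    obtain ⟨j, hj, hlt⟩ := hA
    have hlt' : u i0 ≤ P / x * u j := by
      rw [div_lt_iff₀ hP] at hlt
      rw [div_mul_eq_mul_div, le_div_iff₀ hx]
      linarith
    have h1 : ∑ i ∈ I, u i ≤ P * u i0 := by
      calc _ ≤ (I.card : ℝ) * u i0 := by
            rw [← nsmul_eq_mul]; exact Finset.sum_le_card_nsmul _ _ _ hm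
        _ ≤ _ := mul_le_mul_of_nonneg_right hc hu0
    have e : 2 * R = 2 * r + 2 * (R - r) := by omega
    calc _ ≤ (P * u i0) ^ (2 * R) := pow_le_pow_left₀ (Finset.sum_nonneg hu) h1 _
      _ = P ^ (2 * R) * (u i0 ^ (2 * r) * u i0 ^ (2 * (R - r))) := by
          rw [mul_pow, ← pow_add, ← e]
      _ ≤ P ^ (2 * R) * (u i0 ^ (2 * r) * (P / x * u j) ^ (2 * (R - r))) := by gcongr
      _ = P ^ (2 * R) * (P / x) ^ (2 * (R - r)) * (u i0 ^ (2 * r) * u j ^ (2 * (R - r))) := by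
          rw [mul_pow]; ring
      _ ≤ P ^ (2 * R) * (P / x) ^ (2 * (R - r)) *
        ∑ i ∈ I, ∑ j ∈ I.erase i, u i ^ (2 * r) * u j ^ (2 * (R - r)) := by
          refine mul_le_mul_of_nonneg_left ?_ (by positivity)
          calc _ ≤ ∑ j ∈ I.erase i0, u i0 ^ (2 * r) * u j ^ (2 * (R - r)) :=
                Finset.single_le_sum (f := fun j => u i0 ^ (2 * r) * u j ^ (2 * (R - r)))
                  (fun j hj => mul_nonneg (pow_nonneg hu0 _)
                    (pow_nonneg (hu j (mem_of_mem_erase hj)) _)) hj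
            _ ≤ _ := Finset.single_le_sum
                  (f := fun i => ∑ j ∈ I.erase i, u i ^ (2 * r) * u j ^ (2 * (R - r)))
                  (fun i hi => Finset.sum_nonneg fun j hj => mul_nonneg (pow_nonneg (hu i hi) _)
                    (pow_nonneg (hu j (mem_of_mem_erase hj)) _)) h0
      _ ≤ _ := le_add_of_nonneg_left (by positivity)

lemma ee_le {A : Type} [Fintype A] (k : ℕ) {N a : ℕ} (ha : a ≤ N) (ν : ℤ → ℤ)
    (f : ℤ → A → ℂ) {T J : Finset ℤ} (hJ : J ∈ parts p a ν T) :
    ee p k N ν f J ≤ ee p k N ν f T := by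
  rw [ee_split k ha ν f T]
  exact Finset.single_le_sum (f := fun J => ee p k N ν f J) (fun _ _ => ee_nonneg _ _ _ _ _ _) hJ

lemma step1 {k l b N : ℕ} {D D' K x : ℝ} (hl : 1 ≤ l) (hlk : l < k) (hN : 1 ≤ N)
    (hD' : Dec p k (N - 1) D') (hD0 : 0 ≤ D') (hB : Bil p k l 1 b N K) (hbN : b ≤ N)
    (hK : 0 ≤ K) (hx : 0 < x) (hDp : 0 ≤ D)
    (hD : (1 + x) ^ (2 * RR k) * D' ^ RR k + (p : ℝ) ^ (2 * RR k) *
      ((p : ℝ) / x) ^ (2 * (RR k - RR l)) * ((p : ℝ) * (p * ((p : ℝ) ^ (b * (2 * RR k + 1)) * K)))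
        ≤ D ^ RR k) : Dec p k N D := by
  intro A _ _ χ ν S f hf hR
  have hRk := RR_pos (show 1 ≤ k by omega)
  have hlt : RR l < RR k := by
    have := two_RR l; have := two_RR k; nlinarith
  have hp0 : (0 : ℝ) < p := zero_lt_one.trans p1
  change nq (RR k) (FS f S) ≤ D * ee p k N ν f S
  set E := ee p k N ν f S with hE
  have hE0 : 0 ≤ E := ee_nonneg _ _ _ _ _ _
  refine nq_le hRk (by positivity) ?_
  have hc1 : ((parts p 1 ν S).card : ℝ) ≤ p := by
    have := card_parts (p := p) 1 ν S
    rw [pow_one] at this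
    exact_mod_cast this
  have hFS : ∀ x, FS f S x = ∑ T ∈ parts p 1 ν S, FS f T x := fun x => sum_parts _
  have hclass : ∀ {a : ℕ} {S0 T : Finset ℤ} (hT : T ∈ parts p a ν S0), ∃ n0 ∈ T, ∀ n ∈ T,
      (p : ℤ) ^ a ∣ ν n - ν n0 := by
    intro a S0 T hT
    obtain ⟨n0, hn0⟩ := parts_nonempty hT
    refine ⟨n0, hn0, fun n hn => ?_⟩
    rw [parts_eq hT hn0] at hn
    exact (mem_filter.1 hn).2
  have hdiag : ∑ T ∈ parts p 1 ν S, ∑ x, ‖FS f T x‖ ^ (2 * RR k) ≤ D' ^ RR k * E ^ RR k := by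
    calc _ ≤ ∑ T ∈ parts p 1 ν S, (D' * ee p k N ν f T) ^ RR k := by
          refine Finset.sum_le_sum fun T hT => ?_
          obtain ⟨n0, hn0, hcl⟩ := hclass hT
          have := R1 hD' le_rfl hN hf hR (parts_subset hT) (ν n0) hcl
          rw [← nq_pow hRk]
          exact pow_le_pow_left₀ (nq_nonneg _ _) this _
      _ = D' ^ RR k * ∑ T ∈ parts p 1 ν S, (ee p k N ν f T) ^ RR k := by
          simp_rw [mul_pow]; rw [Finset.mul_sum]
      _ ≤ D' ^ RR k * (∑ T ∈ parts p 1 ν S, ee p k N ν f T) ^ RR k :=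
          mul_le_mul_of_nonneg_left (sum_pow_le' _ _ (fun _ _ => ee_nonneg _ _ _ _ _ _) hRk)
            (by positivity)
      _ = _ := by rw [hE, ee_split k hN]
  have hoff : ∀ T ∈ parts p 1 ν S, ∀ T' ∈ (parts p 1 ν S).erase T,
      Mx (RR l) (RR k - RR l) (FS f T) (FS f T') ≤
        (p : ℝ) ^ (b * (2 * RR k + 1)) * K * E ^ RR k := by
    intro T hT T' hT'
    obtain ⟨hne, hT'⟩ := mem_erase.1 hT'
    obtain ⟨n0, hn0, hcl⟩ := hclass hT
    have hcb : ((parts p b ν T').card : ℝ) ≤ (p : ℝ) ^ b := by exact_mod_cast card_parts b ν T'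
    have hJ : ∀ J ∈ parts p b ν T', Mx (RR l) (RR k - RR l) (FS f T) (FS f J) ≤ K * E ^ RR k := by
      intro J hJ
      obtain ⟨n1, hn1, hcl1⟩ := hclass hJ
      have hn1' := parts_subset hJ hn1
      have hnd : ¬ (p : ℤ) ∣ ν n0 - ν n1 := by
        intro hd
        apply hne
        rw [parts_eq hT hn0, parts_eq hT' hn1']
        refine filter_congr fun m _ => ?_
        rw [pow_one]
        constructor
        · intro h
          have := dvd_sub h hd
          simpa using (by rwa [show ν m - ν n1 - (ν n0 - ν n1) = ν m - ν n0 by ring] at this : (p : ℤ) ∣ ν m - ν n0)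
        · intro h
          have := dvd_add h hd
          rwa [show ν m - ν n0 + (ν n0 - ν n1) = ν m - ν n1 by ring] at this
      have := hB A χ ν S f hf hR (ν n0) (ν n1) hnd T J (parts_subset hT)
        ((parts_subset hJ).trans (parts_subset hT')) hcl hcl1
      refine this.trans (mul_le_mul_of_nonneg_left ?_ hK)
      have e1 : ee p k N ν f T ≤ E := ee_le k hN ν f hT
      have e2 : ee p k N ν f J ≤ E := (ee_le k hbN ν f hJ).trans (ee_le k hN ν f hT')
      calc _ ≤ E ^ RR l * E ^ (RR k - RR l) :=
            mul_le_mul (pow_le_pow_left₀ (ee_nonneg _ _ _ _ _ _) e1 _)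
              (pow_le_pow_left₀ (ee_nonneg _ _ _ _ _ _) e2 _)
              (pow_nonneg (ee_nonneg _ _ _ _ _ _) _) (by positivity)
        _ = E ^ RR k := by rw [← pow_add]; congr 1; omega
    calc Mx (RR l) (RR k - RR l) (FS f T) (FS f T')
        ≤ ∑ x, ‖FS f T x‖ ^ (2 * RR l) * (((p : ℝ) ^ b) ^ (2 * RR k) *
            ∑ J ∈ parts p b ν T', ‖FS f J x‖ ^ (2 * (RR k - RR l))) := by
          refine Finset.sum_le_sum fun x _ => mul_le_mul_of_nonneg_left ?_ (by positivity)
          have h1 : ‖FS f T' x‖ ≤ ∑ J ∈ parts p b ν T', ‖FS f J x‖ := by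
            have : FS f T' x = ∑ J ∈ parts p b ν T', FS f J x := sum_parts _
            rw [this]; exact norm_sum_le _ _
          have h2 := pow_sum_le' (parts p b ν T') (fun J => ‖FS f J x‖) (fun _ _ => norm_nonneg _)
            (show 1 ≤ 2 * (RR k - RR l) by omega)
          refine (pow_le_pow_left₀ (norm_nonneg _) h1 _).trans (h2.trans ?_)
          refine mul_le_mul_of_nonneg_right ?_ (Finset.sum_nonneg fun _ _ => by positivity)
          calc _ ≤ ((p : ℝ) ^ b) ^ (2 * (RR k - RR l)) := pow_le_pow_left₀ (by positivity) hcb _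
            _ ≤ _ := pow_le_pow_right₀ (one_le_pow₀ p1.le) (by omega)
      _ = ((p : ℝ) ^ b) ^ (2 * RR k) * ∑ J ∈ parts p b ν T',
            Mx (RR l) (RR k - RR l) (FS f T) (FS f J) := by
          unfold Mx
          rw [Finset.sum_comm, Finset.mul_sum]
          refine Finset.sum_congr rfl fun x _ => ?_
          rw [Finset.mul_sum, Finset.mul_sum, Finset.mul_sum]
          exact Finset.sum_congr rfl fun J _ => by ring
      _ ≤ ((p : ℝ) ^ b) ^ (2 * RR k) * ((p : ℝ) ^ b * (K * E ^ RR k)) := by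
          refine mul_le_mul_of_nonneg_left ?_ (by positivity)
          calc _ ≤ ((parts p b ν T').card : ℝ) * (K * E ^ RR k) := by
                rw [← nsmul_eq_mul]; exact Finset.sum_le_card_nsmul _ _ _ hJ
            _ ≤ _ := mul_le_mul_of_nonneg_right hcb (by positivity)
      _ = _ := by rw [pow_mul (p : ℝ) b, pow_succ]; ring
  calc ∑ y, ‖FS f S y‖ ^ (2 * RR k)
      ≤ ∑ y, ((1 + x) ^ (2 * RR k) * ∑ T ∈ parts p 1 ν S, ‖FS f T y‖ ^ (2 * RR k) +
        (p : ℝ) ^ (2 * RR k) * ((p : ℝ) / x) ^ (2 * (RR k - RR l)) *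
        ∑ T ∈ parts p 1 ν S, ∑ T' ∈ (parts p 1 ν S).erase T,
          ‖FS f T y‖ ^ (2 * RR l) * ‖FS f T' y‖ ^ (2 * (RR k - RR l))) := by
        refine Finset.sum_le_sum fun y _ => ?_
        have h1 : ‖FS f S y‖ ≤ ∑ T ∈ parts p 1 ν S, ‖FS f T y‖ := by
          rw [hFS]; exact norm_sum_le _ _
        refine (pow_le_pow_left₀ (norm_nonneg _) h1 _).trans ?_
        exact broad (parts p 1 ν S) (fun T => ‖FS f T y‖) (fun _ _ => norm_nonneg _) hp0 hx hc1 hlt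
    _ = (1 + x) ^ (2 * RR k) * (∑ T ∈ parts p 1 ν S, ∑ y, ‖FS f T y‖ ^ (2 * RR k)) +
        (p : ℝ) ^ (2 * RR k) * ((p : ℝ) / x) ^ (2 * (RR k - RR l)) *
        ∑ T ∈ parts p 1 ν S, ∑ T' ∈ (parts p 1 ν S).erase T,
          Mx (RR l) (RR k - RR l) (FS f T) (FS f T') := by
        rw [Finset.sum_add_distrib, ← Finset.mul_sum, ← Finset.mul_sum, Finset.sum_comm]
        congr 2
        rw [Finset.sum_comm]
        refine Finset.sum_congr rfl fun T _ => ?_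
        rw [Finset.sum_comm]; rfl
    _ ≤ (1 + x) ^ (2 * RR k) * (D' ^ RR k * E ^ RR k) +
        (p : ℝ) ^ (2 * RR k) * ((p : ℝ) / x) ^ (2 * (RR k - RR l)) *
        ((p : ℝ) * (p * ((p : ℝ) ^ (b * (2 * RR k + 1)) * K * E ^ RR k))) := by
        refine add_le_add (mul_le_mul_of_nonneg_left hdiag (by positivity))
          (mul_le_mul_of_nonneg_left ?_ (by positivity))
        have hin : ∀ T ∈ parts p 1 ν S, ∑ T' ∈ (parts p 1 ν S).erase T,
          Mx (RR l) (RR k - RR l) (FS f T) (FS f T') ≤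
            p * ((p : ℝ) ^ (b * (2 * RR k + 1)) * K * E ^ RR k) := by
          intro T hT
          calc _ ≤ (((parts p 1 ν S).erase T).card : ℝ) *
                ((p : ℝ) ^ (b * (2 * RR k + 1)) * K * E ^ RR k) := by
                rw [← nsmul_eq_mul]; exact Finset.sum_le_card_nsmul _ _ _ (hoff T hT)
            _ ≤ _ := by
                refine mul_le_mul_of_nonneg_right (le_trans ?_ hc1) (by positivity)
                exact_mod_cast card_le_card (erase_subset _ _)
        calc _ ≤ ((parts p 1 ν S).card : ℝ) * (p * ((p : ℝ) ^ (b * (2 * RR k + 1)) * K * E ^ RR k)) := by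
              rw [← nsmul_eq_mul]; exact Finset.sum_le_card_nsmul _ _ _ hin
          _ ≤ _ := mul_le_mul_of_nonneg_right hc1 (by positivity)
    _ = ((1 + x) ^ (2 * RR k) * D' ^ RR k + (p : ℝ) ^ (2 * RR k) *
      ((p : ℝ) / x) ^ (2 * (RR k - RR l)) * ((p : ℝ) * (p * ((p : ℝ) ^ (b * (2 * RR k + 1)) * K))))
        * E ^ RR k := by ring
    _ ≤ D ^ RR k * E ^ RR k := mul_le_mul_of_nonneg_right hD (by positivity)
    _ = _ := (mul_pow _ _ _).symm

end final
end VMV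

namespace VMV
open Polynomial

section gain
variable {p : ℕ} [hp : Fact p.Prime]

set_option maxHeartbeats 1000000 in
lemma gain {k : ℕ} (hk : 2 ≤ k) (hkp : k < p)
    (hIH : ∀ l, 1 ≤ l → l < k → ∀ ε > (0 : ℝ), Good p l ε) {η0 : ℝ} (hη0 : 0 < η0) :
    ∃ κ > (0 : ℝ), ∀ η, η0 ≤ η → Good p k η → Good p k (η - κ) := by
  have hRk := RR_pos (show 1 ≤ k by omega)
  set R := RR k with hRdef
  have hR0 : (0 : ℝ) < (R : ℝ) := by exact_mod_cast hRk
  have hp1 : (1 : ℝ) < p := p1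
  have hp0 : (0 : ℝ) < p := zero_lt_one.trans hp1
  have hk0 : (0 : ℝ) < k := by exact_mod_cast (show 0 < k by omega)
  have hk1 : (0 : ℝ) < ((k - 1 : ℕ) : ℝ) := by exact_mod_cast (show 0 < k - 1 by omega)
  have hu : 0 < ((k - 1 : ℕ) : ℝ) / k * (η0 * R) := by positivity
  obtain ⟨n, hn⟩ := exists_nat_ge ((((k - 1 : ℕ) : ℝ) * (2 * R + 2)) / (((k - 1 : ℕ) : ℝ) / k * (η0 * R)))
  rw [div_le_iff₀ hu] at hn
  obtain ⟨s, -, -, hs, hB⟩ := iter hk hkp hIH hη0 n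
  obtain ⟨i, hi, hsi⟩ : ∃ i ∈ range (k - 1), (2 * R + 2 : ℝ) ≤ s (i + 1) := by
    by_contra hcon
    push Not at hcon
    have : ∑ i ∈ range (k - 1), s (i + 1) < ∑ i ∈ range (k - 1), (2 * R + 2 : ℝ) :=
      Finset.sum_lt_sum_of_nonempty ⟨0, mem_range.2 (by omega)⟩ hcon
    rw [Finset.sum_const, card_range, nsmul_eq_mul] at this
    linarith
  rw [mem_range] at hi
  set Q := k ^ (n + 1) with hQ
  have hQ1 : 1 ≤ Q := Nat.one_le_pow _ _ (by omega)
  have hQ0 : (0 : ℝ) < Q := by exact_mod_cast hQ1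
  set κ0 : ℝ := min (1 / (2 * Q)) (η0 * R / 2) with hκ0
  have hκ0p : 0 < κ0 := lt_min (by positivity) (by positivity)
  have hκ1 : κ0 ≤ 1 / (2 * Q) := min_le_left _ _
  have hκ2 : κ0 ≤ η0 * R / 2 := min_le_right _ _
  refine ⟨κ0 / R, by positivity, fun η hη hG => ?_⟩
  obtain ⟨C, hC, hB⟩ := hB η hη hG (i + 1) (by omega) (1 / (2 * Q)) (by positivity)
  set θ : ℝ := η * R - κ0 with hθ
  have hθ0 : 0 < θ := by
    have : η0 * R ≤ η * R := by gcongr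
    have : 0 < η0 * R := by positivity
    linarith
  have hθR : η - κ0 / R = θ / R := by rw [hθ]; field_simp
  rw [hθR]
  set x : ℝ := (p : ℝ) ^ (θ / (4 * R)) - 1 with hx
  have hx0 : 0 < x := by
    have : (1 : ℝ) < (p : ℝ) ^ (θ / (4 * R)) := Real.one_lt_rpow hp1 (by positivity)
    linarith
  have hΛ : (1 + x) ^ (2 * R) = (p : ℝ) ^ (θ / 2) := by
    rw [hx, add_sub_cancel, ← Real.rpow_natCast, ← Real.rpow_mul hp0.le]
    congr 1; push_cast; field_simp; norm_num
  set ρ : ℝ := (p : ℝ) ^ (-(θ / 2)) with hρ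
  have hρ1 : ρ < 1 := Real.rpow_lt_one_of_one_lt_of_neg hp1 (by linarith)
  set G : ℝ := (p : ℝ) ^ (2 * R) * ((p : ℝ) / x) ^ (2 * (R - RR (i + 1))) * ((p : ℝ) * (p * (C * p)))
    with hGdef
  have hG0 : 0 < G := by positivity
  set C2 : ℝ := max (max ((p : ℝ) ^ (Q * Q)) (G / (1 - ρ))) 1 with hC2
  have hC21 : 1 ≤ C2 := le_max_right _ _
  have hC2p : 0 < C2 := by linarith
  have hC2a : (p : ℝ) ^ (Q * Q) ≤ C2 := (le_max_left _ _).trans (le_max_left _ _)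
  have hC2b : G ≤ (1 - ρ) * C2 := by
    have : G / (1 - ρ) ≤ C2 := (le_max_right _ _).trans (le_max_left _ _)
    rw [div_le_iff₀ (by linarith)] at this
    linarith
  have hC2R : C2 ≤ C2 ^ R := le_self_pow₀ hC21 (by omega)
  refine ⟨C2, hC2p, fun N => ?_⟩
  have hpow : ∀ y : ℝ, (C2 * (p : ℝ) ^ (θ / R * y)) ^ R = C2 ^ R * (p : ℝ) ^ (θ * y) := by
    intro y
    rw [mul_pow, ← Real.rpow_natCast (_ ^ (_ : ℝ)), ← Real.rpow_mul hp0.le]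
    congr 2; field_simp
  induction N using Nat.strong_induction_on with
  | _ N ih =>
  rcases lt_or_ge N (Q * Q) with hNQ | hNQ
  · refine (Dec_triv (show 1 ≤ k by omega) N).mono ?_
    calc (p : ℝ) ^ N ≤ (p : ℝ) ^ (Q * Q) := pow_le_pow_right₀ hp1.le hNQ.le
      _ ≤ C2 := hC2a
      _ ≤ _ := le_mul_of_one_le_right hC2p.le (Real.one_le_rpow hp1.le (by positivity))
  · have hN1 : 1 ≤ N := by nlinarith
    have hb1 : Q ≤ N / Q := (Nat.le_div_iff_mul_le (by omega)).2 hNQ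
    have hb2 : Q * (N / Q) ≤ N := Nat.mul_div_le _ _
    have hb3 : N / Q ≤ N := Nat.div_le_self _ _
    have hb4 : (N : ℝ) / Q - 1 ≤ ((N / Q : ℕ) : ℝ) := by
      have := Nat.lt_div_mul_add (a := N) (b := Q) (by omega)
      have h2 : (N : ℝ) < ((N / Q : ℕ) : ℝ) * Q + Q := by exact_mod_cast this
      rw [sub_le_iff_le_add, div_le_iff₀ hQ0]; nlinarith
    have hBil := hB N 1 (N / Q) le_rfl hb1 (by
      rw [mul_one]
      have : i + 1 ≤ N / Q ∨ N / Q < i + 1 := le_or_gt _ _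
      have hkQ : k ≤ Q := by rw [hQ]; exact Nat.le_self_pow (by omega) _
      have : 1 * (N / Q) ≤ (k - (i + 1) + 1) * (N / Q) := Nat.mul_le_mul_right _ (by omega)
      omega) hb2
    set b := N / Q with hb
    refine step1 (l := i + 1) (b := b) (x := x) (by omega) (by omega) hN1
      (ih (N - 1) (by omega)) (by positivity) hBil hb3 (by positivity) hx0 (by positivity) ?_
    rw [← hRdef, hpow, hpow, hΛ]
    have hKb : (p : ℝ) ^ (b * (2 * R + 1)) * (C * (p : ℝ) ^ (η * R * N + 1 / (2 * Q) * N - s (i + 1) * b))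
        ≤ C * p * (p : ℝ) ^ (θ * N) := by
      have h1 : (p : ℝ) ^ (b * (2 * R + 1)) * (C * (p : ℝ) ^ (η * R * N + 1 / (2 * Q) * N - s (i + 1) * b))
        = C * (p : ℝ) ^ ((b * (2 * R + 1) : ℝ) + (η * R * N + 1 / (2 * Q) * N - s (i + 1) * b)) := by
        rw [Real.rpow_add hp0]
        rw [show ((b : ℝ) * (2 * R + 1)) = ((b * (2 * R + 1) : ℕ) : ℝ) by push_cast; ring,
          Real.rpow_natCast]
        ring
      have h2 : C * p * (p : ℝ) ^ (θ * N) = C * (p : ℝ) ^ (θ * N + 1) := by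
        rw [Real.rpow_add hp0, Real.rpow_one]; ring
      rw [h1, h2]
      refine mul_le_mul_of_nonneg_left (Real.rpow_le_rpow_of_exponent_le hp1.le ?_) hC.le
      have hbs : (2 * R + 2 : ℝ) * b ≤ s (i + 1) * b := by gcongr
      have h3 : κ0 * N ≤ 1 / (2 * Q) * N := by gcongr
      have h4 : (N : ℝ) / Q = 1 / (2 * Q) * N + 1 / (2 * Q) * N := by field_simp; norm_num
      rw [hθ]
      linarith
    have h5 : (p : ℝ) ^ (θ / 2) * (C2 ^ R * (p : ℝ) ^ (θ * ((N - 1 : ℕ) : ℝ))) =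
        ρ * (C2 ^ R * (p : ℝ) ^ (θ * N)) := by
      have : (p : ℝ) ^ (θ / 2) * (p : ℝ) ^ (θ * ((N - 1 : ℕ) : ℝ)) = ρ * (p : ℝ) ^ (θ * N) := by
        rw [hρ, ← Real.rpow_add hp0, ← Real.rpow_add hp0]
        congr 1
        rw [Nat.cast_sub hN1]; push_cast; ring
      rw [mul_left_comm, this]; ring
    rw [h5]
    have h6 : (p : ℝ) ^ (2 * R) * ((p : ℝ) / x) ^ (2 * (R - RR (i + 1))) * ((p : ℝ) * (p *
      ((p : ℝ) ^ (b * (2 * R + 1)) * (C * (p : ℝ) ^ (η * R * N + 1 / (2 * Q) * N - s (i + 1) * b)))))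
        ≤ G * (p : ℝ) ^ (θ * N) := by
      calc _ ≤ (p : ℝ) ^ (2 * R) * ((p : ℝ) / x) ^ (2 * (R - RR (i + 1))) * ((p : ℝ) * (p *
            (C * p * (p : ℝ) ^ (θ * N)))) := by gcongr
        _ = _ := by rw [hGdef]; ring
    have h7 : G * (p : ℝ) ^ (θ * N) ≤ (1 - ρ) * C2 ^ R * (p : ℝ) ^ (θ * N) := by
      refine mul_le_mul_of_nonneg_right (hC2b.trans ?_) (by positivity)
      exact mul_le_mul_of_nonneg_left hC2R (by linarith)
    linarith

lemma descend {k : ℕ} (hk : 2 ≤ k) (hkp : k < p)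
    (hIH : ∀ l, 1 ≤ l → l < k → ∀ ε > (0 : ℝ), Good p l ε) {η0 : ℝ} (hη0 : 0 < η0) :
    Good p k η0 := by
  obtain ⟨κ, hκ, hg⟩ := gain hk hkp hIH hη0
  have h1 : Good p k 1 := ⟨1, one_pos, fun N => by
    have := Dec_triv (p := p) (show 1 ≤ k by omega) N
    rwa [one_mul, one_mul, Real.rpow_natCast]⟩
  have h : ∀ n : ℕ, Good p k (max η0 (1 - n * κ)) := by
    intro n
    induction n with
    | zero => exact h1.mono (by simp)
    | succ n ih =>
      refine (hg _ (le_max_left _ _) ih).mono ?_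
      push_cast
      rcases le_total η0 (1 - n * κ) with h | h
      · rw [max_eq_right h]; exact le_trans (by linarith) (le_max_right _ _)
      · rw [max_eq_left h]; exact le_trans (by linarith) (le_max_left _ _)
  obtain ⟨n, hn⟩ := exists_nat_ge (1 / κ)
  rw [div_le_iff₀ hκ] at hn
  exact (h n).mono (max_le le_rfl (by linarith))

theorem main_dec {k : ℕ} (hk : 1 ≤ k) (hkp : k < p) {ε : ℝ} (hε : 0 < ε) : Good p k ε := by
  induction k using Nat.strong_induction_on generalizing ε with
  | _ k ih =>
  rcases hk.eq_or_lt with rfl | h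
  · refine ⟨1, one_pos, fun N => (Dec_one N).mono ?_⟩
    rw [one_mul]
    exact Real.one_le_rpow p1.le (by positivity)
  · exact descend h hkp (fun l h1 h2 ε hε => ih l h2 h1 (by omega) hε) hε

end gain
end VMV

namespace VMV
open Polynomial

section app
variable {p : ℕ} [hp : Fact p.Prime]

noncomputable def W0 (p : ℕ) [Fact p.Prime] (K s : ℕ) : Submodule ℤ_[p] ℤ_[p][X] :=
  degreeLT ℤ_[p] s ⊔ Submodule.span ℤ_[p] {X ^ K}

noncomputable def ch (Q s K : ℕ) [NeZero Q] (n : ℤ) : AddChar ((Fin s → ZMod Q) × ZMod Q) ℂ where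
  toFun h := ZMod.stdAddChar (N := Q) (∑ i : Fin s, (n : ZMod Q) ^ (i.1 + 1) * h.1 i + (n : ZMod Q) ^ K * h.2)
  map_zero_eq_one' := by simp
  map_add_eq_mul' := by
    intro a b
    rw [← AddChar.map_add_eq_mul]
    congr 1
    simp only [Prod.fst_add, Prod.snd_add, Pi.add_apply, mul_add, Finset.sum_add_distrib]
    ring

lemma ch_apply (Q s K : ℕ) [NeZero Q] (n : ℤ) (h) : ch Q s K n h =
  ZMod.stdAddChar (N := Q) (∑ i : Fin s, (n : ZMod Q) ^ (i.1 + 1) * h.1 i + (n : ZMod Q) ^ K * h.2) := rfl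

lemma W0_ph (K s L : ℕ) (S : Finset ℤ) : HasPh p (W0 p K (s + 1)) L S id (ch (p ^ L) s K) := by
  intro w hw
  obtain ⟨u, hu, v, hv, rfl⟩ := Submodule.mem_sup.1 hw
  obtain ⟨b, rfl⟩ := Submodule.mem_span_singleton.1 hv
  rw [mem_degreeLT] at hu
  refine ⟨(fun i => PadicInt.toZModPow L (u.coeff (i.1 + 1)), PadicInt.toZModPow L b),
    ps p L (-u.coeff 0), fun n _ => ?_⟩
  rw [← AddChar.map_add_eq_mul, ps_apply, ch_apply]
  congr 1
  have h1 : u.natDegree < s + 1 := by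
    by_cases h0 : u = 0
    · simp [h0]
    · exact (natDegree_lt_iff_degree_lt h0).2 hu
  rw [eval_add, eval_eq_sum_range' h1, Finset.sum_range_succ', Finset.sum_range, eval_smul]
  simp only [map_add, map_neg, map_sum, map_mul, map_pow, eval_pow, eval_X, smul_eq_mul, id,
    map_intCast, pow_zero, mul_one]
  rw [add_assoc, add_left_comm, neg_add_cancel_left]
  congr 1
  · exact Finset.sum_congr rfl fun i _ => mul_comm _ _
  · exact mul_comm _ _

lemma unit_int {z : ℤ} (h : ¬ (p : ℤ) ∣ z) : IsUnit (z : ℤ_[p]) := by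
  by_contra hc
  rw [PadicInt.not_isUnit_iff, PadicInt.norm_int_lt_one_iff_dvd] at hc
  exact h hc

lemma W0_nd {K s : ℕ} (hs : s ≤ K) (hKp : K < p) {ξ : ℤ} (hξ : ¬ (p : ℤ) ∣ ξ) :
    NDat p s (W0 p K s) ξ := by
  have hlow : ∀ j < s, (X - C (ξ : ℤ_[p])) ^ j ∈ W0 p K s := by
    intro j hj
    refine Submodule.mem_sup_left (mem_degreeLT.2 ?_)
    rw [degree_pow, degree_X_sub_C]
    simpa using hj
  intro j hj hjs
  rcases hjs.lt_or_eq with h | rfl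
  · exact ⟨_, hlow j h, 0, 0, by simp⟩
  · set q : ℤ_[p][X] := (X + C (ξ : ℤ_[p])) ^ K with hq
    have hc : q.coeff j = (ξ : ℤ_[p]) ^ (K - j) * (K.choose j : ℤ_[p]) := coeff_X_add_C_pow _ _ _
    have hun : IsUnit (q.coeff j) := by
      rw [hc]
      have h1 : IsUnit (ξ : ℤ_[p]) := unit_int hξ
      have h2 : IsUnit (K.choose j : ℤ_[p]) := by
        have := unit_int (p := p) (z := (K.choose j : ℤ)) (fun h => by
          have h3 : p ∣ K.choose j := by exact_mod_cast h
          have h4 : p ∣ K.factorial := by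
            rw [← Nat.choose_mul_factorial_mul_factorial hs, mul_assoc]
            exact h3.mul_right _
          have := (hp.out.dvd_factorial).1 h4
          omega)
        exact_mod_cast this
      exact (h1.pow _).mul h2
    obtain ⟨u, hu⟩ := hun
    obtain ⟨r, hr⟩ : X ^ (j + 1) ∣ q - ∑ i ∈ range (j + 1), C (q.coeff i) * X ^ i := by
      rw [X_pow_dvd_iff]
      intro d hd
      rw [coeff_sub, finsetSum_coeff]
      simp only [coeff_C_mul, coeff_X_pow]
      rw [Finset.sum_eq_single d]
      · simp
      · intro b _ hb; rw [if_neg (Ne.symm hb), mul_zero]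
      · intro h; exact absurd (mem_range.2 hd) h
    rw [Finset.sum_range_succ] at hr
    refine ⟨C (↑u⁻¹ : ℤ_[p]) * (X ^ K - ∑ i ∈ range j, C (q.coeff i) * (X - C (ξ : ℤ_[p])) ^ i), ?_,
      C (↑u⁻¹ : ℤ_[p]) * r, 0, ?_⟩
    · rw [← smul_eq_C_mul]
      refine Submodule.smul_mem _ _ (Submodule.sub_mem _
        (Submodule.mem_sup_right (Submodule.mem_span_singleton_self _)) (Submodule.sum_mem _ fun i hi => ?_))
      rw [← smul_eq_C_mul]
      exact Submodule.smul_mem _ _ (hlow i (mem_range.1 hi))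
    · rw [mul_comp, C_comp, sub_comp, X_pow_comp, Polynomial.sum_comp]
      simp only [mul_comp, C_comp, pow_comp, sub_comp, X_comp, add_sub_cancel_right]
      have hui : C (↑u⁻¹ : ℤ_[p]) * C (q.coeff j) = 1 := by
        rw [← hu, ← C_mul, Units.inv_mul, C_1]
      rw [C_0]
      linear_combination C (↑u⁻¹ : ℤ_[p]) * hr + X ^ j * hui

end app
end VMV

namespace VMV
open Polynomial

section app2
variable {p : ℕ} [hp : Fact p.Prime]

lemma fullmv {K s : ℕ} (hs : s + 1 ≤ K) (hKp : K < p) {η : ℝ} (hη : 0 < η) :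
    ∃ C > (0 : ℝ), ∀ P : ℕ, 1 ≤ P → ∀ L, L = (s + 1) * (Nat.log p P + 1) → ∀ S ⊆ Icc (1 : ℤ) P,
      (∀ n ∈ S, ¬ (p : ℤ) ∣ n) → ∀ c : ℤ → ℂ, (∀ n, ‖c n‖ ≤ 1) →
      ∑ h, ‖∑ n ∈ S, c n * ch (p ^ L) s K n h‖ ^ (2 * RR (s + 1)) ≤
        C * (P : ℝ) ^ (RR (s + 1) * (1 + η)) * Fintype.card ((Fin s → ZMod (p ^ L)) × ZMod (p ^ L)) := by
  obtain ⟨C0, hC0, hD⟩ := main_dec (p := p) (show 1 ≤ s + 1 by omega) (by omega) hη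
  have hR := RR_pos (show 1 ≤ s + 1 by omega)
  set R := RR (s + 1) with hRd
  have hp1 : (1 : ℝ) < p := p1
  have hp0 : (0 : ℝ) < p := zero_lt_one.trans hp1
  refine ⟨(p * (p * C0)) ^ R, by positivity, ?_⟩
  rintro P hP L hL S hS hcop c hc
  set N := Nat.log p P with hN
  set A := (Fin s → ZMod (p ^ L)) × ZMod (p ^ L) with hA
  set χ := ch (p ^ L) s K with hχ
  set f : ℤ → A → ℂ := fun n h => c n * χ n h with hf
  have hP0 : (0 : ℝ) < P := by exact_mod_cast hP
  have hcardA : (0 : ℝ) < (Fintype.card A : ℝ) := by exact_mod_cast Fintype.card_pos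
  set M : ℝ := (Fintype.card A : ℝ) ^ ((1 : ℝ) / R) with hM
  have hM0 : 0 < M := by positivity
  have hMR : M ^ R = Fintype.card A := by
    rw [hM, ← Real.rpow_natCast, ← Real.rpow_mul hcardA.le, one_div,
      inv_mul_cancel₀ (by exact_mod_cast (by omega : R ≠ 0)), Real.rpow_one]
  have hpN : (p : ℝ) ^ N ≤ P := by
    exact_mod_cast Nat.pow_log_le_self p (by omega : P ≠ 0)
  have hpN' : P < p ^ (N + 1) := Nat.lt_pow_succ_log_self hp.out.one_lt P
  have hsingle : ∀ n, nq R (fun x => f n x) ≤ M := by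
    intro n
    refine nq_le hR hM0.le ?_
    rw [hMR]
    calc _ ≤ ∑ x : A, (1 : ℝ) := by
          refine Finset.sum_le_sum fun x _ => pow_le_one₀ (norm_nonneg _) ?_
          rw [norm_mul, AddChar.norm_apply, mul_one]; exact hc n
      _ = _ := by simp
  have hcl : ∀ T ∈ parts p 1 id S, nq R (fun x => ∑ n ∈ T, f n x) ≤ C0 * (P : ℝ) ^ η * (P * M) := by
    intro T hT
    obtain ⟨n0, hn0⟩ := parts_nonempty hT
    have hTS := parts_subset hT
    have hdv : ∀ n ∈ T, (p : ℤ) ∣ n - n0 := by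
      intro n hn
      rw [parts_eq hT hn0] at hn
      simpa using (mem_filter.1 hn).2
    have hν : ∀ n ∈ T, id n = n0 + (p : ℤ) ^ 1 * ((n - n0) / p) := by
      intro n hn
      rw [pow_one, Int.mul_ediv_cancel' (hdv n hn)]; simp
    have hrich : Rich p (s + 1) N T (fun n => (n - n0) / p) χ := by
      refine rescale (W0_ph K s L T) n0 le_rfl (by rw [hL]) hν fun t => W0_nd hs hKp ?_
      intro hd
      rw [pow_one] at hd
      exact hcop n0 (hTS hn0) ((Int.dvd_add_left (dvd_mul_right _ _)).1 hd)
    have h1 := hD N A χ _ T f (fun n _ x h => by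
      simp only [hf, AddChar.map_add_eq_mul]; ring) hrich
    rw [parts_rescale hν] at h1
    refine h1.trans ?_
    have h2 : (p : ℝ) ^ (η * N) ≤ (P : ℝ) ^ η := by
      rw [mul_comm, Real.rpow_mul hp0.le, Real.rpow_natCast]
      exact Real.rpow_le_rpow (by positivity) hpN hη.le
    have h3 : ∑ T' ∈ parts p (N + 1) id T, nq R (fun x => ∑ n ∈ T', f n x) ≤ P * M := by
      calc _ ≤ ((parts p (N + 1) id T).card : ℝ) * M := by
            rw [← nsmul_eq_mul]
            refine Finset.sum_le_card_nsmul _ _ _ fun T' hT' => ?_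
            obtain ⟨n1, hn1⟩ := parts_nonempty hT'
            have : T' = {n1} := by
              refine eq_singleton_iff_unique_mem.2 ⟨hn1, fun m hm => ?_⟩
              have hm' := hm
              rw [parts_eq hT' hn1] at hm
              have hd := (mem_filter.1 hm).2
              have r1 := mem_Icc.1 (hS (hTS (parts_subset hT' hm')))
              have r2 := mem_Icc.1 (hS (hTS (parts_subset hT' hn1)))
              have r3 : (P : ℤ) < (p : ℤ) ^ (N + 1) := by exact_mod_cast hpN'
              have := Int.eq_zero_of_abs_lt_dvd hd (by
                rw [abs_lt]; simp only [id]; constructor <;> linarith)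
              simp only [id] at this; omega
            rw [this]; simpa using hsingle n1
        _ ≤ _ := by
            refine mul_le_mul_of_nonneg_right ?_ hM0.le
            have a1 : (parts p (N + 1) id T).card ≤ T.card := card_image_le
            have a2 : T.card ≤ (Icc (1 : ℤ) P).card := card_le_card (hTS.trans hS)
            rw [Int.card_Icc] at a2
            exact_mod_cast (show (parts p (N + 1) id T).card ≤ P by omega)
    calc _ ≤ C0 * (p : ℝ) ^ (η * N) * (P * M) := mul_le_mul_of_nonneg_left h3 (by positivity)
      _ ≤ _ := by gcongr
  have hpar : ((parts p 1 id S).card : ℝ) ≤ p := by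
    have := card_parts (p := p) 1 id S
    rw [pow_one] at this
    exact_mod_cast this
  have htot : nq R (fun x => ∑ n ∈ S, f n x) ≤ p * (p * (C0 * (P : ℝ) ^ η * (P * M))) := by
    have e : (fun x => ∑ n ∈ S, f n x) = fun x => ∑ T ∈ parts p 1 id S, ∑ n ∈ T, f n x :=
      funext fun x => sum_parts _
    rw [e]
    refine (nq_triv hR _ _).trans ?_
    refine mul_le_mul hpar ?_ (Finset.sum_nonneg fun _ _ => nq_nonneg _ _) hp0.le
    calc _ ≤ ((parts p 1 id S).card : ℝ) * (C0 * (P : ℝ) ^ η * (P * M)) := by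
          rw [← nsmul_eq_mul]; exact Finset.sum_le_card_nsmul _ _ _ hcl
      _ ≤ _ := mul_le_mul_of_nonneg_right hpar (by positivity)
  calc _ = nq R (fun x => ∑ n ∈ S, f n x) ^ R := (nq_pow hR _).symm
    _ ≤ (p * (p * (C0 * (P : ℝ) ^ η * (P * M)))) ^ R := pow_le_pow_left₀ (nq_nonneg _ _) htot _
    _ = (p * (p * C0)) ^ R * (((P : ℝ) ^ η * P) ^ R) * M ^ R := by
        rw [← mul_pow, ← mul_pow]; ring_nf
    _ = _ := by
        rw [hMR, mul_assoc, mul_assoc]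
        congr 2
        nth_rewrite 2 [← Real.rpow_one (P : ℝ)]
        rw [← Real.rpow_add hP0, ← Real.rpow_natCast, ← Real.rpow_mul hP0.le]
        congr 1; ring

open ComplexConjugate in
lemma keys {B ι : Type} [AddCommGroup B] [Fintype B] (I : Finset ι) (b : ι → ℂ)
    (g : ι → AddChar B ℂ) : (Fintype.card B : ℝ) * ‖∑ i ∈ I, b i‖ ^ 2 ≤
      ((I.image g).card : ℝ) * ∑ h, ‖∑ i ∈ I, b i * g i h‖ ^ 2 := by
  set G : AddChar B ℂ → ℂ := fun γ => ∑ i ∈ I with g i = γ, b i with hG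
  have h1 : ∑ i ∈ I, b i = ∑ γ ∈ I.image g, G γ :=
    (Finset.sum_fiberwise_of_maps_to (fun i hi => mem_image_of_mem g hi) _).symm
  have h2 : ∀ h, ∑ i ∈ I, b i * g i h = ∑ γ ∈ I.image g, G γ * γ h := by
    intro h
    rw [← Finset.sum_fiberwise_of_maps_to (fun i hi => mem_image_of_mem g hi)]
    refine Finset.sum_congr rfl fun γ _ => ?_
    rw [hG, Finset.sum_mul]
    exact Finset.sum_congr rfl fun i hi => by rw [(mem_filter.1 hi).2]
  have h3 : ∑ h, ‖∑ i ∈ I, b i * g i h‖ ^ 2 = ∑ γ ∈ I.image g, (Fintype.card B : ℝ) * ‖G γ‖ ^ 2 := by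
    simp_rw [h2]
    rw [pyth (I.image g) (fun γ h => G γ * γ h)]
    · refine Finset.sum_congr rfl fun γ _ => ?_
      simp [AddChar.norm_apply]
    · intro γ _ γ' _ hne
      exact orth hne (fun x h => by rw [AddChar.map_add_eq_mul]; ring)
        (fun x h => by rw [AddChar.map_add_eq_mul]; ring)
  rw [h3, h1, ← Finset.mul_sum]
  have h4 : ‖∑ γ ∈ I.image g, G γ‖ ^ 2 ≤ ((I.image g).card : ℝ) * ∑ γ ∈ I.image g, ‖G γ‖ ^ 2 := by
    calc _ ≤ (∑ γ ∈ I.image g, ‖G γ‖) ^ 2 := pow_le_pow_left₀ (norm_nonneg _) (norm_sum_le _ _) _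
      _ ≤ _ := sq_sum_le_card_mul_sum_sq
  calc _ ≤ (Fintype.card B : ℝ) * (((I.image g).card : ℝ) * ∑ γ ∈ I.image g, ‖G γ‖ ^ 2) := by gcongr
    _ = _ := by ring

def MV (p K q t : ℕ) : Prop := ∀ ε > (0 : ℝ), ∃ C > (0 : ℝ), ∀ P : ℕ, 1 ≤ P → ∃ Q : ℕ, ∃ _ : NeZero Q,
  ∀ S ⊆ Icc (1 : ℤ) P, (∀ n ∈ S, ¬ (p : ℤ) ∣ n) → ∀ c : ℤ → ℂ, (∀ n, ‖c n‖ ≤ 1) →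
    ∑ a : ZMod Q, ‖∑ n ∈ S, c n * ZMod.stdAddChar ((n : ZMod Q) ^ K * a)‖ ^ q ≤
      C * Q * (P : ℝ) ^ ((q : ℝ) - t + ε)

/-- characters of the lower-degree variables -/
noncomputable def lc (Q s : ℕ) [NeZero Q] (v : Fin s → ℤ) : AddChar (Fin s → ZMod Q) ℂ where
  toFun h := ZMod.stdAddChar (N := Q) (∑ i : Fin s, (v i : ZMod Q) * h i)
  map_zero_eq_one' := by simp
  map_add_eq_mul' := by
    intro a b
    rw [← AddChar.map_add_eq_mul]
    congr 1
    simp only [Pi.add_apply, mul_add, Finset.sum_add_distrib]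

lemma lc_apply (Q s : ℕ) [NeZero Q] (v : Fin s → ℤ) (h) : lc Q s v h =
    ZMod.stdAddChar (N := Q) (∑ i : Fin s, (v i : ZMod Q) * h i) := rfl

lemma prod_std {ι : Type*} (I : Finset ι) (Q : ℕ) [NeZero Q] (u : ι → ZMod Q) :
    ∏ i ∈ I, ZMod.stdAddChar (N := Q) (u i) = ZMod.stdAddChar (N := Q) (∑ i ∈ I, u i) := by
  induction I using Finset.induction_on with
  | empty => simp
  | insert a s ha ih => rw [Finset.prod_insert ha, Finset.sum_insert ha, AddChar.map_add_eq_mul, ih]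

lemma drop_low (Q s K R P : ℕ) [NeZero Q] (hR : 1 ≤ R) (hP : 1 ≤ P) (S : Finset ℤ)
    (hS : S ⊆ Icc (1 : ℤ) P) (c : ℤ → ℂ) (a : ZMod Q) :
    (Fintype.card (Fin s → ZMod Q) : ℝ) *
      ‖∑ n ∈ S, c n * ZMod.stdAddChar ((n : ZMod Q) ^ K * a)‖ ^ (2 * R) ≤
      ((2 * R : ℝ) ^ s * (P : ℝ) ^ RR s) *
        ∑ h : Fin s → ZMod Q, ‖∑ n ∈ S, c n * ch Q s K n (h, a)‖ ^ (2 * R) := by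
  set I := Fintype.piFinset (fun _ : Fin R => S) with hI
  set b : (Fin R → ℤ) → ℂ := fun v => ∏ r, c (v r) * ZMod.stdAddChar ((v r : ZMod Q) ^ K * a) with hb
  set key : (Fin R → ℤ) → (Fin s → ℤ) := fun v i => ∑ r, (v r) ^ (i.1 + 1) with hkey
  have h1 := keys I b (fun v => lc Q s (key v))
  have e1 : ∑ v ∈ I, b v = (∑ n ∈ S, c n * ZMod.stdAddChar ((n : ZMod Q) ^ K * a)) ^ R := by
    rw [Finset.sum_pow']
  have e2 : ∀ h, ∑ v ∈ I, b v * lc Q s (key v) h = (∑ n ∈ S, c n * ch Q s K n (h, a)) ^ R := by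
    intro h
    rw [Finset.sum_pow']
    refine Finset.sum_congr rfl fun v _ => ?_
    rw [hb, lc_apply]
    have : ∑ i : Fin s, ((key v i : ℤ) : ZMod Q) * h i =
        ∑ r, ∑ i : Fin s, ((v r : ℤ) : ZMod Q) ^ (i.1 + 1) * h i := by
      rw [Finset.sum_comm]
      refine Finset.sum_congr rfl fun i _ => ?_
      rw [hkey, ← Finset.sum_mul]; push_cast; rfl
    rw [this, ← prod_std, ← Finset.prod_mul_distrib]
    refine Finset.prod_congr rfl fun r _ => ?_
    rw [ch_apply, AddChar.map_add_eq_mul]; ring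
  rw [e1] at h1
  simp_rw [e2, norm_pow, ← pow_mul, mul_comm R 2] at h1
  refine h1.trans (mul_le_mul_of_nonneg_right ?_ (Finset.sum_nonneg fun _ _ => by positivity))
  have hsub : I.image (fun v => lc Q s (key v)) ⊆
      (Fintype.piFinset (fun i : Fin s => Icc (1 : ℤ) (R * P ^ (i.1 + 1)))).image (lc Q s) := by
    intro γ hγ
    obtain ⟨v, hv, rfl⟩ := mem_image.1 hγ
    refine mem_image.2 ⟨key v, Fintype.mem_piFinset.2 fun i => mem_Icc.2 ⟨?_, ?_⟩, rfl⟩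
    · calc (1 : ℤ) ≤ ∑ r : Fin R, (1 : ℤ) := by simp; exact_mod_cast hR
        _ ≤ _ := Finset.sum_le_sum fun r _ => one_le_pow₀
          (mem_Icc.1 (hS (Fintype.mem_piFinset.1 hv r))).1
    · calc _ ≤ ∑ r : Fin R, (P : ℤ) ^ (i.1 + 1) := Finset.sum_le_sum fun r _ => by
            have := mem_Icc.1 (hS (Fintype.mem_piFinset.1 hv r))
            exact pow_le_pow_left₀ (by linarith) this.2 _
        _ = _ := by simp
  have hcard := (card_le_card hsub).trans card_image_le
  rw [Fintype.card_piFinset] at hcard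
  have h2 : ∏ i : Fin s, (Icc (1 : ℤ) (R * P ^ (i.1 + 1))).card = R ^ s * P ^ RR s := by
    have : ∀ i : Fin s, (Icc (1 : ℤ) (R * P ^ (i.1 + 1))).card = R * P ^ (i.1 + 1) := by
      intro i
      rw [Int.card_Icc]
      have : ((R : ℤ) * (P : ℤ) ^ (i.1 + 1) + 1 - 1) = ((R * P ^ (i.1 + 1) : ℕ) : ℤ) := by
        push_cast; ring
      rw [this, Int.toNat_natCast]
    simp_rw [this]
    rw [Finset.prod_mul_distrib, Finset.prod_const, Finset.prod_pow_eq_pow_sum]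
    congr 1
    · simp
    · congr 1
      rw [← Finset.sum_range (fun i => i + 1)]
      have := two_RR s
      have h3 := Finset.sum_range_id_mul_two (s + 1)
      rw [Finset.sum_range_succ'] at h3
      have h4 : (s + 1) * (s + 1 - 1) = s * (s + 1) := by rw [Nat.add_sub_cancel, mul_comm]
      omega
  rw [h2] at hcard
  calc ((I.image (fun v => lc Q s (key v))).card : ℝ) ≤ (R ^ s * P ^ RR s : ℕ) := by exact_mod_cast hcard
    _ = (R : ℝ) ^ s * (P : ℝ) ^ RR s := by push_cast; rfl
    _ ≤ _ := by
      gcongr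
      have : (0 : ℝ) ≤ R := by positivity
      linarith

theorem MV_vin {K s : ℕ} (hs1 : 1 ≤ s) (hs : s ≤ K) (hKp : K < p) : MV p K (s * (s + 1)) s := by
  obtain ⟨s, rfl⟩ : ∃ s', s = s' + 1 := ⟨s - 1, by omega⟩
  intro ε hε
  have hR := RR_pos (show 1 ≤ s + 1 by omega)
  set R := RR (s + 1) with hRd
  have hR0 : (0 : ℝ) < R := by exact_mod_cast hR
  obtain ⟨C, hC, h⟩ := fullmv (p := p) hs hKp (show 0 < ε / R by positivity)
  refine ⟨(2 * R : ℝ) ^ s * C, by positivity, fun P hP => ?_⟩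
  set L := (s + 1) * (Nat.log p P + 1) with hL
  refine ⟨p ^ L, inferInstance, fun S hS hcop c hc => ?_⟩
  have h1 := h P hP L hL S hS hcop c hc
  have h2R : (s + 1) * (s + 1 + 1) = 2 * R := (two_RR (s + 1)).symm
  rw [h2R]
  have hP0 : (0 : ℝ) < P := by exact_mod_cast hP
  have hB : (0 : ℝ) < (Fintype.card (Fin s → ZMod (p ^ L)) : ℝ) := by exact_mod_cast Fintype.card_pos
  refine le_of_mul_le_mul_left ?_ hB
  rw [Finset.mul_sum]
  calc _ ≤ ∑ a, ((2 * R : ℝ) ^ s * (P : ℝ) ^ RR s) *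
        ∑ h : Fin s → ZMod (p ^ L), ‖∑ n ∈ S, c n * ch (p ^ L) s K n (h, a)‖ ^ (2 * R) :=
        Finset.sum_le_sum fun a _ => drop_low _ s K R P hR hP S hS c a
    _ = ((2 * R : ℝ) ^ s * (P : ℝ) ^ RR s) *
        ∑ h, ‖∑ n ∈ S, c n * ch (p ^ L) s K n h‖ ^ (2 * R) := by
        rw [← Finset.mul_sum, Fintype.sum_prod_type_right]
    _ ≤ ((2 * R : ℝ) ^ s * (P : ℝ) ^ RR s) * (C * (P : ℝ) ^ (R * (1 + ε / R)) *
          Fintype.card ((Fin s → ZMod (p ^ L)) × ZMod (p ^ L))) := by gcongr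
    _ = _ := by
        rw [Fintype.card_prod, ZMod.card]
        have : (P : ℝ) ^ RR s * (P : ℝ) ^ (R * (1 + ε / R)) =
            (P : ℝ) ^ (((2 * R : ℕ) : ℝ) - ((s + 1 : ℕ) : ℝ) + ε) := by
          rw [← Real.rpow_natCast, ← Real.rpow_add hP0]
          congr 1
          have h3 : RR s + (s + 1) = R := by
            have := two_RR s; rw [hRd]; have := two_RR (s + 1); nlinarith
          have h4 : (RR s : ℝ) + ((s : ℝ) + 1) = R := by exact_mod_cast h3
          push_cast
          field_simp
          linarith
        rw [← this]; push_cast; ring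

end app2
end VMV

namespace VMV
open Polynomial

section hua

lemma div_bound {ε : ℝ} (hε : 0 < ε) : ∃ C ≥ (1 : ℝ), ∀ n : ℕ, n ≠ 0 →
    (n.divisors.card : ℝ) ≤ C * (n : ℝ) ^ ε := by
  have hl2 : 0 < Real.log 2 := Real.log_pos (by norm_num)
  set C1 : ℝ := 1 + 1 / (ε * Real.log 2) with hC1
  have hC11 : 1 ≤ C1 := by rw [hC1]; have : 0 < 1 / (ε * Real.log 2) := by positivity
                           linarith
  obtain ⟨B, hB⟩ := exists_nat_ge ((2 : ℝ) ^ (1 / ε))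
  refine ⟨C1 ^ B, one_le_pow₀ hC11, fun n hn => ?_⟩
  have hterm : ∀ q ∈ n.primeFactors, ((n.factorization q + 1 : ℕ) : ℝ) ≤
      (if q < B then C1 else 1) * ((q : ℝ) ^ (n.factorization q)) ^ ε := by
    intro q hq
    have hq2 : (2 : ℝ) ≤ q := by exact_mod_cast (Nat.prime_of_mem_primeFactors hq).two_le
    set e := n.factorization q
    have h0 : ((q : ℝ) ^ e) ^ ε = ((q : ℝ) ^ ε) ^ e := by
      rw [← Real.rpow_natCast, ← Real.rpow_natCast, ← Real.rpow_mul (by positivity),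
        ← Real.rpow_mul (by positivity), mul_comm]
    rw [h0]
    split_ifs with h
    · have h1 : 1 + ε * Real.log 2 * e ≤ ((q : ℝ) ^ ε) ^ e := by
        calc 1 + ε * Real.log 2 * e ≤ Real.exp (ε * Real.log 2 * e) := by
              have := Real.add_one_le_exp (ε * Real.log 2 * e); linarith
          _ = ((2 : ℝ) ^ ε) ^ e := by
              rw [Real.rpow_def_of_pos (by norm_num), ← Real.exp_nat_mul]; ring_nf
          _ ≤ _ := by gcongr
      have h2 : 0 < ε * Real.log 2 := by positivity
      calc ((e + 1 : ℕ) : ℝ) ≤ C1 * (1 + ε * Real.log 2 * e) := by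
            rw [hC1, add_mul, mul_add, mul_add]
            have : 1 / (ε * Real.log 2) * (ε * Real.log 2 * e) = e := by field_simp
            rw [this]; push_cast
            have : 0 ≤ ε * Real.log 2 * e := by positivity
            have : 0 < 1 / (ε * Real.log 2) := by positivity
            linarith
        _ ≤ _ := by gcongr
    · have h1 : (2 : ℝ) ≤ (q : ℝ) ^ ε := by
        calc (2 : ℝ) = ((2 : ℝ) ^ (1 / ε)) ^ ε := by
              rw [← Real.rpow_mul (by norm_num), one_div_mul_cancel hε.ne', Real.rpow_one]
          _ ≤ _ := by
              refine Real.rpow_le_rpow (by positivity) (hB.trans ?_) hε.le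
              exact_mod_cast not_lt.1 h
      rw [one_mul]
      calc ((e + 1 : ℕ) : ℝ) ≤ (2 : ℝ) ^ e := by exact_mod_cast Nat.lt_two_pow_self
        _ ≤ _ := by gcongr
  rw [Nat.card_divisors hn]
  push_cast
  have hfac : (n : ℝ) ^ ε = ∏ q ∈ n.primeFactors, ((q : ℝ) ^ (n.factorization q)) ^ ε := by
    rw [Real.finsetProd_rpow _ _ (fun _ _ => by positivity)]
    congr 1
    conv_lhs => rw [← Nat.prod_factorization_pow_eq_self hn]
    rw [Finsupp.prod, Nat.support_factorization]
    push_cast; rfl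
  calc _ ≤ ∏ q ∈ n.primeFactors, ((if q < B then C1 else 1) * ((q : ℝ) ^ (n.factorization q)) ^ ε) := by
        refine Finset.prod_le_prod (fun _ _ => by positivity) fun q hq => ?_
        have := hterm q hq
        push_cast at this; exact this
    _ = (∏ q ∈ n.primeFactors, (if q < B then C1 else 1)) * (n : ℝ) ^ ε := by
        rw [Finset.prod_mul_distrib, hfac]
    _ ≤ C1 ^ B * (n : ℝ) ^ ε := by
        gcongr
        rw [Finset.prod_ite, Finset.prod_const, Finset.prod_const_one, mul_one]
        refine pow_le_pow_right₀ hC11 ?_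
        calc _ ≤ (range B).card := card_le_card fun q hq => mem_range.2 (mem_filter.1 hq).2
          _ = B := card_range B

lemma diff_poly {d : ℕ} (q : ℤ[X]) (hq : q.natDegree = d + 1) (h : ℤ) :
    ∃ q' : ℤ[X], q'.natDegree = d ∧ q.comp (X + C h) - q = C h * q' := by
  set G : ℕ → ℤ[X] := fun i => ∑ l ∈ range i, (X + C h) ^ l * X ^ (i - 1 - l) with hG
  have hGd : ∀ i, (G i).natDegree ≤ i - 1 := by
    intro i
    refine natDegree_sum_le_of_forall_le _ _ fun l hl => ?_
    have := mem_range.1 hl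
    refine natDegree_mul_le.trans ?_
    rw [natDegree_pow, natDegree_X_add_C, natDegree_X_pow]; omega
  have hGc : (G (d + 1)).coeff d = d + 1 := by
    simp only [hG, finsetSum_coeff]
    have : ∀ l ∈ range (d + 1), ((X + C h) ^ l * X ^ (d + 1 - 1 - l)).coeff d = 1 := by
      intro l hl
      have := mem_range.1 hl
      have e : d = l + (d + 1 - 1 - l) := by omega
      conv_lhs => rw [e]
      rw [show l + (d + 1 - 1 - l) + 1 - 1 - l = d + 1 - 1 - l by omega, coeff_mul_X_pow, coeff_X_add_C_pow]; simp
    rw [Finset.sum_congr rfl this]; simp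
  have hGe : ∀ i, C h * G i = (X + C h) ^ i - X ^ i := by
    intro i
    have := (Commute.all (X + C h : ℤ[X]) X).mul_geom_sum₂ i
    rw [add_sub_cancel_left] at this
    exact this
  set q' : ℤ[X] := ∑ i ∈ range (d + 2), C (q.coeff i) * G i with hq'
  have hqe : q = ∑ i ∈ range (d + 2), C (q.coeff i) * X ^ i := by
    have := q.as_sum_range_C_mul_X_pow
    rwa [hq] at this
  refine ⟨q', ?_, ?_⟩
  · refine natDegree_eq_of_le_of_coeff_ne_zero ?_ ?_
    · refine natDegree_sum_le_of_forall_le _ _ fun i hi => ?_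
      have := mem_range.1 hi
      exact (natDegree_C_mul_le _ _).trans ((hGd i).trans (by omega))
    · rw [hq', finsetSum_coeff, Finset.sum_range_succ, coeff_C_mul, hGc, Finset.sum_eq_zero, zero_add]
      · refine mul_ne_zero ?_ (by positivity)
        rw [← hq]
        exact leadingCoeff_ne_zero.2 (by rintro rfl; simp at hq)
      · intro i hi
        have := mem_range.1 hi
        rw [coeff_C_mul]
        rcases Nat.eq_zero_or_pos i with rfl | hi0
        · simp [hG]
        · rw [coeff_eq_zero_of_natDegree_lt ((hGd i).trans_lt (by omega)), mul_zero]
  · rw [hq', Finset.mul_sum]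
    conv_lhs => rw [hqe]
    rw [Polynomial.sum_comp, ← Finset.sum_sub_distrib]
    refine Finset.sum_congr rfl fun i _ => ?_
    rw [mul_left_comm, hGe]
    simp; ring

noncomputable def Dp (K : ℕ) : List ℤ → ℤ[X]
  | [] => X ^ K
  | h :: t => (Dp K t).comp (X + C h) - Dp K t

noncomputable def In (P : ℕ) : List ℤ → Finset ℤ
  | [] => Icc 1 (P : ℤ)
  | h :: t => (In P t).filter (fun n => n + h ∈ In P t)

noncomputable def UU (P : ℕ) : ℕ → Finset (List ℤ)
  | 0 => {[]}
  | j + 1 => (Icc (-(P : ℤ)) P ×ˢ UU P j).map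
      ⟨fun x => x.1 :: x.2, fun x y h => by
        simp only [List.cons.injEq] at h; exact Prod.ext h.1 h.2⟩

lemma In_sub (P : ℕ) (t : List ℤ) : In P t ⊆ Icc 1 (P : ℤ) := by
  induction t with
  | nil => exact subset_rfl
  | cons h t ih => exact (filter_subset _ _).trans ih

lemma sum_UU {M : Type*} [AddCommMonoid M] (P j : ℕ) (g : List ℤ → M) :
    ∑ t ∈ UU P (j + 1), g t = ∑ t ∈ UU P j, ∑ h ∈ Icc (-(P : ℤ)) P, g (h :: t) := by
  rw [UU, Finset.sum_map, Finset.sum_product_right]; rfl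

lemma UU_length {P j : ℕ} {t : List ℤ} (h : t ∈ UU P j) : t.length = j := by
  induction j generalizing t with
  | zero => simp [UU] at h; simp [h]
  | succ j ih =>
    obtain ⟨x, hx, rfl⟩ := mem_map.1 h
    change (x.1 :: x.2).length = j + 1
    rw [List.length_cons, ih (mem_product.1 hx).2]

lemma card_int (P : ℕ) : (Icc (-(P : ℤ)) P).card = 2 * P + 1 := by
  rw [Int.card_Icc]; omega

lemma card_UU (P j : ℕ) : (UU P j).card = (2 * P + 1) ^ j := by
  induction j with
  | zero => simp [UU]
  | succ j ih => rw [UU, card_map, card_product, ih, card_int, pow_succ, mul_comm]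

lemma card_UU_filter (P j : ℕ) (q : ℤ → Prop) [DecidablePred q] :
    ((UU P j).filter (fun t => ∀ h ∈ t, q h)).card = ((Icc (-(P : ℤ)) P).filter q).card ^ j := by
  induction j with
  | zero => simp [UU, Finset.filter_singleton]
  | succ j ih =>
    rw [card_filter, sum_UU, pow_succ, ← ih, card_filter, card_filter, Finset.sum_mul_sum]
    refine Finset.sum_congr rfl fun t _ => Finset.sum_congr rfl fun h _ => ?_
    by_cases h1 : q h <;> simp [h1]

lemma card_UU_zero (P j : ℕ) :
    ((UU P j).filter (fun t => (0 : ℤ) ∈ t)).card * (2 * P + 1) ≤ j * (2 * P + 1) ^ j := by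
  induction j with
  | zero => simp [UU, Finset.filter_singleton]
  | succ j ih =>
    have : ((UU P (j + 1)).filter (fun t => (0 : ℤ) ∈ t)).card ≤
        (2 * P + 1) ^ j + (2 * P + 1) * ((UU P j).filter (fun t => (0 : ℤ) ∈ t)).card := by
      rw [card_filter, sum_UU]
      calc _ ≤ ∑ t ∈ UU P j, (1 + (2 * P + 1) * (if (0 : ℤ) ∈ t then 1 else 0)) := by
            refine Finset.sum_le_sum fun t _ => ?_
            calc _ ≤ ∑ h ∈ Icc (-(P : ℤ)) P, ((if h = 0 then 1 else 0) + (if (0 : ℤ) ∈ t then 1 else 0)) := by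
                  refine Finset.sum_le_sum fun h _ => ?_
                  by_cases h1 : h = 0 <;> by_cases h2 : (0 : ℤ) ∈ t <;> simp [h1, h2, List.mem_cons, eq_comm (a := (0 : ℤ)) (b := h)]
              _ ≤ _ := by
                  rw [Finset.sum_add_distrib, Finset.sum_const, card_int, Finset.sum_ite_eq']
                  simp
        _ = _ := by
            rw [Finset.sum_add_distrib, Finset.sum_const, card_UU, ← Finset.mul_sum, ← card_filter]; simp
    calc _ ≤ ((2 * P + 1) ^ j + (2 * P + 1) * ((UU P j).filter (fun t => (0 : ℤ) ∈ t)).card) * (2 * P + 1) :=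
          Nat.mul_le_mul_right _ this
      _ = (2 * P + 1) ^ (j + 1) + (2 * P + 1) *
          (((UU P j).filter (fun t => (0 : ℤ) ∈ t)).card * (2 * P + 1)) := by ring
      _ ≤ (2 * P + 1) ^ (j + 1) + (2 * P + 1) * (j * (2 * P + 1) ^ j) := by gcongr
      _ = _ := by ring

lemma Dp_form (K : ℕ) (t : List ℤ) (ht : t.length ≤ K) :
    ∃ q : ℤ[X], q.natDegree = K - t.length ∧ Dp K t = C t.prod * q := by
  induction t with
  | nil => exact ⟨X ^ K, by simp, by simp [Dp]⟩
  | cons h t ih =>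
    simp only [List.length_cons] at ht ⊢
    obtain ⟨q, hq, hD⟩ := ih (by omega)
    obtain ⟨q', hq', hD'⟩ := diff_poly (d := K - (t.length + 1)) q (by omega) h
    refine ⟨q', hq', ?_⟩
    rw [Dp, hD, mul_comp, C_comp, ← mul_sub, hD', List.prod_cons, C_mul]; ring

lemma Dp_bound (K P : ℕ) (t : List ℤ) {n : ℤ} (hn : n ∈ In P t) :
    |(Dp K t).eval n| ≤ 2 ^ t.length * (P : ℤ) ^ K := by
  induction t generalizing n with
  | nil =>
    have := mem_Icc.1 hn
    simp only [Dp, eval_pow, eval_X, List.length_nil, pow_zero, one_mul, abs_pow]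
    exact pow_le_pow_left₀ (abs_nonneg _) (by rw [abs_le]; constructor <;> linarith) _
  | cons h t ih =>
    obtain ⟨h1, h2⟩ := mem_filter.1 hn
    rw [Dp, eval_sub, eval_comp]
    simp only [eval_add, eval_X, eval_C, List.length_cons, pow_succ]
    have a := ih h1
    have b := ih h2
    have := abs_sub (eval (n + h) (Dp K t)) (eval n (Dp K t))
    linarith

lemma fib_card {K : ℕ} {t : List ℤ} (ht : t.length < K) (h0 : (0 : ℤ) ∉ t) (I : Finset ℤ) (m : ℤ) :
    (I.filter (fun n => (Dp K t).eval n = m)).card ≤ K := by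
  obtain ⟨q, hq, hD⟩ := Dp_form K t ht.le
  have hp : t.prod ≠ 0 := List.prod_ne_zero h0
  have hne : Dp K t - C m ≠ 0 := by
    intro h
    have : (Dp K t).natDegree = 0 := by rw [sub_eq_zero.1 h]; exact natDegree_C _
    rw [hD, natDegree_C_mul hp, hq] at this
    omega
  calc _ ≤ (Dp K t - C m).roots.toFinset.card := by
        refine card_le_card fun n hn => ?_
        rw [Multiset.mem_toFinset, mem_roots hne, IsRoot, eval_sub, eval_C, (mem_filter.1 hn).2, sub_self]
    _ ≤ (Dp K t - C m).roots.card := Multiset.toFinset_card_le _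
    _ ≤ (Dp K t - C m).natDegree := card_roots' _
    _ ≤ K := by
        rw [natDegree_sub_C, hD, natDegree_C_mul hp, hq]; omega

/-- number of zeros of the differenced polynomials -/
lemma Z0_bound {K j : ℕ} (hj : j < K) (P : ℕ) :
    ∑ t ∈ UU P j, ((In P t).filter (fun n => (Dp K t).eval n = 0)).card ≤ 2 * K * (2 * P + 1) ^ j := by
  have hIn : ∀ t, (In P t).card ≤ 2 * P + 1 := by
    intro t
    have := card_le_card (In_sub P t)
    rw [Int.card_Icc] at this; omega
  calc _ ≤ ∑ t ∈ UU P j, (K + (if (0 : ℤ) ∈ t then 1 else 0) * (2 * P + 1)) := by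
        refine Finset.sum_le_sum fun t ht => ?_
        by_cases h : (0 : ℤ) ∈ t
        · rw [if_pos h, one_mul]
          exact (card_le_card (filter_subset _ _)).trans ((hIn t).trans (by omega))
        · rw [if_neg h, zero_mul]
          exact fib_card (by rw [UU_length ht]; exact hj) h _ _
    _ ≤ (2 * P + 1) ^ j * K + j * (2 * P + 1) ^ j := by
        rw [Finset.sum_add_distrib, Finset.sum_const, card_UU, ← Finset.sum_mul, ← card_filter, smul_eq_mul]
        exact Nat.add_le_add_left (card_UU_zero P j) _
    _ ≤ _ := by nlinarith [Nat.mul_le_mul_right ((2 * P + 1) ^ j) hj.le]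

lemma Z1_bound {K j : ℕ} (hj : j < K) (P : ℕ) {m : ℤ} (hm : m ≠ 0) :
    ∑ t ∈ UU P j, ((In P t).filter (fun n => (Dp K t).eval n = m)).card ≤
      K * (2 * m.natAbs.divisors.card) ^ j := by
  have hdv : ((Icc (-(P : ℤ)) P).filter (fun h => h ∣ m)).card ≤ 2 * m.natAbs.divisors.card := by
    have : (Icc (-(P : ℤ)) P).filter (fun h => h ∣ m) ⊆
        m.natAbs.divisors.image (fun d : ℕ => (d : ℤ)) ∪ m.natAbs.divisors.image (fun d : ℕ => -(d : ℤ)) := by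
      intro h hh
      have hd := (mem_filter.1 hh).2
      have h2 : h.natAbs ∈ m.natAbs.divisors :=
        Nat.mem_divisors.2 ⟨Int.natAbs_dvd_natAbs.2 hd, by simpa using hm⟩
      rcases Int.natAbs_eq h with h1 | h1
      · exact mem_union_left _ (mem_image.2 ⟨_, h2, h1.symm⟩)
      · exact mem_union_right _ (mem_image.2 ⟨_, h2, h1.symm⟩)
    refine (card_le_card this).trans ((card_union_le _ _).trans ?_)
    have a := card_image_le (s := m.natAbs.divisors) (f := fun d : ℕ => (d : ℤ))
    have b := card_image_le (s := m.natAbs.divisors) (f := fun d : ℕ => -(d : ℤ))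
    omega
  calc _ ≤ ∑ t ∈ UU P j, (if (∀ h ∈ t, h ∣ m) then 1 else 0) * K := by
        refine Finset.sum_le_sum fun t ht => ?_
        have hl := UU_length ht
        split_ifs with h
        · rw [one_mul]
          refine fib_card (by omega) (fun h0 => hm ?_) _ _
          exact zero_dvd_iff.1 (h 0 h0)
        · rw [zero_mul, Nat.le_zero, card_eq_zero, filter_eq_empty_iff]
          intro n _ he
          apply h
          intro a ha
          obtain ⟨q, -, hD⟩ := Dp_form K t (by omega)
          rw [← he, hD, eval_mul, eval_C]
          exact (List.dvd_prod ha).mul_right _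
    _ = ((Icc (-(P : ℤ)) P).filter (fun h => h ∣ m)).card ^ j * K := by
        rw [← Finset.sum_mul, ← card_filter, card_UU_filter]
    _ ≤ _ := by rw [mul_comm]; gcongr

end hua
end VMV

namespace VMV
open Polynomial

section hua2
open ComplexConjugate

noncomputable def TT (Q K P : ℕ) [NeZero Q] (t : List ℤ) (a : ZMod Q) : ℂ :=
  ∑ n ∈ In P t, ZMod.stdAddChar ((((Dp K t).eval n : ℤ) : ZMod Q) * a)

lemma TT_sq (Q K P : ℕ) [NeZero Q] (t : List ℤ) (a : ZMod Q) :
    ((‖TT Q K P t a‖ ^ 2 : ℝ) : ℂ) = ∑ h ∈ Icc (-(P : ℤ)) P, TT Q K P (h :: t) a := by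
  push_cast
  rw [← Complex.mul_conj']
  unfold TT
  rw [map_sum, Finset.sum_mul_sum, Finset.sum_comm]
  simp only [In, Finset.sum_filter]
  conv_rhs => rw [Finset.sum_comm]
  refine Finset.sum_congr rfl fun m hm => ?_
  rw [← Finset.sum_filter]
  have hm' := mem_Icc.1 (In_sub P t hm)
  refine Finset.sum_nbij' (fun n => n - m) (fun h => m + h) ?_ ?_ ?_ ?_ ?_
  · intro n hn
    have hn' := mem_Icc.1 (In_sub P t hn)
    refine mem_filter.2 ⟨mem_Icc.2 ⟨by linarith, by linarith⟩, ?_⟩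
    simpa using hn
  · intro h hh; exact (mem_filter.1 hh).2
  · intro n _; ring
  · intro h _; ring
  · intro n _
    rw [← AddChar.map_neg_eq_conj, ← AddChar.map_add_eq_mul]
    congr 1
    simp only [Dp, eval_sub, eval_comp, eval_add, eval_X, eval_C, add_sub_cancel]
    push_cast; ring

lemma TT_sum (Q K P : ℕ) [NeZero Q] (j : ℕ) (a : ZMod Q) :
    ((∑ t ∈ UU P j, ‖TT Q K P t a‖ ^ 2 : ℝ) : ℂ) = ∑ t ∈ UU P (j + 1), TT Q K P t a := by
  rw [sum_UU]; push_cast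
  refine Finset.sum_congr rfl fun t _ => ?_
  rw [← TT_sq]; push_cast; rfl

lemma weyl_aux (Q K P : ℕ) [NeZero Q] (j : ℕ) (a : ZMod Q)
    (h : ‖TT Q K P [] a‖ ^ (2 ^ j) ≤ ((2 * P + 1 : ℕ) : ℝ) ^ (2 ^ j - j - 1) * ‖∑ t ∈ UU P j, TT Q K P t a‖) :
    ‖TT Q K P [] a‖ ^ (2 ^ (j + 1)) ≤ ((2 * P + 1 : ℕ) : ℝ) ^ (2 ^ (j + 1) - (j + 1) - 1) *
      ∑ t ∈ UU P j, ‖TT Q K P t a‖ ^ 2 := by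
  have hj : j + 1 ≤ 2 ^ j := Nat.lt_two_pow_self
  have hj' : 2 ^ (j + 1) = 2 * 2 ^ j := by ring
  set B : ℝ := ((2 * P + 1 : ℕ) : ℝ) with hB
  calc ‖TT Q K P [] a‖ ^ (2 ^ (j + 1)) = (‖TT Q K P [] a‖ ^ (2 ^ j)) ^ 2 := by rw [← pow_mul, pow_succ]
    _ ≤ (B ^ (2 ^ j - j - 1) * ‖∑ t ∈ UU P j, TT Q K P t a‖) ^ 2 :=
        pow_le_pow_left₀ (by positivity) h _
    _ ≤ (B ^ (2 ^ j - j - 1)) ^ 2 * (B ^ j * ∑ t ∈ UU P j, ‖TT Q K P t a‖ ^ 2) := by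
        rw [mul_pow]
        gcongr
        calc _ ≤ (∑ t ∈ UU P j, ‖TT Q K P t a‖) ^ 2 := pow_le_pow_left₀ (norm_nonneg _) (norm_sum_le _ _) _
          _ ≤ _ := by
            refine sq_sum_le_card_mul_sum_sq.trans (le_of_eq ?_)
            rw [card_UU, hB]; push_cast; rfl
    _ = _ := by
        rw [← mul_assoc, ← pow_mul, ← pow_add]
        congr 2
        omega

lemma weyl_norm (Q K P : ℕ) [NeZero Q] (j : ℕ) (a : ZMod Q) :
    ‖TT Q K P [] a‖ ^ (2 ^ j) ≤ ((2 * P + 1 : ℕ) : ℝ) ^ (2 ^ j - j - 1) * ‖∑ t ∈ UU P j, TT Q K P t a‖ := by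
  induction j with
  | zero => simp [UU]
  | succ j ih =>
    refine (weyl_aux Q K P j a ih).trans ?_
    rw [← TT_sum, Complex.norm_real]
    gcongr
    exact Real.le_norm_self _

lemma weyl_re (Q K P : ℕ) [NeZero Q] (j : ℕ) (a : ZMod Q) :
    ‖TT Q K P [] a‖ ^ (2 ^ (j + 1)) ≤ ((2 * P + 1 : ℕ) : ℝ) ^ (2 ^ (j + 1) - (j + 1) - 1) *
      (∑ t ∈ UU P (j + 1), TT Q K P t a).re := by
  rw [← TT_sum, Complex.ofReal_re]
  exact weyl_aux Q K P j a (weyl_norm Q K P j a)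

noncomputable def II (r P : ℕ) : Finset (Fin r → ℤ) := Fintype.piFinset (fun _ : Fin r => Icc (1 : ℤ) P)
def ky (K : ℕ) {r : ℕ} (u : Fin r → ℤ) : ℤ := ∑ i, u i ^ K

lemma card_II (r P : ℕ) : (II r P).card = P ^ r := by
  rw [II, Fintype.card_piFinset]; simp

lemma ky_bound {K r P : ℕ} {u : Fin r → ℤ} (hu : u ∈ II r P) : 0 ≤ ky K u ∧ ky K u ≤ r * (P : ℤ) ^ K := by
  have h : ∀ i, 1 ≤ u i ∧ u i ≤ P := fun i => mem_Icc.1 (Fintype.mem_piFinset.1 hu i)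
  constructor
  · exact Finset.sum_nonneg fun i _ => pow_nonneg (by linarith [(h i).1]) _
  · calc _ ≤ ∑ i : Fin r, (P : ℤ) ^ K := Finset.sum_le_sum fun i _ =>
          pow_le_pow_left₀ (by linarith [(h i).1]) (h i).2 _
      _ = _ := by simp

lemma f_expand (Q K P r : ℕ) [NeZero Q] (a : ZMod Q) :
    ((‖TT Q K P [] a‖ ^ (2 * r) : ℝ) : ℂ) = ∑ u ∈ II r P, ∑ v ∈ II r P,
      ZMod.stdAddChar (((ky K u - ky K v : ℤ) : ZMod Q) * a) := by
  have h1 : TT Q K P [] a ^ r = ∑ u ∈ II r P, ZMod.stdAddChar (((ky K u : ℤ) : ZMod Q) * a) := by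
    rw [TT, Finset.sum_pow']
    refine Finset.sum_congr rfl fun u _ => ?_
    rw [prod_std, ← Finset.sum_mul]
    simp [Dp, ky]
  push_cast
  rw [mul_comm 2 r, pow_mul, ← Complex.ofReal_pow, ← norm_pow, ← Complex.mul_conj', h1, map_sum, Finset.sum_mul_sum]
  refine Finset.sum_congr rfl fun u _ => Finset.sum_congr rfl fun v _ => ?_
  rw [← AddChar.map_neg_eq_conj, ← AddChar.map_add_eq_mul]
  congr 1; push_cast; ring

lemma orthQ (Q : ℕ) [NeZero Q] (m : ℤ) :
    ∑ a : ZMod Q, ZMod.stdAddChar ((m : ZMod Q) * a) = if (Q : ℤ) ∣ m then (Q : ℂ) else 0 := by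
  have := AddChar.sum_mulShift (ψ := ZMod.stdAddChar (N := Q)) (m : ZMod Q) (ZMod.isPrimitive_stdAddChar Q)
  simp_rw [mul_comm (m : ZMod Q)]
  rw [this, ZMod.card]
  simp [ZMod.intCast_zmod_eq_zero_iff_dvd]

noncomputable def cnt (K P j : ℕ) (m : ℤ) : ℕ :=
  ∑ t ∈ UU P j, ((In P t).filter (fun n => (Dp K t).eval n = m)).card

lemma hua_count {Q K P r j : ℕ} [NeZero Q] (hj : j < K) (hr : r ≤ 2 ^ K) (hP : 1 ≤ P)
    (hQ : 2 ^ (K + 2) * P ^ K ≤ Q) {Z1 : ℝ} (hZ : 0 ≤ Z1)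
    (hZ1 : ∀ m : ℤ, m ≠ 0 → |m| ≤ 2 ^ K * (P : ℤ) ^ K → (cnt K P j m : ℝ) ≤ Z1) :
    ∑ a : ZMod Q, ‖TT Q K P [] a‖ ^ (2 * r) * (∑ t ∈ UU P j, TT Q K P t a).re ≤
      (2 * K * (2 * P + 1) ^ j : ℕ) * ∑ a : ZMod Q, ‖TT Q K P [] a‖ ^ (2 * r) + Q * ((P : ℝ) ^ (2 * r) * Z1) := by
  have hPK : (0 : ℤ) < (P : ℤ) ^ K := by positivity
  have hQ' : 4 * (2 ^ K * (P : ℤ) ^ K) ≤ Q := by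
    have : ((2 ^ (K + 2) * P ^ K : ℕ) : ℤ) ≤ Q := by exact_mod_cast hQ
    push_cast at this; rw [pow_add] at this; linarith
  have hky : ∀ u ∈ II r P, ∀ v ∈ II r P, |ky K u - ky K v| ≤ 2 ^ K * (P : ℤ) ^ K := by
    intro u hu v hv
    have h1 := ky_bound (K := K) hu
    have h2 := ky_bound (K := K) hv
    have h3 : (r : ℤ) * (P : ℤ) ^ K ≤ 2 ^ K * (P : ℤ) ^ K := by
      have : (r : ℤ) ≤ 2 ^ K := by exact_mod_cast hr
      gcongr
    rw [abs_le]; constructor <;> linarith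
  have hpos2 : (0 : ℤ) < 2 ^ K * (P : ℤ) ^ K := by positivity
  -- first identity
  have e1 : ((∑ a : ZMod Q, ‖TT Q K P [] a‖ ^ (2 * r) * (∑ t ∈ UU P j, TT Q K P t a).re : ℝ) : ℝ) =
      ∑ u ∈ II r P, ∑ v ∈ II r P, (Q : ℝ) * (cnt K P j (ky K v - ky K u) : ℝ) := by
    have : (∑ a : ZMod Q, ((‖TT Q K P [] a‖ ^ (2 * r) : ℝ) : ℂ) * (∑ t ∈ UU P j, TT Q K P t a)) =
      ((∑ u ∈ II r P, ∑ v ∈ II r P, (Q : ℝ) * (cnt K P j (ky K v - ky K u) : ℝ) : ℝ) : ℂ) := by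
      simp_rw [f_expand, Finset.sum_mul]
      rw [Finset.sum_comm]
      push_cast
      refine Finset.sum_congr rfl fun u hu => ?_
      rw [Finset.sum_comm]
      refine Finset.sum_congr rfl fun v hv => ?_
      simp_rw [TT, Finset.mul_sum]
      rw [Finset.sum_comm, cnt]
      push_cast
      rw [Finset.mul_sum]
      refine Finset.sum_congr rfl fun t ht => ?_
      rw [Finset.sum_comm, card_filter]
      push_cast
      rw [Finset.mul_sum]
      refine Finset.sum_congr rfl fun n hn => ?_
      have h5 := orthQ Q (ky K u - ky K v + (Dp K t).eval n)
      calc _ = ∑ a : ZMod Q, ZMod.stdAddChar (((ky K u - ky K v + (Dp K t).eval n : ℤ) : ZMod Q) * a) := by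
            refine Finset.sum_congr rfl fun a _ => ?_
            rw [← AddChar.map_add_eq_mul]; congr 1; push_cast; ring
        _ = _ := by
            rw [h5]
            have hb := Dp_bound K P t hn
            rw [UU_length ht] at hb
            have hb2 : (2 : ℤ) ^ j * (P : ℤ) ^ K ≤ 2 ^ K * (P : ℤ) ^ K := by
              have : (2 : ℤ) ^ j ≤ 2 ^ K := pow_le_pow_right₀ (by norm_num) hj.le
              gcongr
            have hk := hky u hu v hv
            have hiff : (Q : ℤ) ∣ ky K u - ky K v + (Dp K t).eval n ↔ (Dp K t).eval n = ky K v - ky K u := by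
              constructor
              · intro hd
                have := Int.eq_zero_of_abs_lt_dvd hd (by
                  have := abs_add_le (ky K u - ky K v) ((Dp K t).eval n)
                  linarith)
                linarith
              · intro h; rw [h]; simp
            by_cases hc : (Dp K t).eval n = ky K v - ky K u
            · rw [if_pos (hiff.2 hc), if_pos hc, mul_one]
            · rw [if_neg (fun h => hc (hiff.1 h)), if_neg hc, mul_zero]
    have h6 := congrArg Complex.re this
    rw [Complex.ofReal_re, Complex.re_sum] at h6
    rw [← h6]
    refine Finset.sum_congr rfl fun a _ => ?_
    rw [Complex.re_ofReal_mul]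
  have e2 : (∑ a : ZMod Q, ‖TT Q K P [] a‖ ^ (2 * r) : ℝ) =
      ∑ u ∈ II r P, ∑ v ∈ II r P, (Q : ℝ) * (if ky K v - ky K u = 0 then 1 else 0) := by
    have : ((∑ a : ZMod Q, ‖TT Q K P [] a‖ ^ (2 * r) : ℝ) : ℂ) =
      ((∑ u ∈ II r P, ∑ v ∈ II r P, (Q : ℝ) * (if ky K v - ky K u = 0 then 1 else 0) : ℝ) : ℂ) := by
      rw [Complex.ofReal_sum]
      simp_rw [f_expand]
      rw [Finset.sum_comm]
      push_cast
      refine Finset.sum_congr rfl fun u hu => ?_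
      rw [Finset.sum_comm]
      refine Finset.sum_congr rfl fun v hv => ?_
      have h5 := orthQ Q (ky K u - ky K v)
      push_cast at h5
      rw [h5]
      have hk := hky u hu v hv
      by_cases hc : ky K v - ky K u = 0
      · have : ky K u - ky K v = 0 := by linarith
        rw [if_pos hc, if_pos (by rw [this]; exact dvd_zero _)]; simp
      · rw [if_neg hc, if_neg]
        · simp
        intro hd
        have := Int.eq_zero_of_abs_lt_dvd hd (by linarith)
        exact hc (by linarith)
    exact_mod_cast this
  rw [e1, e2, Finset.mul_sum]
  have h7 : (Q : ℝ) * ((P : ℝ) ^ (2 * r) * Z1) = ∑ u ∈ II r P, ∑ v ∈ II r P, (Q : ℝ) * Z1 := by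
    rw [Finset.sum_const, Finset.sum_const, card_II]
    simp only [nsmul_eq_mul]; push_cast; ring
  rw [h7, ← Finset.sum_add_distrib]
  refine Finset.sum_le_sum fun u hu => ?_
  rw [Finset.mul_sum, ← Finset.sum_add_distrib]
  refine Finset.sum_le_sum fun v hv => ?_
  have hQ0 : (0 : ℝ) ≤ Q := by positivity
  by_cases hc : ky K v - ky K u = 0
  · rw [if_pos hc, mul_one, hc]
    have : (cnt K P j 0 : ℝ) ≤ (2 * K * (2 * P + 1) ^ j : ℕ) := by exact_mod_cast Z0_bound hj P
    nlinarith
  · rw [if_neg hc, mul_zero, mul_zero, zero_add]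
    exact mul_le_mul_of_nonneg_left (hZ1 _ hc (hky v hv u hu)) hQ0

lemma Z1_real {K : ℕ} (hK : 1 ≤ K) {ε : ℝ} (hε : 0 < ε) : ∃ C > (0 : ℝ), ∀ P : ℕ, 1 ≤ P → ∀ j < K,
    ∀ m : ℤ, m ≠ 0 → |m| ≤ 2 ^ K * (P : ℤ) ^ K → (cnt K P j m : ℝ) ≤ C * (P : ℝ) ^ ε := by
  have hK0 : (0 : ℝ) < K := by exact_mod_cast hK
  set ε' := ε / (K * K) with hε'
  have hε'0 : 0 < ε' := by positivity
  obtain ⟨C0, hC0, hd⟩ := div_bound hε'0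
  set C1 : ℝ := 2 * (C0 * ((2 : ℝ) ^ K) ^ ε') with hC1
  have h2K : (1 : ℝ) ≤ ((2 : ℝ) ^ K) ^ ε' := Real.one_le_rpow (one_le_pow₀ (by norm_num)) hε'0.le
  have hC11 : 1 ≤ C1 := by rw [hC1]; nlinarith
  refine ⟨K * C1 ^ K, by positivity, fun P hP j hj m hm hmb => ?_⟩
  have hP1 : (1 : ℝ) ≤ P := by exact_mod_cast hP
  have hP0 : (0 : ℝ) < P := by linarith
  have h1 : (cnt K P j m : ℝ) ≤ K * (2 * (m.natAbs.divisors.card : ℝ)) ^ j := by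
    exact_mod_cast Z1_bound hj P hm
  have h2 : (m.natAbs : ℝ) ≤ 2 ^ K * (P : ℝ) ^ K := by
    have : ((m.natAbs : ℕ) : ℤ) ≤ 2 ^ K * (P : ℤ) ^ K := by rwa [Int.natCast_natAbs]
    exact_mod_cast this
  have h3 : 2 * (m.natAbs.divisors.card : ℝ) ≤ C1 * ((P : ℝ) ^ K) ^ ε' := by
    have := hd m.natAbs (by simpa using hm)
    calc _ ≤ 2 * (C0 * (2 ^ K * (P : ℝ) ^ K) ^ ε') := by
          have h4 : (m.natAbs : ℝ) ^ ε' ≤ (2 ^ K * (P : ℝ) ^ K) ^ ε' :=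
            Real.rpow_le_rpow (by positivity) h2 hε'0.le
          have : C0 * (m.natAbs : ℝ) ^ ε' ≤ C0 * (2 ^ K * (P : ℝ) ^ K) ^ ε' := by gcongr
          linarith
      _ = _ := by rw [Real.mul_rpow (by positivity) (by positivity), hC1]; ring
  have h4 : 1 ≤ C1 * ((P : ℝ) ^ K) ^ ε' := by
    have : 1 ≤ ((P : ℝ) ^ K) ^ ε' := Real.one_le_rpow (one_le_pow₀ hP1) hε'0.le
    nlinarith
  calc _ ≤ K * (C1 * ((P : ℝ) ^ K) ^ ε') ^ j := h1.trans (by gcongr)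
    _ ≤ K * (C1 * ((P : ℝ) ^ K) ^ ε') ^ K := by gcongr
    _ = _ := by
        have : (((P : ℝ) ^ K) ^ ε') ^ K = (P : ℝ) ^ ε := by
          rw [← Real.rpow_natCast (P : ℝ) K, ← Real.rpow_mul hP0.le, ← Real.rpow_natCast _ K, ← Real.rpow_mul hP0.le]
          congr 1; rw [hε']; field_simp
        rw [mul_pow, this]; ring

lemma hua_mom {K : ℕ} {ε : ℝ} (hε : 0 < ε) (j : ℕ) (hjK : j + 1 ≤ K) (hK : 2 ≤ K) : ∃ C > (0 : ℝ),
    ∀ P : ℕ, 1 ≤ P → ∀ (Q : ℕ) [NeZero Q], 2 ^ (K + 2) * P ^ K ≤ Q →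
    ∑ a : ZMod Q, ‖TT Q K P [] a‖ ^ (2 ^ (j + 1)) ≤
      C * Q * (P : ℝ) ^ ((2 ^ (j + 1) : ℕ) - (j + 1 : ℕ) + ε : ℝ) := by
  obtain ⟨C1, hC1, hZ⟩ := Z1_real (K := K) (by omega) hε
  have hB : ∀ P : ℕ, 1 ≤ P → ((2 * P + 1 : ℕ) : ℝ) ≤ 3 * P := by
    intro P hP
    have : (1 : ℝ) ≤ P := by exact_mod_cast hP
    push_cast; linarith
  have hpr : ∀ P : ℕ, 1 ≤ P → ∀ (n : ℕ) (x : ℝ), (P : ℝ) ^ n * (P : ℝ) ^ x = (P : ℝ) ^ (n + x) := by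
    intro P hP n x
    rw [Real.rpow_add (by exact_mod_cast hP), Real.rpow_natCast]
  induction j with
  | zero =>
    refine ⟨2 * K * 3 + C1, by positivity, fun P hP Q _ hQ => ?_⟩
    have hP1 : (1 : ℝ) ≤ P := by exact_mod_cast hP
    have h := hua_count (Q := Q) (r := 0) (j := 1) (by omega : 1 < K) (by positivity) hP hQ (by positivity)
      (fun m hm hmb => hZ P hP 1 (by omega) m hm hmb)
    simp only [mul_zero, pow_zero, one_mul, Finset.sum_const, card_univ, ZMod.card, nsmul_eq_mul, mul_one, pow_one] at h
    calc _ ≤ ∑ a : ZMod Q, (∑ t ∈ UU P 1, TT Q K P t a).re := by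
          refine Finset.sum_le_sum fun a _ => ?_
          simpa using weyl_re Q K P 0 a
      _ ≤ _ := h
      _ ≤ (2 * K * (3 * P)) * Q + Q * (C1 * (P : ℝ) ^ ε) := by
          have := hB P hP
          push_cast at this ⊢
          gcongr
      _ ≤ (2 * K * (3 * (P : ℝ) ^ (1 + ε))) * Q + Q * (C1 * (P : ℝ) ^ (1 + ε)) := by
          have a1 : (P : ℝ) ≤ (P : ℝ) ^ (1 + ε) := Real.self_le_rpow_of_one_le hP1 (by linarith)
          have a2 : (P : ℝ) ^ ε ≤ (P : ℝ) ^ (1 + ε) := Real.rpow_le_rpow_of_exponent_le hP1 (by linarith)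
          gcongr
      _ = _ := by
          norm_num
          ring
  | succ j ih =>
    obtain ⟨C, hC, ih⟩ := ih (by omega)
    refine ⟨3 ^ (2 ^ (j + 1) - (j + 1) - 1) * (2 * K * 3 ^ (j + 1) * C + C1), by positivity, fun P hP Q _ hQ => ?_⟩
    have hP1 : (1 : ℝ) ≤ P := by exact_mod_cast hP
    have hBP := hB P hP
    have ih' := ih P hP Q hQ
    have h2j : 2 * 2 ^ j = 2 ^ (j + 1) := by ring
    have h := hua_count (Q := Q) (r := 2 ^ j) (j := j + 1) (by omega : j + 1 < K)
      (Nat.pow_le_pow_right (by norm_num) (by omega)) hP hQ (by positivity)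
      (fun m hm hmb => hZ P hP (j + 1) (by omega) m hm hmb)
    rw [h2j] at h
    set e := 2 ^ (j + 1) - (j + 1) - 1 with he
    have hee : 2 ^ (j + 1) = e + (j + 1) + 1 := by
      have : j + 1 + 1 ≤ 2 ^ (j + 1) := Nat.lt_two_pow_self
      omega
    calc _ ≤ ∑ a : ZMod Q, ((2 * P + 1 : ℕ) : ℝ) ^ e * (‖TT Q K P [] a‖ ^ (2 ^ (j + 1)) *
            (∑ t ∈ UU P (j + 1), TT Q K P t a).re) := by
          refine Finset.sum_le_sum fun a _ => ?_
          have := mul_le_mul_of_nonneg_left (weyl_re Q K P j a)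
            (show 0 ≤ ‖TT Q K P [] a‖ ^ (2 ^ (j + 1)) by positivity)
          rw [← pow_add, ← two_mul, mul_comm 2, ← pow_succ] at this
          rw [mul_left_comm]; exact this
      _ ≤ ((2 * P + 1 : ℕ) : ℝ) ^ e * ((2 * K * (2 * P + 1) ^ (j + 1) : ℕ) *
            ∑ a : ZMod Q, ‖TT Q K P [] a‖ ^ (2 ^ (j + 1)) + Q * ((P : ℝ) ^ (2 ^ (j + 1)) * (C1 * (P : ℝ) ^ ε))) := by
          rw [← Finset.mul_sum]; gcongr
      _ ≤ (3 * P : ℝ) ^ e * ((2 * K * (3 * P : ℝ) ^ (j + 1)) *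
            (C * Q * (P : ℝ) ^ ((2 ^ (j + 1) : ℕ) - (j + 1 : ℕ) + ε : ℝ)) +
            Q * ((P : ℝ) ^ (2 ^ (j + 1)) * (C1 * (P : ℝ) ^ ε))) := by
          have : ((2 * K * (2 * P + 1) ^ (j + 1) : ℕ) : ℝ) ≤ 2 * K * (3 * P : ℝ) ^ (j + 1) := by
            push_cast at hBP ⊢
            gcongr
          gcongr
      _ = 3 ^ e * Q * (2 * K * 3 ^ (j + 1) * C * ((P : ℝ) ^ (e + (j + 1)) *
            (P : ℝ) ^ ((2 ^ (j + 1) : ℕ) - (j + 1 : ℕ) + ε : ℝ)) + C1 * ((P : ℝ) ^ (e + 2 ^ (j + 1)) * (P : ℝ) ^ ε)) := by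
          rw [mul_pow, mul_pow, pow_add, pow_add]; ring
      _ = _ := by
          rw [hpr P hP, hpr P hP]
          have e1 : ((e + (j + 1) : ℕ) : ℝ) + ((2 ^ (j + 1) : ℕ) - (j + 1 : ℕ) + ε : ℝ) =
              ((2 ^ (j + 1 + 1) : ℕ) - (j + 1 + 1 : ℕ) + ε : ℝ) := by
            rw [pow_succ 2 (j + 1), hee]; push_cast; ring
          have e2 : ((e + 2 ^ (j + 1) : ℕ) : ℝ) + ε =
              ((2 ^ (j + 1 + 1) : ℕ) - (j + 1 + 1 : ℕ) + ε : ℝ) := by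
            rw [pow_succ 2 (j + 1), hee]; push_cast; ring
          rw [e1, e2]; ring

lemma majorant {B ι : Type} [AddCommGroup B] [Fintype B] {I I' : Finset ι} (hI : I ⊆ I') (b : ι → ℂ)
    (hb : ∀ i ∈ I, ‖b i‖ ≤ 1) (g : ι → AddChar B ℂ) :
    ∑ h, ‖∑ i ∈ I, b i * g i h‖ ^ 2 ≤ ∑ h, ‖∑ i ∈ I', g i h‖ ^ 2 := by
  have key : ∀ (b : ι → ℂ) (I : Finset ι), I ⊆ I' → ∑ h, ‖∑ i ∈ I, b i * g i h‖ ^ 2 =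
      ∑ γ ∈ I'.image g, (Fintype.card B : ℝ) * ‖∑ i ∈ I with g i = γ, b i‖ ^ 2 := by
    intro b I hI
    have h2 : ∀ h, ∑ i ∈ I, b i * g i h = ∑ γ ∈ I'.image g, (∑ i ∈ I with g i = γ, b i) * γ h := by
      intro h
      rw [← Finset.sum_fiberwise_of_maps_to (fun i hi => mem_image_of_mem g (hI hi))]
      refine Finset.sum_congr rfl fun γ _ => ?_
      rw [Finset.sum_mul]
      exact Finset.sum_congr rfl fun i hi => by rw [(mem_filter.1 hi).2]
    simp_rw [h2]
    rw [pyth (I'.image g) (fun γ h => (∑ i ∈ I with g i = γ, b i) * γ h)]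
    · refine Finset.sum_congr rfl fun γ _ => ?_
      simp [AddChar.norm_apply]
    · intro γ _ γ' _ hne
      exact orth hne (fun x h => by rw [AddChar.map_add_eq_mul]; ring)
        (fun x h => by rw [AddChar.map_add_eq_mul]; ring)
  have h1 := key (fun _ => 1) I' subset_rfl
  simp only [one_mul] at h1
  rw [key b I hI, h1]
  refine Finset.sum_le_sum fun γ _ => ?_
  gcongr
  calc _ ≤ ∑ i ∈ I with g i = γ, ‖b i‖ := norm_sum_le _ _
    _ ≤ ∑ i ∈ I with g i = γ, (1 : ℝ) := Finset.sum_le_sum fun i hi => hb i (mem_filter.1 hi).1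
    _ ≤ ∑ i ∈ I' with g i = γ, (1 : ℝ) := Finset.sum_le_sum_of_subset_of_nonneg
        (filter_subset_filter _ hI) (fun _ _ _ => zero_le_one)
    _ = _ := by
      rw [Finset.sum_const, Finset.sum_const, nsmul_eq_mul, nsmul_eq_mul, mul_one, mul_one, Complex.norm_natCast]

noncomputable def sc (Q : ℕ) [NeZero Q] (m : ℤ) : AddChar (ZMod Q) ℂ where
  toFun a := ZMod.stdAddChar (N := Q) ((m : ZMod Q) * a)
  map_zero_eq_one' := by simp
  map_add_eq_mul' := by intro a b; rw [← AddChar.map_add_eq_mul, mul_add]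

lemma sc_apply (Q : ℕ) [NeZero Q] (m : ℤ) (a : ZMod Q) :
    sc Q m a = ZMod.stdAddChar (N := Q) ((m : ZMod Q) * a) := rfl

theorem MV_hua (p : ℕ) {K : ℕ} (hK : 2 ≤ K) (j : ℕ) (hj : j + 1 ≤ K) : MV p K (2 ^ (j + 1)) (j + 1) := by
  intro ε hε
  obtain ⟨C, hC, h⟩ := hua_mom hε j hj hK
  refine ⟨C, hC, fun P hP => ?_⟩
  obtain ⟨Q, hQ⟩ : ∃ Q, Q = 2 ^ (K + 2) * P ^ K := ⟨_, rfl⟩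
  have hQ0 : NeZero Q := ⟨by rw [hQ]; positivity⟩
  refine ⟨Q, hQ0, fun S hS _ c hc => ?_⟩
  refine le_trans ?_ (h P hP Q hQ.ge)
  set r := 2 ^ j
  have hr : 2 ^ (j + 1) = r * 2 := by rw [pow_succ]
  rw [hr]
  have e1 : ∀ a : ZMod Q, (∑ n ∈ S, c n * ZMod.stdAddChar ((n : ZMod Q) ^ K * a)) ^ r =
      ∑ u ∈ Fintype.piFinset (fun _ : Fin r => S), (∏ i, c (u i)) * sc Q (ky K u) a := by
    intro a
    rw [Finset.sum_pow']
    refine Finset.sum_congr rfl fun u _ => ?_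
    rw [Finset.prod_mul_distrib, prod_std, sc_apply, ← Finset.sum_mul, ky]; push_cast; rfl
  have e2 : ∀ a : ZMod Q, TT Q K P [] a ^ r =
      ∑ u ∈ Fintype.piFinset (fun _ : Fin r => In P []), sc Q (ky K u) a := by
    intro a
    rw [TT, Finset.sum_pow']
    refine Finset.sum_congr rfl fun u _ => ?_
    rw [prod_std, sc_apply, ← Finset.sum_mul, ky]; simp [Dp]
  have hsub : Fintype.piFinset (fun _ : Fin r => S) ⊆ Fintype.piFinset (fun _ : Fin r => In P []) :=
    Fintype.piFinset_subset _ _ fun _ => hS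
  have h1 := majorant hsub (fun u => ∏ i, c (u i)) (fun u _ => by
    rw [norm_prod]; exact Finset.prod_le_one (fun _ _ => norm_nonneg _) fun i _ => hc _) (fun u => sc Q (ky K u))
  simp_rw [← e1, ← e2, norm_pow, ← pow_mul] at h1
  exact h1

end hua2
end VMV

namespace VMV
open Polynomial

lemma MV_triv (p K : ℕ) : MV p K 1 0 := by
  intro ε hε
  refine ⟨1, one_pos, fun P hP => ⟨1, inferInstance, fun S hS _ c hc => ?_⟩⟩
  have hP1 : (1 : ℝ) ≤ P := by exact_mod_cast hP
  have h : ∀ a : ZMod 1, ‖∑ n ∈ S, c n * ZMod.stdAddChar ((n : ZMod 1) ^ K * a)‖ ^ 1 ≤ (P : ℝ) := by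
    intro a
    rw [pow_one]
    calc _ ≤ ∑ n ∈ S, ‖c n * ZMod.stdAddChar ((n : ZMod 1) ^ K * a)‖ := norm_sum_le _ _
      _ ≤ ∑ n ∈ S, (1 : ℝ) := Finset.sum_le_sum fun n _ => by
          rw [norm_mul, AddChar.norm_apply, mul_one]; exact hc n
      _ = (S.card : ℝ) := by simp
      _ ≤ P := by
          have := card_le_card hS
          simp at this
          exact_mod_cast this
  refine (Finset.sum_le_sum fun a _ => h a).trans ?_
  rw [Finset.sum_const, card_univ, ZMod.card, one_nsmul]
  have : (P : ℝ) ^ (1 : ℝ) ≤ (P : ℝ) ^ (((1 : ℕ) : ℝ) - (0 : ℕ) + ε) :=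
    Real.rpow_le_rpow_of_exponent_le hP1 (by push_cast; linarith)
  rw [Real.rpow_one] at this
  simpa using this

noncomputable def kk (τ α : ℝ) : ℝ := 2 * τ ^ 2 * (1 + (τ * α) ^ 2)⁻¹

lemma kk_nonneg (τ α : ℝ) : 0 ≤ kk τ α := by unfold kk; positivity

lemma Kf_nonneg (τ α : ℝ) : 0 ≤ Kf τ α := by unfold Kf; split_ifs <;> positivity

lemma Kf_le (τ α : ℝ) : Kf τ α ≤ kk τ α := by
  have hpos : 0 < 1 + (τ * α) ^ 2 := by positivity
  unfold kk
  rw [← div_eq_mul_inv, le_div_iff₀ hpos]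
  unfold Kf
  split_ifs with h
  · rw [h]; nlinarith [sq_nonneg τ]
  · have hpi : 0 < Real.pi := Real.pi_pos
    have hα : 0 < Real.pi ^ 2 * α ^ 2 := by positivity
    rw [div_pow, div_mul_eq_mul_div, mul_pow Real.pi, div_le_iff₀ hα]
    have h1 : Real.sin (Real.pi * τ * α) ^ 2 ≤ 1 := Real.sin_sq_le_one _
    have h2 : Real.sin (Real.pi * τ * α) ^ 2 ≤ (Real.pi * τ * α) ^ 2 :=
      sq_le_sq.2 Real.abs_sin_le_abs
    have h3 : (1 : ℝ) ≤ Real.pi ^ 2 := by nlinarith [Real.pi_gt_three]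
    have h4 : Real.sin (Real.pi * τ * α) ^ 2 * (τ * α) ^ 2 ≤ 1 * (Real.pi ^ 2 * (τ * α) ^ 2) := by
      have : (τ * α) ^ 2 ≤ Real.pi ^ 2 * (τ * α) ^ 2 := le_mul_of_one_le_left (sq_nonneg _) h3
      exact mul_le_mul h1 this (sq_nonneg _) zero_le_one
    nlinarith

lemma kk_int {τ : ℝ} (hτ : 0 < τ) : Integrable (kk τ) := by
  unfold kk
  exact (integrable_inv_one_add_sq.comp_mul_left' hτ.ne').const_mul _

lemma kk_integral {τ : ℝ} (hτ : 0 < τ) : ∫ α, kk τ α = 2 * Real.pi * τ := by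
  unfold kk
  rw [integral_const_mul, MeasureTheory.Measure.integral_comp_mul_left (fun x : ℝ => (1 + x ^ 2)⁻¹) τ, integral_univ_inv_one_add_sq, abs_of_pos (by positivity), smul_eq_mul]
  field_simp

lemma kk_shift {τ U : ℝ} (hτ : 0 < τ) (hτ1 : τ < 1) (α u : ℝ) (hu : |u| ≤ U) :
    kk τ α ≤ (2 + 2 * U ^ 2) * kk τ (α + u) := by
  unfold kk
  have h1 : 0 < 1 + (τ * α) ^ 2 := by positivity
  have h2 : 0 < 1 + (τ * (α + u)) ^ 2 := by positivity
  have h3 : 1 + (τ * (α + u)) ^ 2 ≤ (2 + 2 * U ^ 2) * (1 + (τ * α) ^ 2) := by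
    have h4 : u ^ 2 ≤ U ^ 2 := sq_le_sq' (by linarith [neg_abs_le u]) (by linarith [le_abs_self u])
    have h5 : τ ^ 2 ≤ 1 := by nlinarith
    have h6 : τ ^ 2 * u ^ 2 ≤ 1 * U ^ 2 := mul_le_mul h5 h4 (sq_nonneg _) zero_le_one
    nlinarith [sq_nonneg (τ * (α - u)), mul_nonneg (sq_nonneg U) (sq_nonneg (τ * α))]
  rw [mul_left_comm]
  refine mul_le_mul_of_nonneg_left ?_ (by positivity)
  rw [← div_eq_mul_inv, le_div_iff₀ h2, ← div_eq_inv_mul, div_le_iff₀ h1]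
  exact h3

lemma avg {f : ℝ → ℝ} (hf : Continuous f) {B : ℝ} (hB : ∀ x, ‖f x‖ ≤ B) (h0 : ∀ x, 0 ≤ f x) {lam : ℝ} (hlam : lam ≠ 0)
    {Q : ℕ} [NeZero Q] {A : ℝ} (hA : ∀ β, ∑ a : ZMod Q, f (β + a.val / Q) ≤ Q * A)
    {τ : ℝ} (hτ : 0 < τ) (hτ1 : τ < 1) :
    ∫ α, f (lam * α) * kk τ α ≤ (2 + 2 * |lam|⁻¹ ^ 2) * (2 * Real.pi) * τ * A := by
  have hQ : (0 : ℝ) < Q := by exact_mod_cast NeZero.pos Q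
  set M := 2 + 2 * |lam|⁻¹ ^ 2
  have hi : ∀ b c : ℝ, Integrable fun α => f (lam * α + b) * kk τ (α + c) := fun b c =>
    ((kk_int hτ).comp_add_right c).bdd_mul (c := B) (by fun_prop) (Filter.Eventually.of_forall fun x => hB _)
  have h1 : ∀ a : ZMod Q, ∫ α, f (lam * α) * kk τ α ≤ M * ∫ α, f (lam * α + a.val / Q) * kk τ α := by
    intro a
    set u : ℝ := -(a.val / Q / lam) with hu
    have hub : |u| ≤ |lam|⁻¹ := by
      have : (a.val : ℝ) / Q ≤ 1 := by
        rw [div_le_one hQ]; exact_mod_cast (ZMod.val_lt a).le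
      rw [hu, abs_neg, abs_div, abs_of_nonneg (by positivity), ← one_div]
      gcongr
    calc _ ≤ ∫ α, M * (f (lam * α) * kk τ (α + u)) := by
          refine integral_mono (by simpa using hi 0 0) (by simpa using (hi 0 u).const_mul M) fun α => ?_
          have := mul_le_mul_of_nonneg_left (kk_shift hτ hτ1 α u hub) (h0 (lam * α))
          simp only; linarith
      _ = M * ∫ α, f (lam * α) * kk τ (α + u) := integral_const_mul _ _
      _ = M * ∫ α, f (lam * (α - u)) * kk τ (α - u + u) := by
          rw [integral_sub_right_eq_self (fun α => f (lam * α) * kk τ (α + u))]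
      _ = _ := by
          congr 1; congr 1; ext α
          rw [sub_add_cancel]; congr 2
          rw [hu]; field_simp; ring
  have h2 : (Q : ℝ) * ∫ α, f (lam * α) * kk τ α ≤ Q * (M * (2 * Real.pi) * τ * A) := by
    calc _ = ∑ a : ZMod Q, ∫ α, f (lam * α) * kk τ α := by
          rw [Finset.sum_const, card_univ, ZMod.card, nsmul_eq_mul]
      _ ≤ ∑ a : ZMod Q, M * ∫ α, f (lam * α + a.val / Q) * kk τ α := Finset.sum_le_sum fun a _ => h1 a
      _ = M * ∫ α, ∑ a : ZMod Q, f (lam * α + a.val / Q) * kk τ α := by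
          rw [integral_finsetSum _ (fun a _ => by simpa using hi (a.val / Q) 0), Finset.mul_sum]
      _ ≤ M * ∫ α, (Q * A) * kk τ α := by
          refine mul_le_mul_of_nonneg_left ?_ (by positivity)
          refine integral_mono (integrable_finsetSum _ (fun a _ => by simpa using hi (a.val / Q) 0)) ((kk_int hτ).const_mul _) fun α => ?_
          simp only [← Finset.sum_mul]
          exact mul_le_mul_of_nonneg_right (hA _) (kk_nonneg _ _)
      _ = _ := by rw [integral_const_mul, kk_integral hτ]; ring
  exact le_of_mul_le_mul_left h2 hQ

lemma e_norm (x : ℝ) : ‖e x‖ = 1 := by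
  rw [e, show (2 * Real.pi * Complex.I * x : ℂ) = ((2 * Real.pi * x : ℝ) : ℂ) * Complex.I by push_cast; ring]
  exact Complex.norm_exp_ofReal_mul_I _

lemma e_add (x y : ℝ) : e (x + y) = e x * e y := by
  rw [e, e, e, ← Complex.exp_add]; congr 1; push_cast; ring

lemma SS_cont (η X : ℝ) (k : ℕ) : Continuous (SS η X k) := by
  unfold SS e; fun_prop

lemma log_bd {ε : ℝ} (hε : 0 < ε) {P : ℝ} (hP : 1 ≤ P) : 1 + Real.log P ≤ (1 + 1 / ε) * P ^ ε := by
  have h1 := Real.log_le_rpow_div (by linarith : 0 ≤ P) hε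
  have h2 : 1 ≤ P ^ ε := Real.one_le_rpow hP hε.le
  rw [add_mul, one_div_mul_eq_div]; linarith

lemma SS_sup (k : ℕ) (η : ℝ) {ε : ℝ} (hε : 0 < ε) : ∃ C > (0 : ℝ), ∀ X ≥ (1 : ℝ), ∀ α,
    ‖SS η X k α‖ ≤ C * (X ^ ((1 : ℝ) / k)) ^ (1 + ε) := by
  refine ⟨1 + 1 / ε, by positivity, fun X hX α => ?_⟩
  set Y := X ^ ((1 : ℝ) / k) with hY
  have hY1 : 1 ≤ Y := Real.one_le_rpow hX (by positivity)
  unfold SS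
  calc _ ≤ ∑ p ∈ (Finset.Icc 1 ⌊Y⌋₊).filter (fun p : ℕ => p.Prime ∧ (η * X) ^ ((1:ℝ)/(k:ℝ)) ≤ (p : ℝ)), (1 + Real.log Y) := by
        refine norm_sum_le_of_le _ fun p hp => ?_
        have hp' := mem_Icc.1 (mem_filter.1 hp).1
        have hp1 : (1 : ℝ) ≤ p := by exact_mod_cast hp'.1
        have h2 : (p : ℝ) ≤ Y := (Nat.le_floor_iff (by linarith)).1 hp'.2
        rw [norm_mul, e_norm, mul_one, Complex.norm_real, Real.norm_of_nonneg (Real.log_nonneg hp1)]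
        have := Real.log_le_log (by linarith) h2
        linarith
    _ ≤ Y * (1 + Real.log Y) := by
        rw [Finset.sum_const, nsmul_eq_mul]
        have h0 : 0 ≤ Real.log Y := Real.log_nonneg hY1
        refine mul_le_mul_of_nonneg_right ?_ (by linarith)
        have h1 := Finset.card_filter_le (Finset.Icc 1 ⌊Y⌋₊) (fun p : ℕ => p.Prime ∧ (η * X) ^ ((1:ℝ)/(k:ℝ)) ≤ (p : ℝ))
        rw [Nat.card_Icc, Nat.add_sub_cancel] at h1
        exact le_trans (by exact_mod_cast h1) (Nat.floor_le (by linarith))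
    _ ≤ Y * ((1 + 1 / ε) * Y ^ ε) := mul_le_mul_of_nonneg_left (log_bd hε hY1) (by linarith)
    _ = _ := by rw [Real.rpow_add (by linarith), Real.rpow_one]; ring

lemma SS_mv {p k q t : ℕ} (hp : p.Prime) (hk : 1 ≤ k) (htq : t ≤ q) (h : MV p k q t) {η : ℝ} (hη : 0 < η) {ε : ℝ} (hε : 0 < ε) :
    ∃ C > (0 : ℝ), ∃ X0 : ℝ, ∀ X ≥ X0, ∃ Q : ℕ, ∃ _ : NeZero Q, ∀ β,
      ∑ a : ZMod Q, ‖SS η X k (β + a.val / Q)‖ ^ q ≤ Q * (C * (X ^ ((1 : ℝ) / k)) ^ ((q : ℝ) - t + ε)) := by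
  obtain ⟨C, hC, h⟩ := h (ε / 2) (by positivity)
  set ε1 := ε / (2 * (q + 1)) with hε1
  have hε10 : 0 < ε1 := by positivity
  refine ⟨(1 + 1 / ε1) ^ q * C, by positivity, max 1 ((p + 1 : ℝ) ^ k / η), fun X hX => ?_⟩
  have hX1 : 1 ≤ X := (le_max_left _ _).trans hX
  have hX2 : (p + 1 : ℝ) ^ k / η ≤ X := (le_max_right _ _).trans hX
  have hk0 : (k : ℝ) ≠ 0 := by positivity
  set Y := X ^ ((1 : ℝ) / k) with hY
  have hY1 : 1 ≤ Y := Real.one_le_rpow hX1 (by positivity)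
  set P := ⌊Y⌋₊ with hP
  have hP1 : 1 ≤ P := Nat.one_le_floor_iff _ |>.2 hY1
  have hP1' : (1 : ℝ) ≤ P := by exact_mod_cast hP1
  have hPY : (P : ℝ) ≤ Y := Nat.floor_le (by linarith)
  have hpX : (p + 1 : ℝ) ≤ (η * X) ^ ((1 : ℝ) / k) := by
    rw [div_le_iff₀ hη, mul_comm] at hX2
    have := Real.rpow_le_rpow (by positivity) hX2 (show 0 ≤ (1 : ℝ) / k by positivity)
    rwa [← Real.rpow_natCast, ← Real.rpow_mul (by positivity), mul_one_div_cancel hk0, Real.rpow_one] at this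
  set S0 := (Finset.Icc 1 P).filter (fun p : ℕ => p.Prime ∧ (η * X) ^ ((1:ℝ)/(k:ℝ)) ≤ (p : ℝ)) with hS0
  set L : ℝ := 1 + Real.log P with hL
  have hL1 : 1 ≤ L := by have := Real.log_nonneg hP1'; linarith
  have hLC : (L : ℂ) ≠ 0 := by exact_mod_cast (by linarith : L ≠ 0)
  obtain ⟨Q, hQ0, h⟩ := h P hP1
  refine ⟨Q, hQ0, fun β => ?_⟩
  have hQ : (0 : ℝ) < Q := by exact_mod_cast NeZero.pos Q
  have hmem : ∀ n ∈ S0.map Nat.castEmbedding, ∃ l : ℕ, (l : ℤ) = n ∧ l ∈ S0 := by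
    intro n hn
    obtain ⟨l, hl, rfl⟩ := mem_map.1 hn
    exact ⟨l, rfl, hl⟩
  set c : ℤ → ℂ := fun n => if 1 ≤ n ∧ n ≤ P then (Real.log n : ℂ) / L * e ((n : ℝ) ^ k * β) else 0 with hc
  have hcn : ∀ n, ‖c n‖ ≤ 1 := by
    intro n
    rw [hc]; dsimp only
    split_ifs with hn
    · have h1 : (1 : ℝ) ≤ n := by exact_mod_cast hn.1
      have h2 : (n : ℝ) ≤ P := by exact_mod_cast hn.2
      rw [norm_mul, e_norm, mul_one, norm_div, Complex.norm_real, Complex.norm_real, Real.norm_of_nonneg (Real.log_nonneg h1),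
        Real.norm_of_nonneg (by linarith), div_le_one (by linarith)]
      have := Real.log_le_log (by linarith) h2
      linarith
    · simp
  have hmain := h (S0.map Nat.castEmbedding) (by
      intro n hn
      obtain ⟨l, rfl, hl⟩ := hmem n hn
      have := mem_Icc.1 (mem_filter.1 hl).1
      exact mem_Icc.2 ⟨by exact_mod_cast this.1, by exact_mod_cast this.2⟩) (by
      intro n hn hd
      obtain ⟨l, rfl, hl⟩ := hmem n hn
      have hl2 := (mem_filter.1 hl).2
      have : p = l := (Nat.prime_dvd_prime_iff_eq hp hl2.1).1 (by exact_mod_cast hd)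
      have h3 := hl2.2
      rw [← this] at h3; linarith) c hcn
  have hS : ∀ a : ZMod Q, SS η X k (β + a.val / Q) =
      L * ∑ n ∈ S0.map Nat.castEmbedding, c n * ZMod.stdAddChar ((n : ZMod Q) ^ k * a) := by
    intro a
    rw [Finset.sum_map, Finset.mul_sum, SS]
    refine Finset.sum_congr rfl fun l hl => ?_
    have hl' := mem_Icc.1 (mem_filter.1 hl).1
    have h1 : ((Nat.castEmbedding l : ℤ) : ZMod Q) ^ k * a = ((l ^ k * a.val : ℤ) : ZMod Q) := by
      simp
    rw [h1, ZMod.stdAddChar_coe, hc]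
    dsimp only
    rw [if_pos (by exact ⟨by simpa using hl'.1, by simpa using hl'.2⟩), mul_add, e_add]
    have h2 : e ((l : ℝ) ^ k * (a.val / Q)) = Complex.exp (2 * Real.pi * Complex.I * ((l ^ k * a.val : ℤ) : ℂ) / Q) := by
      rw [e]; congr 1; push_cast; ring
    rw [← h2]
    simp only [Nat.castEmbedding_apply, Int.cast_natCast]
    field_simp
  simp_rw [hS, norm_mul, mul_pow]
  rw [← Finset.mul_sum, Complex.norm_real, Real.norm_of_nonneg (by linarith)]
  calc _ ≤ ((1 + 1 / ε1) * (P : ℝ) ^ ε1) ^ q * (C * Q * (P : ℝ) ^ ((q : ℝ) - t + ε / 2)) := by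
        gcongr
        exact log_bd hε10 hP1'
    _ = Q * ((1 + 1 / ε1) ^ q * C * (P : ℝ) ^ (ε1 * q + ((q : ℝ) - t + ε / 2))) := by
        rw [Real.rpow_add (by linarith) (ε1 * q), Real.rpow_mul (by linarith), Real.rpow_natCast, mul_pow]; ring
    _ ≤ Q * ((1 + 1 / ε1) ^ q * C * (P : ℝ) ^ ((q : ℝ) - t + ε)) := by
        have : ε1 * q + ((q : ℝ) - t + ε / 2) ≤ (q : ℝ) - t + ε := by
          have : ε1 * q ≤ ε / 2 := by
            rw [hε1, div_mul_eq_mul_div, div_le_div_iff₀ (by positivity) (by positivity)]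
            nlinarith
          linarith
        gcongr
    _ ≤ _ := by
        have : (t : ℝ) ≤ q := by exact_mod_cast htq
        gcongr

lemma I_bound {p k q t : ℕ} (hp : p.Prime) (hk : 1 ≤ k) (htq : t ≤ q) (h : MV p k q t) {η : ℝ} (hη : 0 < η)
    {lam : ℝ} (hlam : lam ≠ 0) {ε : ℝ} (hε : 0 < ε) :
    ∃ C > (0 : ℝ), ∃ X0 : ℝ, ∀ X ≥ X0, ∀ τ, 0 < τ → τ < 1 →
      ∫ α, ‖SS η X k (lam * α)‖ ^ q * kk τ α ≤ C * τ * (X ^ ((1 : ℝ) / k)) ^ ((q : ℝ) - t + ε) := by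
  obtain ⟨C, hC, X0, h⟩ := SS_mv hp hk htq h hη hε
  obtain ⟨C', hC', h'⟩ := SS_sup k η hε
  refine ⟨(2 + 2 * |lam|⁻¹ ^ 2) * (2 * Real.pi) * C, by have := Real.pi_pos; positivity, max X0 1, fun X hX τ hτ hτ1 => ?_⟩
  obtain ⟨Q, hQ, h⟩ := h X ((le_max_left _ _).trans hX)
  have := avg (f := fun x => ‖SS η X k x‖ ^ q) (by have := SS_cont η X k; fun_prop)
    (B := (C' * (X ^ ((1 : ℝ) / k)) ^ (1 + ε)) ^ q) (fun x => by
      rw [norm_pow, norm_norm]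
      exact pow_le_pow_left₀ (norm_nonneg _) (h' X ((le_max_right _ _).trans hX) x) _)
    (fun x => by positivity) hlam h hτ hτ1
  refine this.trans (le_of_eq ?_); ring

lemma interp {p k q0 q1 j : ℕ} (hp : p.Prime) (hk : 1 ≤ k) (h0 : j ≤ q0) (h1 : j + 1 ≤ q1)
    (hm0 : MV p k q0 j) (hm1 : MV p k q1 (j + 1)) {η : ℝ} (hη : 0 < η) {lam : ℝ} (hlam : lam ≠ 0)
    {δ θ m : ℝ} (hθ : k * δ = j + θ) (hθ0 : 0 ≤ θ) (hθ1 : θ ≤ 1) (hm : (1 - θ) * q0 + θ * q1 ≤ m)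
    {ε : ℝ} (hε : 0 < ε) :
    ∃ C > (0:ℝ), ∃ X₀ : ℝ, ∀ X ≥ X₀, ∀ τ : ℝ, 0 < τ → τ < 1 →
      (∫ α : ℝ, ‖SS η X k (lam * α)‖ ^ m * Kf τ α) ≤ C * τ * X ^ (m / (k:ℝ) - δ + ε) := by
  have hk0 : (0 : ℝ) < k := by exact_mod_cast hk
  set m' := (1 - θ) * q0 + θ * q1 with hm'
  have hm'0 : 0 ≤ m' := by
    have : 0 ≤ 1 - θ := by linarith
    positivity
  have hd : 0 < m - m' + 1 := by linarith
  set ε1 := k * ε / (m - m' + 1) with hε1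
  have hε10 : 0 < ε1 := by positivity
  obtain ⟨C, hC, hsup⟩ := SS_sup k η hε10
  obtain ⟨C0, hC0, X0, hb0⟩ := I_bound hp hk h0 hm0 hη hlam hε10
  obtain ⟨C1, hC1, X1, hb1⟩ := I_bound hp hk h1 hm1 hη hlam hε10
  refine ⟨C ^ (m - m') * (C0 + C1), by positivity, max 1 (max X0 X1), fun X hX τ hτ hτ1 => ?_⟩
  have hX1 : 1 ≤ X := (le_max_left _ _).trans hX
  have hb0 := hb0 X ((le_max_left _ _).trans ((le_max_right _ _).trans hX)) τ hτ hτ1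
  have hb1 := hb1 X ((le_max_right _ _).trans ((le_max_right _ _).trans hX)) τ hτ hτ1
  have hsup := hsup X hX1
  have hfin : ∀ x : ℝ, X ^ (x / k) = (X ^ ((1 : ℝ) / k)) ^ x := by
    intro x; rw [← Real.rpow_mul (by linarith)]; congr 1; ring
  have hY1 : 1 ≤ X ^ ((1 : ℝ) / k) := Real.one_le_rpow hX1 (by positivity)
  have hE : X ^ (m / (k:ℝ) - δ + ε) = (X ^ ((1 : ℝ) / k)) ^ (m - (j + θ) + k * ε) := by
    rw [← hfin, ← hθ]; congr 1; field_simp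
  rw [hE]
  set Y := X ^ ((1 : ℝ) / k) with hY
  have hY0 : 0 < Y := by linarith
  set D : ℝ := (C * Y ^ (1 + ε1)) ^ (m - m') * Y ^ (m' - (j + θ)) with hD
  have hD0 : 0 < D := by positivity
  have hint : ∀ q : ℕ, Integrable fun α => ‖SS η X k (lam * α)‖ ^ q * kk τ α := fun q =>
    (kk_int hτ).bdd_mul (c := (C * Y ^ (1 + ε1)) ^ q) (by have := SS_cont η X k; fun_prop)
      (Filter.Eventually.of_forall fun x => by
        rw [norm_pow, norm_norm]; exact pow_le_pow_left₀ (norm_nonneg _) (hsup _) _)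
  have hpt : ∀ s : ℝ, 0 ≤ s → s ≤ C * Y ^ (1 + ε1) →
      s ^ m ≤ D * (Y ^ (-((q0 : ℝ) - j)) * s ^ q0 + Y ^ (-((q1 : ℝ) - (j + 1))) * s ^ q1) := by
    intro s hs hsC
    have a1 : s ^ m = s ^ m' * s ^ (m - m') := by
      rw [← Real.rpow_add_of_nonneg hs hm'0 (by linarith)]; congr 1; ring
    have a2 : s ^ (m - m') ≤ (C * Y ^ (1 + ε1)) ^ (m - m') := Real.rpow_le_rpow hs hsC (by linarith)
    have hA : 0 ≤ Y ^ (-((q0 : ℝ) - j)) * s ^ q0 := by positivity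
    have hB : 0 ≤ Y ^ (-((q1 : ℝ) - (j + 1))) * s ^ q1 := by positivity
    have a3 := Real.geom_mean_le_arith_mean2_weighted (by linarith : 0 ≤ 1 - θ) hθ0 hA hB (by ring)
    have a4 : (Y ^ (-((q0 : ℝ) - j)) * s ^ q0) ^ (1 - θ) * (Y ^ (-((q1 : ℝ) - (j + 1))) * s ^ q1) ^ θ =
        Y ^ (-(m' - (j + θ))) * s ^ m' := by
      rw [Real.mul_rpow (by positivity) (by positivity), Real.mul_rpow (by positivity) (by positivity),
        ← Real.rpow_natCast s, ← Real.rpow_natCast s, ← Real.rpow_mul hs, ← Real.rpow_mul hs, ← Real.rpow_mul hY0.le,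
        ← Real.rpow_mul hY0.le, mul_mul_mul_comm, ← Real.rpow_add hY0,
        ← Real.rpow_add_of_nonneg hs (mul_nonneg (by positivity) (by linarith)) (by positivity)]
      congr 2 <;> rw [hm'] <;> ring
    rw [a4, Real.rpow_neg hY0.le] at a3
    have a5 : s ^ m' ≤ Y ^ (m' - (j + θ)) * (Y ^ (-((q0 : ℝ) - j)) * s ^ q0 + Y ^ (-((q1 : ℝ) - (j + 1))) * s ^ q1) := by
      rw [← inv_mul_le_iff₀ (by positivity)]
      refine a3.trans ?_
      nlinarith
    calc _ = s ^ m' * s ^ (m - m') := a1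
      _ ≤ _ := mul_le_mul a5 a2 (by positivity) (by positivity)
      _ = _ := by rw [hD]; ring
  calc _ ≤ ∫ α, D * (Y ^ (-((q0 : ℝ) - j)) * (‖SS η X k (lam * α)‖ ^ q0 * kk τ α) +
          Y ^ (-((q1 : ℝ) - (j + 1))) * (‖SS η X k (lam * α)‖ ^ q1 * kk τ α)) := by
        refine integral_mono_of_nonneg (Filter.Eventually.of_forall fun α => ?_)
          ((((hint q0).const_mul _).add ((hint q1).const_mul _)).const_mul _)
          (Filter.Eventually.of_forall fun α => ?_)
        · exact mul_nonneg (by positivity) (Kf_nonneg _ _)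
        · have := mul_le_mul (hpt _ (norm_nonneg _) (hsup (lam * α))) (Kf_le τ α) (Kf_nonneg _ _) (by positivity)
          refine this.trans (le_of_eq ?_); simp only; ring
    _ = D * (Y ^ (-((q0 : ℝ) - j)) * (∫ α, ‖SS η X k (lam * α)‖ ^ q0 * kk τ α) +
          Y ^ (-((q1 : ℝ) - (j + 1))) * (∫ α, ‖SS η X k (lam * α)‖ ^ q1 * kk τ α)) := by
        rw [integral_const_mul, integral_add ((hint q0).const_mul _) ((hint q1).const_mul _), integral_const_mul, integral_const_mul]
    _ ≤ D * (Y ^ (-((q0 : ℝ) - j)) * (C0 * τ * Y ^ ((q0 : ℝ) - j + ε1)) +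
          Y ^ (-((q1 : ℝ) - (j + 1))) * (C1 * τ * Y ^ ((q1 : ℝ) - (j + 1 : ℕ) + ε1))) := by gcongr
    _ = D * ((C0 + C1) * τ * Y ^ ε1) := by
        have b0 : Y ^ (-((q0 : ℝ) - j)) * Y ^ ((q0 : ℝ) - j + ε1) = Y ^ ε1 := by
          rw [← Real.rpow_add hY0]; congr 1; ring
        have b1 : Y ^ (-((q1 : ℝ) - (j + 1))) * Y ^ ((q1 : ℝ) - (j + 1 : ℕ) + ε1) = Y ^ ε1 := by
          rw [← Real.rpow_add hY0]; congr 1; push_cast; ring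
        linear_combination D * C0 * τ * b0 + D * C1 * τ * b1
    _ = C ^ (m - m') * (C0 + C1) * τ * (Y ^ ((1 + ε1) * (m - m')) * Y ^ (m' - (j + θ)) * Y ^ ε1) := by
        rw [hD, Real.mul_rpow hC.le (by positivity), ← Real.rpow_mul hY0.le]; ring
    _ = _ := by
        rw [← Real.rpow_add hY0, ← Real.rpow_add hY0]
        congr 2
        have : ε1 * (m - m' + 1) = k * ε := by rw [hε1]; field_simp
        linarith

lemma final (k : ℕ) (hk : 5 ≤ k) (lam : ℝ) (hlam : lam ≠ 0)
    (δ : ℝ) (hδ : 0 < δ) (hδ1 : δ < 1) (ε : ℝ) (hε : 0 < ε) (η : ℝ) (hη : 0 < η) :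
    ∃ C > (0:ℝ), ∃ X₀ : ℝ, ∀ X ≥ X₀, ∀ τ : ℝ, 0 < τ → τ < 1 →
      (∫ α : ℝ, ‖SS η X k (lam * α)‖ ^ (mδ k δ) * Kf τ α) ≤ C * τ * X ^ (mδ k δ / (k:ℝ) - δ + ε) := by
  obtain ⟨p, hpk, hp⟩ := Nat.exists_infinite_primes (k + 1)
  haveI : Fact p.Prime := ⟨hp⟩
  have hk0 : (0 : ℝ) < k := by positivity
  have hfl : 0 ≤ ⌊(k:ℝ) * δ⌋ := Int.floor_nonneg.2 (by positivity)
  obtain ⟨j, hj⟩ := Int.eq_ofNat_of_zero_le hfl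
  have hj' : ⌊(k:ℝ) * δ⌋ = (j : ℤ) := hj
  have hlo := Int.floor_le ((k:ℝ) * δ)
  have hhi := Int.lt_floor_add_one ((k:ℝ) * δ)
  rw [hj'] at hlo hhi
  push_cast at hlo hhi
  have hjk : j + 1 ≤ k := by
    have : (j : ℝ) < k := by nlinarith
    exact_mod_cast this
  set θ := (k:ℝ) * δ - j with hθ
  have hθ0 : 0 ≤ θ := by linarith
  have hθ1 : θ ≤ 1 := by linarith
  have ht : (k:ℝ) * δ = j + θ := by rw [hθ]; ring
  have hk1 : 1 ≤ k := by omega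
  unfold mδ
  rw [Int.floor_sub_one, hj']
  split_ifs with c1 c2
  · have hj3 : j ≤ 3 := by exact_mod_cast c1
    have hm0 : MV p k (2 ^ j) j := by
      rcases j with _ | j
      · exact MV_triv p k
      · exact MV_hua p (by omega) j (by omega)
    refine interp hp hk1 Nat.lt_two_pow_self.le Nat.lt_two_pow_self.le hm0 (MV_hua p (by omega) j hjk) hη hlam ht hθ0 hθ1 ?_ hε
    have hc := Int.le_ceil (((k:ℝ) * δ + 1 - ((j : ℤ) : ℝ)) * (2:ℝ) ^ ((j : ℤ) - 1))
    have h2 : (2 : ℝ) ^ ((j : ℤ) - 1) = 2 ^ j / 2 := by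
      rw [zpow_sub₀ (by norm_num), zpow_natCast, zpow_one]
    have h3 : ((k:ℝ) * δ + 1 - ((j : ℤ) : ℝ)) * (2:ℝ) ^ ((j : ℤ) - 1) = (1 + θ) * 2 ^ j / 2 := by
      rw [h2, ht]; push_cast; ring
    have h4 : (1 - θ) * ((2 ^ j : ℕ) : ℝ) + θ * ((2 ^ (j + 1) : ℕ) : ℝ) = (1 + θ) * 2 ^ j := by push_cast; ring
    rw [h4]
    linarith
  · have hj4 : j = 4 := by exact_mod_cast c2
    subst hj4
    refine interp hp hk1 (by norm_num) (by norm_num) (MV_hua p (by omega) 3 (by omega)) (MV_vin (s := 5) (by omega) (by omega) (by omega)) hη hlam ht hθ0 hθ1 ?_ hε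
    have hc := Int.le_ceil (7 * (k:ℝ) * δ - 20)
    push_cast at ht ⊢
    nlinarith
  · have hj5 : 5 ≤ j := by
      have : ¬ ((j : ℤ) = 4) := c2
      omega
    refine interp hp hk1 (by nlinarith) (by nlinarith) (MV_vin (s := j) (by omega) (by omega) (by omega)) (MV_vin (s := j + 1) (by omega) hjk (by omega)) hη hlam ht hθ0 hθ1 ?_ hε
    have hc := Int.le_ceil (((k:ℝ) * δ - ((j : ℤ) : ℝ)/2) * (((j : ℤ) : ℝ) + 1))
    have h3 : ((k:ℝ) * δ - ((j : ℤ) : ℝ)/2) * (((j : ℤ) : ℝ) + 1) * 2 = (1 - θ) * ((j * (j + 1) : ℕ) : ℝ) + θ * (((j + 1) * (j + 1 + 1) : ℕ) : ℝ) := by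
      rw [ht]; push_cast; ring
    linarith

end VMV

/-- moment estimate for `S_k` (Li–Wang). -/
theorem Sk_moment_bound (k : ℕ) (hk : 5 ≤ k) (lam : ℝ) (hlam : lam ≠ 0)
    (δ : ℝ) (hδ : 0 < δ) (hδ1 : δ < 1) (ε : ℝ) (hε : 0 < ε)
    (η : ℝ) (hη : 0 < η) (hη1 : η < 1) :
    ∃ C > (0:ℝ), ∃ X₀ : ℝ, ∀ X ≥ X₀, ∀ τ : ℝ, 0 < τ → τ < 1 →
      (∫ α : ℝ, ‖SS η X k (lam * α)‖ ^ (mδ k δ) * Kf τ α)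
        ≤ C * τ * X ^ (mδ k δ / (k:ℝ) - δ + ε) := by
  exact VMV.final k hk lam hlam δ hδ hδ1 ε hε η hη
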